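/- Let G be a finite simple graph with maximum degree Δ(G) ≥ 9 that is chair-free, i.e., G contains no induced subgraph isomorphic to the chair. Then χ(G) ≤ max{Δ(G) − 1, ω(G)}. -/

import Mathlib

open SimpleGraph

/-- The chair (fork): vertices `0,1,2,3,4` with edges
`01, 12, 23, 24`, i.e. the claw with one edge subdivided. -/
def chairGraph : SimpleGraph (Fin 5) :=
  SimpleGraph.fromRel (fun a b =>
    (a = 0 ∧ b = 1) ∨ (a = 1 ∧ b = 2) ∨ (a = 2 ∧ b = 3) ∨ (a = 2 ∧ b = 4))

open SimpleGraph
namespace BK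
section
open scoped Classical
variable {V : Type*} [Fintype V] {G : SimpleGraph V} {k : ℕ}

/-- `f` is a proper colouring of `G - v`. -/
def P1 (G : SimpleGraph V) (v : V) (f : V → Fin k) : Prop :=
  ∀ x y, x ≠ v → y ≠ v → G.Adj x y → f x ≠ f y

structure Crit (G : SimpleGraph V) (k : ℕ) : Prop where
  noCol : ∀ f : V → Fin k, ∃ x y, G.Adj x y ∧ f x = f y
  del : ∀ v, ∃ f : V → Fin k, P1 G v f
  deg : ∀ v (s : Finset V), (∀ x ∈ s, G.Adj v x) → s.card ≤ k + 1
  clq : ∀ s : Finset V, (∀ x ∈ s, ∀ y ∈ s, x ≠ y → G.Adj x y) → s.card ≤ k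
  chair : ∀ w a v b c, G.Adj w a → G.Adj a v → G.Adj v b → G.Adj v c → b ≠ c →
    ¬ G.Adj w v → ¬ G.Adj w b → ¬ G.Adj w c → ¬ G.Adj a b → ¬ G.Adj a c → ¬ G.Adj b c → False
  k8 : 8 ≤ k

def Uniq (G : SimpleGraph V) (f : V → Fin k) (v u : V) : Prop :=
  G.Adj v u ∧ ∀ x, G.Adj v x → f x = f u → x = u

def Rep (G : SimpleGraph V) (f : V → Fin k) (v u : V) (c : Fin k) : Prop :=
  ∃ x y, x ≠ y ∧ x ≠ v ∧ y ≠ v ∧ G.Adj u x ∧ G.Adj u y ∧ f x = c ∧ f y = c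

/-- counting: if `N` has at most `|C|` elements and `C ⊆ f(N)`, then `f` is injective on `N`. -/
lemma count_inj {α β : Type*} (N : Finset α) (C : Finset β) (f : α → β)
    (hC : ∀ c ∈ C, ∃ x ∈ N, f x = c) (hN : N.card ≤ C.card) :
    ∀ x ∈ N, ∀ y ∈ N, f x = f y → x = y := by
  have h1 : C ⊆ N.image f := by
    intro c hc; obtain ⟨x, hx, rfl⟩ := hC c hc; exact Finset.mem_image_of_mem f hx
  have h2 : (N.image f).card = N.card :=
    le_antisymm Finset.card_image_le (hN.trans (Finset.card_le_card h1))
  have := Finset.card_image_iff.mp h2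
  intro x hx y hy h
  exact this hx hy h

lemma count_pair {α β : Type*} (N : Finset α) (C : Finset β) (f : α → β)
    (hC : ∀ c ∈ C, ∃ x ∈ N, f x = c) (hN : N.card ≤ C.card + 1)
    {x1 x2 y1 y2 : α} (hx1 : x1 ∈ N) (hx2 : x2 ∈ N) (hy1 : y1 ∈ N) (hy2 : y2 ∈ N)
    (hx : x1 ≠ x2) (hy : y1 ≠ y2) (fx : f x1 = f x2) (fy : f y1 = f y2) :
    (x1 = y1 ∧ x2 = y2) ∨ (x1 = y2 ∧ x2 = y1) := by
  have key : ∀ a ∈ N, ∀ b ∈ N, a ≠ b → f a = f b → ∀ x ∈ N, ∀ y ∈ N, x ≠ a → y ≠ a →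
      f x = f y → x = y := by
    intro a ha b hb hab fab x hx y hy hxa hya fxy
    refine count_inj (N.erase a) C f ?_ ?_ x (by simp [*]) y (by simp [*]) fxy
    · intro c hc
      obtain ⟨z, hz, rfl⟩ := hC c hc
      by_cases h : z = a
      · exact ⟨b, by simp [hb, hab.symm], by rw [h, fab]⟩
      · exact ⟨z, by simp [hz, h], rfl⟩
    · rw [Finset.card_erase_of_mem ha]; omega
  have k1 := key x1 hx1 x2 hx2 hx fx y1 hy1 y2 hy2
  have k2 := key x2 hx2 x1 hx1 hx.symm fx.symm y1 hy1 y2 hy2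
  by_contra hcon
  grind

noncomputable def nb (G : SimpleGraph V) (v : V) : Finset V := Finset.univ.filter (fun x => G.Adj v x)

lemma P1.ne {v : V} {f : V → Fin k} (h : P1 G v f) {x y : V} (hx : x ≠ v) (hy : y ≠ v)
    (e : f x = f y) : ¬ G.Adj x y := fun ha => h x y hx hy ha e
end
end BK

open SimpleGraph
namespace BK
section
open scoped Classical
variable {V : Type*} [Fintype V] {G : SimpleGraph V} {k : ℕ}

lemma mem_nb {v x : V} : x ∈ nb G v ↔ G.Adj v x := by simp [nb]

lemma sees (C : Crit G k) {v : V} {f : V → Fin k} (hf : P1 G v f) (c : Fin k) :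
    ∃ x, G.Adj v x ∧ f x = c := by
  by_contra hcon
  push Not at hcon
  obtain ⟨x, y, hxy, h⟩ := C.noCol (fun z => if z = v then c else f z)
  have := hxy.ne
  have h2 := hxy.symm
  simp only [P1] at hf
  grind

lemma pairs (C : Crit G k) {v : V} {f : V → Fin k} (hf : P1 G v f)
    {x1 x2 y1 y2 : V} (hx1 : G.Adj v x1) (hx2 : G.Adj v x2) (hy1 : G.Adj v y1) (hy2 : G.Adj v y2)
    (hx : x1 ≠ x2) (hy : y1 ≠ y2) (fx : f x1 = f x2) (fy : f y1 = f y2) :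
    (x1 = y1 ∧ x2 = y2) ∨ (x1 = y2 ∧ x2 = y1) := by
  refine count_pair (nb G v) (Finset.univ : Finset (Fin k)) f ?_ ?_ (mem_nb.2 hx1) (mem_nb.2 hx2)
    (mem_nb.2 hy1) (mem_nb.2 hy2) hx hy fx fy
  · intro c _
    obtain ⟨x, hx, h⟩ := sees C hf c
    exact ⟨x, mem_nb.2 hx, h⟩
  · have := C.deg v (nb G v) (fun x hx => mem_nb.1 hx)
    simpa using this

lemma shift {v u : V} {f : V → Fin k} (hf : P1 G v f) (hu : Uniq G f v u) :
    P1 G u (Function.update f v (f u)) := by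
  intro x y hx hy hxy
  have := hxy.ne
  have h2 := hxy.symm
  have h3 := hu.1.ne
  simp only [P1, Uniq] at hf hu
  simp only [Function.update_apply]
  grind

lemma S1 (C : Crit G k) {v u : V} {f : V → Fin k} (hf : P1 G v f) (hu : Uniq G f v u)
    {c : Fin k} (hc : c ≠ f u) : ∃ x, G.Adj u x ∧ x ≠ v ∧ f x = c := by
  obtain ⟨x, hx, h⟩ := sees C (shift hf hu) c
  simp only [Function.update_apply] at h
  grind

lemma S2 (C : Crit G k) {v u : V} {f : V → Fin k} (hf : P1 G v f) (hu : Uniq G f v u)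
    {x1 x2 y1 y2 : V} (hx1 : G.Adj u x1) (hx2 : G.Adj u x2) (hy1 : G.Adj u y1) (hy2 : G.Adj u y2)
    (vx1 : x1 ≠ v) (vx2 : x2 ≠ v) (vy1 : y1 ≠ v) (vy2 : y2 ≠ v)
    (hx : x1 ≠ x2) (hy : y1 ≠ y2) (fx : f x1 = f x2) (fy : f y1 = f y2) :
    (x1 = y1 ∧ x2 = y2) ∨ (x1 = y2 ∧ x2 = y1) := by
  refine pairs C (shift hf hu) hx1 hx2 hy1 hy2 hx hy ?_ ?_ <;> simp [Function.update_apply, *]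

lemma S2' (C : Crit G k) {v u : V} {f : V → Fin k} (hf : P1 G v f) (hu : Uniq G f v u)
    {c d : Fin k} (h1 : Rep G f v u c) (h2 : Rep G f v u d) : c = d := by
  obtain ⟨x, y, a1, a2, a3, a4, a5, a6, a7⟩ := h1
  obtain ⟨x', y', b1, b2, b3, b4, b5, b6, b7⟩ := h2
  have := S2 C hf hu a4 a5 b4 b5 a2 a3 b2 b3 a1 b1 (by grind) (by grind)
  grind

lemma not_rep {f : V → Fin k} {v u : V} {c : Fin k} (h : ¬ Rep G f v u c)
    {x y : V} (h1 : G.Adj u x) (h2 : G.Adj u y) (hx : x ≠ v) (hy : y ≠ v) (fx : f x = c)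
    (fy : f y = c) : x = y := by
  by_contra hne
  exact h ⟨x, y, hne, hx, hy, h1, h2, fx, fy⟩

def Closed (G : SimpleGraph V) (S : Set V) (f : V → Fin k) (i j : Fin k) (T : V → Prop) : Prop :=
  ∀ x y, T x → G.Adj x y → x ∉ S → y ∉ S → (f x = i ∨ f x = j) → (f y = i ∨ f y = j) → T y

noncomputable def swp (f : V → Fin k) (i j : Fin k) (T : V → Prop) : V → Fin k :=
  fun x => if T x then (if f x = i then j else if f x = j then i else f x) else f x

lemma swp_po {S : Set V} {f : V → Fin k} {i j : Fin k} {T : V → Prop}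
    (hf : ∀ x y, x ∉ S → y ∉ S → G.Adj x y → f x ≠ f y) (hT : Closed G S f i j T) :
    ∀ x y, x ∉ S → y ∉ S → G.Adj x y → swp f i j T x ≠ swp f i j T y := by
  intro x y hx hy hxy
  have h1 := hf x y hx hy hxy
  have h2 := hT x y
  have h3 := hT y x
  have h4 := hxy.symm
  simp only [swp]
  grind

lemma swp_p1 {v : V} {f : V → Fin k} {i j : Fin k} {T : V → Prop}
    (hf : P1 G v f) (hT : Closed G {v} f i j T) : P1 G v (swp f i j T) := by
  have := swp_po (S := {v}) (G := G) (f := f) (i := i) (j := j) (T := T)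
    (by simpa [P1] using hf) hT
  simpa [P1] using this

lemma link (C : Crit G k) {v u w : V} {f : V → Fin k} (hf : P1 G v f) (hu : Uniq G f v u)
    (hw : Uniq G f v w) (hne : u ≠ w) {T : V → Prop} (hT : Closed G {v} f (f u) (f w) T)
    (h1 : T u) (h2 : ¬ T w) : False := by
  have hp := swp_p1 hf hT
  obtain ⟨x, hx, h⟩ := sees C hp (f u)
  simp only [swp, Uniq] at *
  grind

lemma lemU (C : Crit G k) {v s t x p q : V} {f : V → Fin k} (hf : P1 G v f) (hs : Uniq G f v s)
    (ht : G.Adj v t) (hst : ¬ G.Adj s t) (hne : s ≠ t) (hxv : ¬ G.Adj v x) (hxv' : x ≠ v)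
    (hxs : G.Adj s x)
    (hxt : G.Adj t x) (us : ∀ y, G.Adj s y → y ≠ v → f y = f x → y = x)
    (ut : ∀ y, G.Adj t y → y ≠ v → f y = f x → y = x)
    (hp : G.Adj x p) (hq : G.Adj x q) (hpq : p ≠ q) (fpq : f p = f q)
    (ps : f p ≠ f s) (pt : f p ≠ f t) : False := by
  have hsv := hs.1.ne
  have htv := ht.ne
  have fx := hf s x hsv.symm hxv' hxs
  have hp1 : P1 G x (fun y => if y = s then f x else if y = t then f x else if y = v then f s
      else f y) := by
    intro y z hy hz hyz
    have h1 := hyz.ne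
    have h2 := hyz.symm
    simp only [P1, Uniq] at *
    grind
  have := pairs C hp1 hxs.symm hxt.symm hp hq hne hpq (by simp [hne.symm])
    (by
      have : p ≠ v := fun h => hxv (h ▸ hp.symm)
      have : q ≠ v := fun h => hxv (h ▸ hq.symm)
      grind)
  grind

lemma lemR0 (C : Crit G k) {v b c r : V} {f : V → Fin k} (hf : P1 G v f) (hb : Uniq G f v b)
    (hc : Uniq G f v c) (hr : Uniq G f v r) (hbc : ¬ G.Adj b c) (hne : b ≠ c)
    (hrb : G.Adj r b) (hrc : G.Adj r c) (h1 : ¬ Rep G f v b (f r)) (h2 : ¬ Rep G f v c (f r))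
    (h3 : ¬ Rep G f v r (f b)) : False := by
  have hbv := hb.1.ne
  have hcv := hc.1.ne
  have hrv := hr.1.ne
  have k1 := fun y (h : G.Adj b y) (h' : y ≠ v) (hy : f y = f r) =>
    not_rep h1 h hrb.symm h' hrv.symm hy rfl
  have k2 := fun y (h : G.Adj c y) (h' : y ≠ v) (hy : f y = f r) =>
    not_rep h2 h hrc.symm h' hrv.symm hy rfl
  have k3 := fun y (h : G.Adj r y) (h' : y ≠ v) (hy : f y = f b) =>
    not_rep h3 h hrb h' hbv.symm hy rfl
  obtain ⟨x, y, hxy, h⟩ := C.noCol (fun y => if y = b then f r else if y = c then f r else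
    if y = r then f b else if y = v then f c else f y)
  have e1 := hxy.ne
  have e2 := hxy.symm
  have e3 := hrb.ne
  have e4 := hrc.ne
  have e5 := hf r b
  have e6 := hf r c
  have e7 : f b ≠ f c := fun h => hne (hc.2 b hb.1 h)
  simp only [P1, Uniq] at *
  grind

lemma lemR (C : Crit G k) {v b c r : V} {f : V → Fin k} (hf : P1 G v f) (hb : Uniq G f v b)
    (hc : Uniq G f v c) (hr : Uniq G f v r) (hbc : ¬ G.Adj b c) (hne : b ≠ c)
    (hrb : G.Adj r b) (hrc : G.Adj r c) : Rep G f v b (f r) ∨ Rep G f v c (f r) := by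
  by_contra hcon
  push Not at hcon
  by_cases h3 : Rep G f v r (f b)
  · refine lemR0 C hf hc hb hr (fun h => hbc h.symm) hne.symm hrc hrb hcon.2 hcon.1 ?_
    intro h
    exact hne (hc.2 b hb.1 (S2' C hf hr h3 h))
  · exact lemR0 C hf hb hc hr hbc hne hrb hrc hcon.1 hcon.2 h3

noncomputable def uset (G : SimpleGraph V) (f : V → Fin k) (v : V) : Finset V :=
  Finset.univ.filter (fun x => Uniq G f v x)

lemma card_nb_ge (C : Crit G k) {v : V} {f : V → Fin k} (hf : P1 G v f) (N : Finset V)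
    (hN : ∀ c, ∃ x ∈ N, f x = c) : k ≤ N.card := by
  have : (Finset.univ : Finset (Fin k)) ⊆ N.image f := by
    intro c _
    obtain ⟨x, hx, h⟩ := hN c
    exact Finset.mem_image.2 ⟨x, hx, h⟩
  have := Finset.card_le_card this
  have h2 := Finset.card_image_le (s := N) (f := f)
  simp at this
  omega

lemma uset_pair (C : Crit G k) {v : V} {f : V → Fin k} (hf : P1 G v f) {z z' : V}
    (hz : G.Adj v z) (hz' : G.Adj v z') (hne : z ≠ z') (e : f z = f z') :
    (∀ x, G.Adj v x → x ≠ z → x ≠ z' → Uniq G f v x) ∧ k - 1 ≤ (uset G f v).card := by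
  have h1 : ∀ x, G.Adj v x → x ≠ z → x ≠ z' → Uniq G f v x := by
    intro x hx h1 h2
    refine ⟨hx, fun y hy hyx => ?_⟩
    by_contra hn
    have := pairs C hf hz hz' hy hx hne hn e hyx
    grind
  refine ⟨h1, ?_⟩
  have h2 : k ≤ ((nb G v).erase z').card := by
    apply card_nb_ge C hf
    intro c
    obtain ⟨x, hx, h⟩ := sees C hf c
    by_cases hh : x = z'
    · exact ⟨z, by simp [mem_nb, hz, hne], by rw [e, ← hh, h]⟩
    · exact ⟨x, by simp [mem_nb, hx, hh], h⟩
  have h3 : (((nb G v).erase z').erase z) ⊆ uset G f v := by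
    intro x hx
    simp only [Finset.mem_erase, mem_nb] at hx
    simp only [uset, Finset.mem_filter, Finset.mem_univ, true_and]
    exact h1 x hx.2.2 hx.1 hx.2.1
  have h4 := Finset.card_le_card h3
  have h5 := Finset.pred_card_le_card_erase (s := (nb G v).erase z') (a := z)
  omega

lemma uset_card (C : Crit G k) {v : V} {f : V → Fin k} (hf : P1 G v f) :
    k - 1 ≤ (uset G f v).card := by
  by_cases h : ∃ z z', G.Adj v z ∧ G.Adj v z' ∧ z ≠ z' ∧ f z = f z'
  · obtain ⟨z, z', h1, h2, h3, h4⟩ := h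
    exact (uset_pair C hf h1 h2 h3 h4).2
  · push Not at h
    have h2 : k ≤ (uset G f v).card := by
      apply card_nb_ge C hf
      intro c
      obtain ⟨x, hx, hc⟩ := sees C hf c
      refine ⟨x, ?_, hc⟩
      simp only [uset, Finset.mem_filter, Finset.mem_univ, true_and]
      refine ⟨hx, fun y hy e => ?_⟩
      by_contra hn
      exact h y x hy hx hn e
    omega
end
end BK

open SimpleGraph
set_option linter.all false
set_option linter.unusedSectionVars false
set_option linter.unusedVariables false
set_option linter.unusedSimpArgs false
namespace BK
section
open scoped Classical
variable {V : Type*} [Fintype V] {G : SimpleGraph V} {k : ℕ}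

lemma caseA_adj (C : Crit G k) {v s t w x : V} {f : V → Fin k} (hf : P1 G v f)
    (hs : Uniq G f v s) (ht : Uniq G f v t) (hw : Uniq G f v w) (st : ¬ G.Adj s t)
    (sw : ¬ G.Adj s w) (tw : ¬ G.Adj t w) (hne : t ≠ w) (hx : x ≠ v) (fx : f x = f w)
    (h : G.Adj s x) : G.Adj t x := by
  by_contra hn
  have hxv : ¬ G.Adj v x := by
    intro h1
    have := hw.2 x h1 fx
    exact sw (this ▸ h)
  have hwv := hw.1.ne
  have hxw : ¬ G.Adj x w := hf.ne hx hwv.symm fx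
  exact C.chair x s v t w h.symm hs.1.symm ht.1 hw.1 hne (fun h => hxv h.symm)
    (fun h => hn h.symm) hxw st sw tw

lemma caseA_core (C : Crit G k) {v a b c : V} {f : V → Fin k} (hf : P1 G v f)
    (ha : Uniq G f v a) (hb : Uniq G f v b) (hc : Uniq G f v c) (ab : ¬ G.Adj a b)
    (ac : ¬ G.Adj a c) (bc : ¬ G.Adj b c) (nab : a ≠ b) (nac : a ≠ c) (nbc : b ≠ c)
    (r2 : ¬ Rep G f v a (f b)) (r3 : ¬ Rep G f v a (f c)) : False := by
  have ba : ¬ G.Adj b a := fun h => ab h.symm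
  have ca : ¬ G.Adj c a := fun h => ac h.symm
  have cb : ¬ G.Adj c b := fun h => bc h.symm
  have fab : f a ≠ f b := fun h => nab (hb.2 a ha.1 h)
  have fac : f a ≠ f c := fun h => nac (hc.2 a ha.1 h)
  have fbc : f b ≠ f c := fun h => nbc (hc.2 b hb.1 h)
  have av := ha.1.ne
  have bv := hb.1.ne
  have cv := hc.1.ne
  obtain ⟨x2, hx2, x2v, fx2⟩ := S1 C hf ha fab.symm
  obtain ⟨x3, hx3, x3v, fx3⟩ := S1 C hf ha fac.symm
  have nx2 : ¬ G.Adj v x2 := fun h => ab ((hb.2 x2 h fx2) ▸ hx2)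
  have nx3 : ¬ G.Adj v x3 := fun h => ac ((hc.2 x3 h fx3) ▸ hx3)
  have u2 : ∀ y, G.Adj a y → y ≠ v → f y = f b → y = x2 := fun y h1 h2 h3 =>
    not_rep r2 h1 hx2 h2 x2v h3 fx2
  have u3 : ∀ y, G.Adj a y → y ≠ v → f y = f c → y = x3 := fun y h1 h2 h3 =>
    not_rep r3 h1 hx3 h2 x3v h3 fx3
  have a2 : ∀ y, y ≠ v → f y = f b → (G.Adj a y ↔ G.Adj c y) := fun y h1 h2 =>
    ⟨caseA_adj C hf ha hc hb ac ab cb nbc.symm h1 h2, caseA_adj C hf hc ha hb ca cb ab nab h1 h2⟩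
  have a3 : ∀ y, y ≠ v → f y = f c → (G.Adj a y ↔ G.Adj b y) := fun y h1 h2 =>
    ⟨caseA_adj C hf ha hb hc ab ac bc nbc h1 h2, caseA_adj C hf hb ha hc ba bc ac nac h1 h2⟩
  have cx2 : G.Adj c x2 := (a2 x2 x2v fx2).1 hx2
  have bx3 : G.Adj b x3 := (a3 x3 x3v fx3).1 hx3
  -- another 1-neighbour of x2
  have e1 : ∃ y, G.Adj x2 y ∧ y ≠ a ∧ f y = f a ∧ y ≠ v := by
    by_contra hcon
    push Not at hcon
    refine link C hf ha hb nab (T := fun y => y = a ∨ y = x2) ?_ (Or.inl rfl) ?_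
    · rintro x y (rfl | rfl) hxy hx hy h1 h2
      · have := hf _ y av.symm hy hxy
        grind
      · have := hf _ y x2v hy hxy
        grind
    · rintro (h | h)
      · exact nab h.symm
      · exact ab (h ▸ hx2)
  have e2 : ∃ y, G.Adj x2 y ∧ y ≠ c ∧ f y = f c ∧ y ≠ v := by
    by_contra hcon
    push Not at hcon
    refine link C hf hc hb nbc.symm (T := fun y => y = c ∨ y = x2) ?_ (Or.inl rfl) ?_
    · rintro x y (rfl | rfl) hxy hx hy h1 h2
      · have := hf _ y cv.symm hy hxy
        have := a2 y hy
        grind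
      · have := hf _ y x2v hy hxy
        grind
    · rintro (h | h)
      · exact nbc h
      · exact ab (h ▸ hx2)
  have e3 : ∃ y, G.Adj x3 y ∧ y ≠ b ∧ f y = f b ∧ y ≠ v := by
    by_contra hcon
    push Not at hcon
    refine link C hf hb hc nbc (T := fun y => y = b ∨ y = x3) ?_ (Or.inl rfl) ?_
    · rintro x y (rfl | rfl) hxy hx hy h1 h2
      · have := hf _ y bv.symm hy hxy
        have := a3 y hy
        grind
      · have := hf _ y x3v hy hxy
        grind
    · rintro (h | h)
      · exact nbc h.symm
      · exact ac (h ▸ hx3)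
  obtain ⟨y1, hy1, ny1, fy1, vy1⟩ := e1
  obtain ⟨y2, hy2, ny2, fy2, vy2⟩ := e2
  obtain ⟨y3, hy3, ny3, fy3, vy3⟩ := e3
  have key : ∀ r, Uniq G f v r → r ≠ a → r ≠ b → r ≠ c →
      ∃ s ∈ ({a, b, c} : Finset V), Rep G f v s (f r) := by
    intro r hr ra rb rc
    have fra : f r ≠ f a := fun h => ra (ha.2 r hr.1 h)
    have frb : f r ≠ f b := fun h => rb (hb.2 r hr.1 h)
    have frc : f r ≠ f c := fun h => rc (hc.2 r hr.1 h)
    have q1 : G.Adj r a ∨ G.Adj r b := by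
      by_contra hcon
      push Not at hcon
      have ar : ¬ G.Adj a r := fun h => hcon.1 h.symm
      have br : ¬ G.Adj b r := fun h => hcon.2 h.symm
      have A : ∀ y, y ≠ v → f y = f b → (G.Adj a y ↔ G.Adj r y) := fun y h1 h2 =>
        ⟨caseA_adj C hf ha hr hb ar ab hcon.2 rb h1 h2, caseA_adj C hf hr ha hb hcon.1 hcon.2 ab nab h1 h2⟩
      exact lemU C hf ha hr.1 ar ra.symm nx2 x2v hx2 ((A x2 x2v fx2).1 hx2)
        (by rw [fx2]; exact u2) (by rw [fx2]; exact fun y h1 h2 h3 => u2 y ((A y h2 h3).2 h1) h2 h3)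
        cx2.symm hy2 ny2.symm fy2.symm fac.symm frc.symm
    have q2 : G.Adj r a ∨ G.Adj r c := by
      by_contra hcon
      push Not at hcon
      have ar : ¬ G.Adj a r := fun h => hcon.1 h.symm
      have A : ∀ y, y ≠ v → f y = f c → (G.Adj a y ↔ G.Adj r y) := fun y h1 h2 =>
        ⟨caseA_adj C hf ha hr hc ar ac hcon.2 rc h1 h2, caseA_adj C hf hr ha hc hcon.1 hcon.2 ac nac h1 h2⟩
      exact lemU C hf ha hr.1 ar ra.symm nx3 x3v hx3 ((A x3 x3v fx3).1 hx3)
        (by rw [fx3]; exact u3) (by rw [fx3]; exact fun y h1 h2 h3 => u3 y ((A y h2 h3).2 h1) h2 h3)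
        bx3.symm hy3 ny3.symm fy3.symm fab.symm frb.symm
    have q3 : G.Adj r b ∨ G.Adj r c := by
      by_contra hcon
      push Not at hcon
      have cr : ¬ G.Adj c r := fun h => hcon.2 h.symm
      have A : ∀ y, y ≠ v → f y = f b → (G.Adj c y ↔ G.Adj r y) := fun y h1 h2 =>
        ⟨caseA_adj C hf hc hr hb cr cb hcon.1 rb h1 h2, caseA_adj C hf hr hc hb hcon.2 hcon.1 cb nbc.symm h1 h2⟩
      exact lemU C hf hc hr.1 cr rc.symm nx2 x2v cx2 ((A x2 x2v fx2).1 cx2)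
        (by rw [fx2]; exact fun y h1 h2 h3 => u2 y ((a2 y h2 h3).2 h1) h2 h3)
        (by rw [fx2]; exact fun y h1 h2 h3 => u2 y ((a2 y h2 h3).2 ((A y h2 h3).2 h1)) h2 h3)
        hx2.symm hy1 ny1.symm fy1.symm fac fra.symm
    by_cases h1 : G.Adj r a
    · by_cases h2 : G.Adj r b
      · rcases lemR C hf ha hb hr ab nab h1 h2 with h | h
        · exact ⟨a, by simp, h⟩
        · exact ⟨b, by simp, h⟩
      · have h3 := q3.resolve_left h2
        rcases lemR C hf ha hc hr ac nac h1 h3 with h | h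
        · exact ⟨a, by simp, h⟩
        · exact ⟨c, by simp, h⟩
    · have h2 := q1.resolve_left h1
      have h3 := q2.resolve_left h1
      rcases lemR C hf hb hc hr bc nbc h2 h3 with h | h
      · exact ⟨b, by simp, h⟩
      · exact ⟨c, by simp, h⟩
  have hcard := uset_card C hf
  have h8 := C.k8
  set W := (uset G f v) \ {a, b, c} with hW
  have hc1 : ({a, b, c} : Finset V).card < W.card := by
    have h1 : ({a, b, c} : Finset V).card ≤ 3 := Finset.card_le_three
    have h2 := Finset.le_card_sdiff ({a, b, c} : Finset V) (uset G f v)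
    rw [← hW] at h2
    omega
  have key2 : ∀ r, ∃ s, r ∈ W → s ∈ ({a, b, c} : Finset V) ∧ Rep G f v s (f r) := by
    intro r
    by_cases hr : r ∈ W
    · have hr' := hr
      simp only [hW, uset, Finset.mem_sdiff, Finset.mem_filter, Finset.mem_univ, true_and,
        Finset.mem_insert, Finset.mem_singleton, not_or] at hr'
      obtain ⟨s, hs, h⟩ := key r hr'.1 hr'.2.1 hr'.2.2.1 hr'.2.2.2
      exact ⟨s, fun _ => ⟨hs, h⟩⟩
    · exact ⟨a, fun h => absurd h hr⟩
  choose g hg using key2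
  obtain ⟨r, hr, r', hr', hne, he⟩ := Finset.exists_ne_map_eq_of_card_lt_of_maps_to hc1
    (f := g) (fun r hr => (hg r hr).1)
  have hUr : Uniq G f v r := by simp [hW, uset] at hr; exact hr.1
  have hUr' : Uniq G f v r' := by simp [hW, uset] at hr'; exact hr'.1
  have hs : Uniq G f v (g r) := by
    have := (hg r hr).1
    simp at this
    rcases this with h | h | h <;> rw [h] <;> assumption
  have := S2' C hf hs (hg r hr).2 (he ▸ (hg r' hr').2)
  exact hne (hUr'.2 r hUr.1 this)

lemma caseA (C : Crit G k) {v a b c : V} {f : V → Fin k} (hf : P1 G v f)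
    (ha : Uniq G f v a) (hb : Uniq G f v b) (hc : Uniq G f v c) (ab : ¬ G.Adj a b)
    (ac : ¬ G.Adj a c) (bc : ¬ G.Adj b c) (nab : a ≠ b) (nac : a ≠ c) (nbc : b ≠ c) : False := by
  have ba : ¬ G.Adj b a := fun h => ab h.symm
  have ca : ¬ G.Adj c a := fun h => ac h.symm
  have cb : ¬ G.Adj c b := fun h => bc h.symm
  have fab : f a ≠ f b := fun h => nab (hb.2 a ha.1 h)
  have fac : f a ≠ f c := fun h => nac (hc.2 a ha.1 h)
  have fbc : f b ≠ f c := fun h => nbc (hc.2 b hb.1 h)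
  have tr : ∀ s t w, Uniq G f v s → Uniq G f v t → Uniq G f v w → ¬ G.Adj s t → ¬ G.Adj s w →
      ¬ G.Adj t w → t ≠ w → Rep G f v s (f w) → Rep G f v t (f w) := by
    rintro s t w hs ht hw st sw tw hne ⟨x, y, h1, h2, h3, h4, h5, h6, h7⟩
    exact ⟨x, y, h1, h2, h3, caseA_adj C hf hs ht hw st sw tw hne h2 h6 h4,
      caseA_adj C hf hs ht hw st sw tw hne h3 h7 h5, h6, h7⟩
  by_cases r2 : Rep G f v a (f b)
  · have rc2 := tr a c b ha hc hb ac ab cb nbc.symm r2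
    refine caseA_core C hf hb ha hc ba bc ac nab.symm nbc nac ?_ ?_
    · intro h
      have := tr b c a hb hc ha bc ba ca nac.symm h
      exact fab (S2' C hf hc this rc2)
    · intro h
      have := tr b a c hb ha hc ba bc ac nac h
      exact fbc (S2' C hf ha r2 this)
  · by_cases r3 : Rep G f v a (f c)
    · have rb3 := tr a b c ha hb hc ab ac bc nbc r3
      refine caseA_core C hf hc ha hb ca cb ab nac.symm nbc.symm nab ?_ ?_
      · intro h
        have := tr c b a hc hb ha cb ca ba nab.symm h
        exact fac (S2' C hf hb this rb3)
      · intro h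
        have := tr c a b hc ha hb ca cb ab nab h
        exact r2 this
    · exact caseA_core C hf ha hb hc ab ac bc nab nac nbc r2 r3
end
end BK

open SimpleGraph
set_option linter.all false
set_option linter.unusedSectionVars false
set_option linter.unusedVariables false
set_option linter.unusedSimpArgs false
namespace BK
section
open scoped Classical
variable {V : Type*} [Fintype V] {G : SimpleGraph V} {k : ℕ}

lemma count_rep {α β : Type*} (N : Finset α) (C R : Finset β) (f : α → β)
    (hC : ∀ c ∈ C, ∃ x ∈ N, f x = c) (hRC : R ⊆ C)
    (hR : ∀ c ∈ R, ∃ x ∈ N, ∃ y ∈ N, x ≠ y ∧ f x = c ∧ f y = c) : C.card + R.card ≤ N.card := by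
  have h1 : C.card + R.card = ∑ c ∈ C, (1 + if c ∈ R then 1 else 0) := by
    rw [Finset.sum_add_distrib]
    simp [Finset.inter_eq_right.2 hRC]
  have h2 : ∑ c ∈ C, (N.filter (fun x => f x = c)).card ≤ N.card := by
    rw [← Finset.card_biUnion]
    · apply Finset.card_le_card
      intro x hx
      simp at hx
      exact hx.2
    · intro c _ d _ hcd
      rw [Function.onFun, Finset.disjoint_left]
      intro x hx hx'
      simp at hx hx'
      exact hcd (hx.2.symm.trans hx'.2)
  rw [h1]
  refine le_trans (Finset.sum_le_sum ?_) h2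
  intro c hc
  split_ifs with h
  · obtain ⟨x, hx, y, hy, hne, e1, e2⟩ := hR c h
    have : 1 < (N.filter (fun x => f x = c)).card :=
      Finset.one_lt_card.2 ⟨x, by simp [*], y, by simp [*], hne⟩
    omega
  · obtain ⟨x, hx, e⟩ := hC c hc
    have : 0 < (N.filter (fun x => f x = c)).card := Finset.card_pos.2 ⟨x, by simp [*]⟩
    omega

lemma B2 (C : Crit G k) {v y z z' : V} {f : V → Fin k} (hf : P1 G v f) (hz : G.Adj v z)
    (hz' : G.Adj v z') (hne : z ≠ z') (e : f z = f z') (hy : Uniq G f v y) :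
    G.Adj y z ∨ G.Adj y z' := by
  by_contra hcon
  push Not at hcon
  have zv := hz.ne
  have zv' := hz'.ne
  have fyz : f z ≠ f y := fun h => hne ((hy.2 z hz h).trans (hy.2 z' hz' (e ▸ h)).symm)
  obtain ⟨w, hw, wv, fw⟩ := S1 C hf hy fyz
  have nw : ¬ G.Adj v w := by
    intro h
    have hwz : z ≠ w := fun h => hcon.1 (h ▸ hw)
    have := pairs C hf hz hz' hz h hne hwz e fw.symm
    grind
  exact C.chair w y v z z' hw.symm hy.1.symm hz hz' hne (fun h => nw h.symm)
    (hf.ne wv zv.symm fw) (hf.ne wv zv'.symm (fw.trans e)) hcon.1 hcon.2 (hf.ne zv.symm zv'.symm e)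

structure BS (G : SimpleGraph V) (f : V → Fin k) (v z z' y y' : V) : Prop where
  hz : G.Adj v z
  hz' : G.Adj v z'
  hne : z ≠ z'
  e : f z = f z'
  hy : Uniq G f v y
  hy' : Uniq G f v y'
  zy : ¬ G.Adj z y
  zy' : ¬ G.Adj z y'
  yy' : ¬ G.Adj y y'
  yne : y ≠ y'

lemma BS.symm {f : V → Fin k} {v z z' y y' : V} (B : BS G f v z z' y y') : BS G f v z z' y' y :=
  ⟨B.hz, B.hz', B.hne, B.e, B.hy', B.hy, B.zy', B.zy, fun h => B.yy' h.symm, B.yne.symm⟩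

lemma BS.col {f : V → Fin k} {v z z' y y' : V} (B : BS G f v z z' y y') {r : V}
    (hr : Uniq G f v r) : f r ≠ f z ∧ r ≠ z ∧ r ≠ z' := by
  have h : f z ≠ f r := fun h =>
    B.hne ((hr.2 z B.hz h).trans (hr.2 z' B.hz' (B.e ▸ h)).symm)
  have := B.e
  refine ⟨fun h' => h h'.symm, ?_, ?_⟩ <;> grind

lemma BS.only {f : V → Fin k} {v z z' y y' : V} (C : Crit G k) (hf : P1 G v f)
    (B : BS G f v z z' y y') {w : V} (h : G.Adj v w) (hw : f w = f z) : w = z ∨ w = z' := by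
  by_contra hcon
  push Not at hcon
  have := pairs C hf B.hz B.hz' B.hz h B.hne hcon.1.symm B.e hw.symm
  have := B.hne
  grind

lemma BS.zadj {f : V → Fin k} {v z z' y y' : V} (C : Crit G k) (hf : P1 G v f)
    (B : BS G f v z z' y y') : G.Adj y z' :=
  (B2 C hf B.hz B.hz' B.hne B.e B.hy).resolve_left (fun h => B.zy h.symm)

/-- generic chair consequence. -/
lemma chair_tr (C : Crit G k) {v s t w x : V} {f : V → Fin k} (hf : P1 G v f)
    (hs : G.Adj v s) (ht : G.Adj v t) (hw : G.Adj v w) (st : ¬ G.Adj s t)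
    (sw : ¬ G.Adj s w) (tw : ¬ G.Adj t w) (hne : t ≠ w) (hx : x ≠ v) (hxv : ¬ G.Adj v x)
    (fx : f x = f w) (h : G.Adj s x) : G.Adj t x := by
  by_contra hn
  have hwv := hw.ne
  have hxw : ¬ G.Adj x w := hf.ne hx hwv.symm fx
  exact C.chair x s v t w h.symm hs.symm ht hw hne (fun h => hxv h.symm)
    (fun h => hn h.symm) hxw st sw tw

lemma BS.b1 {f : V → Fin k} {v z z' y y' : V} (C : Crit G k) (hf : P1 G v f)
    (B : BS G f v z z' y y') {x : V} (hx : x ≠ v) (fx : f x = f y') : G.Adj y x ↔ G.Adj z x := by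
  have c := B.col B.hy'
  constructor
  · intro h
    refine chair_tr C hf B.hy.1 B.hz B.hy'.1 (fun h => B.zy h.symm) B.yy' B.zy' c.2.1.symm hx ?_ fx h
    intro hh
    exact B.yy' (B.hy'.2 x hh fx ▸ h)
  · intro h
    refine chair_tr C hf B.hz B.hy.1 B.hy'.1 B.zy B.zy' B.yy' B.yne hx ?_ fx h
    intro hh
    exact B.zy' (B.hy'.2 x hh fx ▸ h)

lemma BS.b1' {f : V → Fin k} {v z z' y y' : V} (C : Crit G k) (hf : P1 G v f)
    (B : BS G f v z z' y y') {x : V} (hx : x ≠ v) (hxz : x ≠ z') (fx : f x = f z)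
    (h : G.Adj y x) : ¬ G.Adj v x ∧ G.Adj y' x := by
  have c := B.col B.hy'
  have h1 : ¬ G.Adj v x := by
    intro hh
    rcases B.only C hf hh fx with h' | h'
    · exact B.zy (h' ▸ h).symm
    · exact hxz h'
  exact ⟨h1, chair_tr C hf B.hy.1 B.hy'.1 B.hz B.yy' (fun h => B.zy h.symm) (fun h => B.zy' h.symm)
    c.2.1 hx h1 fx h⟩

lemma BS.b2 {f : V → Fin k} {v z z' y y' : V} (C : Crit G k) (hf : P1 G v f)
    (B : BS G f v z z' y y') {c : Fin k} (hc : c ≠ f z) : ∃ x, G.Adj z' x ∧ x ≠ v ∧ f x = c := by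
  by_contra hcon
  push Not at hcon
  have c1 := B.col B.hy
  have c2 := B.col B.hy'
  have a1 := B.zadj C hf
  have a2 := B.symm.zadj C hf
  have vy := B.hy.1.ne
  have vy' := B.hy'.1.ne
  have vz := B.hz.ne
  have vz' := B.hz'.ne
  have cy : c ≠ f y := fun h => hcon y a1.symm vy.symm h.symm
  have cy' : c ≠ f y' := fun h => hcon y' a2.symm vy'.symm h.symm
  set g : V → Fin k := fun x => if x = z' then c else f x with hg
  have hgp : P1 G v g := by
    intro p q hp hq hpq
    have h1 := hpq.symm
    have h2 := hpq.ne
    have h3 := hf p q hp hq hpq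
    simp only [hg]
    grind
  have uz : Uniq G g v z := by
    refine ⟨B.hz, fun x hx he => ?_⟩
    have hne := B.hne
    by_cases hxz : x = z'
    · simp [hg, hxz, hne] at he; exact absurd he hc
    · simp [hg, hxz, hne] at he
      exact (B.only C hf hx he).resolve_right hxz
  have uy : ∀ t, Uniq G f v t → t ≠ z' → c ≠ f t → Uniq G g v t := by
    intro t ht htz hct
    refine ⟨ht.1, fun x hx he => ?_⟩
    by_cases hxz : x = z'
    · simp [hg, hxz, htz] at he; exact absurd he hct
    · simp [hg, hxz, htz] at he
      exact ht.2 x hx he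
  exact caseA C hgp uz (uy y B.hy c1.2.2 cy) (uy y' B.hy' c2.2.2 cy') B.zy B.zy' B.yy'
    c1.2.1.symm c2.2.1.symm B.yne

lemma rep_le_one (C : Crit G k) {f : V → Fin k} {v z : V} (hz : G.Adj v z)
    (hs : ∀ c, c ≠ f z → ∃ x, G.Adj z x ∧ x ≠ v ∧ f x = c) {c d : Fin k}
    (h1 : Rep G f v z c) (h2 : Rep G f v z d) : c = d := by
  obtain ⟨x, y, a1, a2, a3, a4, a5, a6, a7⟩ := h1
  obtain ⟨x', y', b1, b2, b3, b4, b5, b6, b7⟩ := h2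
  have := count_pair ((nb G z).erase v) (Finset.univ.erase (f z)) f (by
      intro c hc
      obtain ⟨x, h1, h2, h3⟩ := hs c (by simpa using hc)
      exact ⟨x, by simp [mem_nb, h1, h2], h3⟩)
    (by
      have h1 := C.deg z (nb G z) (fun x hx => mem_nb.1 hx)
      have h2 : v ∈ nb G z := mem_nb.2 hz.symm
      rw [Finset.card_erase_of_mem h2, Finset.card_erase_of_mem (Finset.mem_univ _)]
      have := C.k8
      simp; omega)
    (x1 := x) (x2 := y) (y1 := x') (y2 := y') (by simp [mem_nb, *]) (by simp [mem_nb, *])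
    (by simp [mem_nb, *]) (by simp [mem_nb, *]) a1 b1 (by grind) (by grind)
  grind

lemma BS.b3_aux {f : V → Fin k} {v z z' y y' : V} (C : Crit G k) (hf : P1 G v f)
    (B : BS G f v z z' y y') (h1 : ∀ x, x ≠ v → f x = f z → G.Adj y x → x = z')
    (h2 : ∀ x, x ≠ v → f x = f z → G.Adj y' x → x = z') (h3 : ¬ Rep G f v z' (f y)) : False := by
  have c1 := B.col B.hy
  have c2 := B.col B.hy'
  have a1 := B.zadj C hf
  have a2 := B.symm.zadj C hf
  have vy := B.hy.1.ne
  have vy' := B.hy'.1.ne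
  have vz := B.hz.ne
  have vz' := B.hz'.ne
  have yy' := B.yy'
  have hne := B.yne
  have u1 := B.hy.2
  have u2 := B.hy'.2
  have k3 := fun x (h : G.Adj z' x) (h' : x ≠ v) (hy : f x = f y) =>
    not_rep h3 h a1.symm h' vy.symm hy rfl
  have e7 : f y ≠ f y' := fun h => hne (u2 y B.hy.1 h)
  obtain ⟨p, q, hpq, h⟩ := C.noCol (fun x => if x = y then f z else if x = y' then f z else
    if x = z' then f y else if x = v then f y' else f x)
  have e1 := hpq.ne
  have e2 := hpq.symm
  have e3 := hf p q
  grind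

lemma BS.b3 {f : V → Fin k} {v z z' y y' : V} (C : Crit G k) (hf : P1 G v f)
    (B : BS G f v z z' y y') :
    ∃ o, o ≠ z' ∧ o ≠ v ∧ f o = f z ∧ G.Adj y o ∧ G.Adj y' o ∧ ¬ G.Adj v o := by
  by_contra hcon
  push Not at hcon
  have h1 : ∀ x, x ≠ v → f x = f z → G.Adj y x → x = z' := by
    intro x hx fx hyx
    by_contra hn
    have := B.b1' C hf hx hn fx hyx
    exact this.1 (hcon x hn hx fx hyx this.2)
  have h2 : ∀ x, x ≠ v → f x = f z → G.Adj y' x → x = z' := by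
    intro x hx fx hyx
    by_contra hn
    have := B.symm.b1' C hf hx hn fx hyx
    exact this.1 (hcon x hn hx fx this.2 hyx)
  by_cases h3 : Rep G f v z' (f y)
  · refine B.symm.b3_aux C hf h2 h1 ?_
    intro h4
    have : f y = f y' := rep_le_one C B.hz' (fun c hc => B.b2 C hf (B.e ▸ hc)) h3 h4
    exact B.yne (B.hy'.2 y B.hy.1 this)
  · exact B.b3_aux C hf h1 h2 h3
end
end BK

open SimpleGraph
set_option linter.all false
set_option linter.unusedSectionVars false
set_option linter.unusedVariables false
set_option linter.unusedSimpArgs false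
namespace BK
section
open scoped Classical
variable {V : Type*} [Fintype V] {G : SimpleGraph V} {k : ℕ}

lemma BS.rep0 {f : V → Fin k} {v z z' y y' o : V} (C : Crit G k) (hf : P1 G v f)
    (B : BS G f v z z' y y') (ho : o ≠ z') (ov : o ≠ v) (fo : f o = f z) (yo : G.Adj y o) :
    ∀ c, Rep G f v y c → c = f z := by
  intro c hc
  exact S2' C hf B.hy hc ⟨z', o, ho.symm, B.hz'.ne.symm, ov, B.zadj C hf, yo, B.e.symm, fo⟩

lemma BS.b4 {f : V → Fin k} {v z z' y y' : V} (C : Crit G k) (hf : P1 G v f)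
    (B : BS G f v z z' y y') {r : V} (hr : Uniq G f v r) (ry : r ≠ y) (ry' : r ≠ y') :
    (G.Adj r y ∧ ¬ G.Adj r y') ∨ (G.Adj r y' ∧ ¬ G.Adj r y) := by
  obtain ⟨o, o1, o2, o3, o4, o5, o6⟩ := B.b3 C hf
  have c := B.col hr
  by_cases h1 : G.Adj r y <;> by_cases h2 : G.Adj r y'
  · rcases lemR C hf B.hy B.hy' hr B.yy' B.yne h1 h2 with h | h
    · exact absurd (B.rep0 C hf o1 o2 o3 o4 _ h) c.1
    · exact absurd (B.symm.rep0 C hf o1 o2 o3 o5 _ h) c.1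
  · exact Or.inl ⟨h1, h2⟩
  · exact Or.inr ⟨h2, h1⟩
  · exact (caseA C hf hr B.hy B.hy' h1 h2 B.yy' ry ry' B.yne).elim

lemma BS.b5_aux {f : V → Fin k} {v z z' y y' : V} (C : Crit G k) (hf : P1 G v f)
    (B : BS G f v z z' y y') {r : V} (hr : Uniq G f v r) (ry : r ≠ y) (ry' : r ≠ y')
    (h1 : G.Adj r y) (h2 : ¬ G.Adj r y') : G.Adj r z := by
  by_contra hrz
  obtain ⟨o, o1, o2, o3, o4, o5, o6⟩ := B.b3 C hf
  have c := B.col hr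
  have cy := B.col B.hy
  have cy' := B.col B.hy'
  have e7 : f y ≠ f y' := fun h => B.yne (B.hy'.2 y B.hy.1 h)
  obtain ⟨x, hx, xv, fx⟩ := S1 C hf B.hy e7.symm
  have hn : ¬ Rep G f v y (f y') := fun h => cy'.1 (B.rep0 C hf o1 o2 o3 o4 _ h)
  have uy : ∀ t, G.Adj y t → t ≠ v → f t = f y' → t = x := fun t h1 h2 h3 =>
    not_rep hn h1 hx h2 xv h3 fx
  have nvx : ¬ G.Adj v x := fun h => B.yy' (B.hy'.2 x h fx ▸ hx)
  have vy := B.hy.1.ne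
  have hzx := (B.b1 C hf xv fx).1 hx
  have hrx : G.Adj r x := chair_tr C hf B.hz hr.1 B.hy'.1 (fun h => hrz h.symm) B.zy' h2 ry' xv nvx fx hzx
  have e1 : ∃ t, G.Adj x t ∧ t ≠ y ∧ f t = f y ∧ t ≠ v := by
    by_contra hcon
    push Not at hcon
    refine link C hf B.hy B.hy' B.yne (T := fun t => t = y ∨ t = x) ?_ (Or.inl rfl) ?_
    · rintro s t (rfl | rfl) hst hs ht g1 g2
      · have := hf _ t vy.symm ht hst
        grind
      · have := hf _ t xv ht hst
        grind
    · rintro (h | h)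
      · exact B.yne h.symm
      · exact B.yy' (h ▸ hx)
  obtain ⟨t, t1, t2, t3, t4⟩ := e1
  have uz : ∀ t, G.Adj z t → t ≠ v → f t = f y' → t = x := fun t h1 h2 h3 =>
    uy t ((B.b1 C hf h2 h3).2 h1) h2 h3
  have ur : ∀ t, G.Adj r t → t ≠ v → f t = f y' → t = x := by
    intro t g1 g2 g3
    refine uz t (chair_tr C hf hr.1 B.hz B.hy'.1 hrz h2 B.zy' cy'.2.1.symm g2 ?_ g3 g1) g2 g3
    intro hh
    exact h2 (B.hy'.2 t hh g3 ▸ g1)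
  exact lemU C hf hr B.hz hrz c.2.1 nvx xv hrx hzx (by rw [fx]; exact ur) (by rw [fx]; exact uz)
    hx.symm t1 t2.symm t3.symm (fun h => ry (B.hy.2 r hr.1 h.symm)) cy.1

lemma BS.b5 {f : V → Fin k} {v z z' y y' : V} (C : Crit G k) (hf : P1 G v f)
    (B : BS G f v z z' y y') {r : V} (hr : Uniq G f v r) (ry : r ≠ y) (ry' : r ≠ y') :
    G.Adj r z := by
  rcases B.b4 C hf hr ry ry' with h | h
  · exact B.b5_aux C hf hr ry ry' h.1 h.2
  · exact B.symm.b5_aux C hf hr ry' ry h.1 h.2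

lemma BS.uq {f : V → Fin k} {v z z' y y' : V} (C : Crit G k) (hf : P1 G v f)
    (B : BS G f v z z' y y') {x : V} (hx : G.Adj v x) (fx : f x ≠ f z) : Uniq G f v x := by
  have e := B.e
  exact (uset_pair C hf B.hz B.hz' B.hne B.e).1 x hx (by grind) (by grind)

lemma BS.b6 {f : V → Fin k} {v z z' y y' : V} (C : Crit G k) (hf : P1 G v f)
    (B : BS G f v z z' y y') {c : Fin k} (hc : c ≠ f z) : ∃ x, G.Adj z x ∧ x ≠ v ∧ f x = c := by
  have e7 : f y ≠ f y' := fun h => B.yne (B.hy'.2 y B.hy.1 h)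
  by_cases h1 : c = f y
  · obtain ⟨x, a1, a2, a3⟩ := S1 C hf B.hy' e7
    exact ⟨x, (B.symm.b1 C hf a2 a3).1 a1, a2, a3.trans h1.symm⟩
  by_cases h2 : c = f y'
  · obtain ⟨x, a1, a2, a3⟩ := S1 C hf B.hy e7.symm
    exact ⟨x, (B.b1 C hf a2 a3).1 a1, a2, a3.trans h2.symm⟩
  obtain ⟨r, hr, fr⟩ := sees C hf c
  have hu := B.uq C hf hr (fr ▸ hc)
  refine ⟨r, (B.b5 C hf hu ?_ ?_).symm, hr.ne.symm, fr⟩ <;> grind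

lemma BS.b7_aux {f : V → Fin k} {v z z' y y' o : V} (C : Crit G k) (hf : P1 G v f)
    (B : BS G f v z z' y y') (o1 : o ≠ z') (o2 : o ≠ v) (o3 : f o = f z) (o4 : G.Adj y o)
    {r : V} (hr : Uniq G f v r) (ry : r ≠ y)
    (h1 : G.Adj r y) : G.Adj r z' ∨ G.Adj r o := by
  have c := B.col hr
  have rv := hr.1.ne
  have zv := B.hz'.ne
  refine B2 C (shift hf B.hy) (B.zadj C hf) o4 o1.symm ?_ ?_
  · rw [Function.update_of_ne zv.symm, Function.update_of_ne o2, o3, B.e]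
  · refine ⟨h1.symm, fun x hx fx => ?_⟩
    rw [Function.update_of_ne rv.symm] at fx
    by_cases hxv : x = v
    · subst hxv
      simp at fx
      exact absurd (hr.2 y B.hy.1 fx).symm ry
    · rw [Function.update_of_ne hxv] at fx
      by_contra hn
      exact c.1 (B.rep0 C hf o1 o2 o3 o4 _ ⟨x, r, hn, hxv, rv.symm, hx, h1.symm, fx, rfl⟩)

lemma BS.b8a {f : V → Fin k} {v z z' y y' : V} (C : Crit G k) (hf : P1 G v f)
    (B : BS G f v z z' y y') {r : V} (hr : Uniq G f v r) (ry : r ≠ y) (ry' : r ≠ y')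
    {T : V → Prop} (hT : Closed G {v} f (f z) (f r) T) (Tr : T r) : T z' := by
  by_contra hn
  have c := B.col hr
  have cy := B.col B.hy
  have cy' := B.col B.hy'
  have rv := hr.1.ne
  have zv := B.hz.ne
  have e := B.e
  have e1 : f y ≠ f r := fun h => ry (hr.2 y B.hy.1 h).symm
  have e2 : f y' ≠ f r := fun h => ry' (hr.2 y' B.hy'.1 h).symm
  have Tz : T z := hT r z Tr (B.b5 C hf hr ry ry') rv.symm zv.symm (Or.inr rfl) (Or.inl rfl)
  have hp := swp_p1 hf hT
  have uz : Uniq G (swp f (f z) (f r) T) v z := by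
    refine ⟨B.hz, fun x hx fx => ?_⟩
    have h1 := B.only C hf hx
    have h2 := hr.2 x hx
    simp only [swp] at fx
    grind
  have ut : ∀ t, Uniq G f v t → f t ≠ f z → f t ≠ f r → Uniq G (swp f (f z) (f r) T) v t := by
    intro t ht h1 h2
    refine ⟨ht.1, fun x hx fx => ?_⟩
    have h3 := ht.2 x hx
    simp only [swp] at fx
    grind
  exact caseA C hp uz (ut y B.hy cy.1 e1) (ut y' B.hy' cy'.1 e2) B.zy B.zy' B.yy'
    cy.2.1.symm cy'.2.1.symm B.yne

lemma BS.b8b {f : V → Fin k} {v z z' y y' o : V} (C : Crit G k) (hf : P1 G v f)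
    (B : BS G f v z z' y y') (o1 : o ≠ z') (o2 : o ≠ v) (o3 : f o = f z) (o4 : G.Adj y o)
    (o5 : G.Adj y' o)
    {r : V} (hr : Uniq G f v r) (ry : r ≠ y) (ry' : r ≠ y')
    {T : V → Prop} (hT : Closed G {v} f (f z) (f r) T) (Tr : T r) : T o := by
  by_contra hn
  have c := B.col hr
  have cy := B.col B.hy
  have cy' := B.col B.hy'
  have rv := hr.1.ne
  have zv := B.hz.ne
  have zv' := B.hz'.ne
  have e := B.e
  have e1 : f y ≠ f r := fun h => ry (hr.2 y B.hy.1 h).symm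
  have e2 : f y' ≠ f r := fun h => ry' (hr.2 y' B.hy'.1 h).symm
  have Tz : T z := hT r z Tr (B.b5 C hf hr ry ry') rv.symm zv.symm (Or.inr rfl) (Or.inl rfl)
  have Tz' := B.b8a C hf hr ry ry' hT Tr
  have hp := swp_p1 hf hT
  have ut : ∀ t, Uniq G f v t → f t ≠ f z → f t ≠ f r → Uniq G (swp f (f z) (f r) T) v t := by
    intro t ht h1 h2
    refine ⟨ht.1, fun x hx fx => ?_⟩
    have h3 := ht.2 x hx
    simp only [swp] at fx
    grind
  have fz : swp f (f z) (f r) T z = f r := by simp [swp, Tz]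
  have fz' : swp f (f z) (f r) T z' = f r := by simp [swp, Tz', ← e]
  have fr : swp f (f z) (f r) T r = f z := by simp [swp, Tr, c.1]
  have fo : swp f (f z) (f r) T o = f z := by simp [swp, hn, o3]
  have B' : BS G (swp f (f z) (f r) T) v z z' y y' :=
    ⟨B.hz, B.hz', B.hne, by rw [fz, fz'], ut y B.hy cy.1 e1, ut y' B.hy' cy'.1 e2, B.zy, B.zy',
      B.yy', B.yne⟩
  obtain ⟨p, p1, p2, p3, p4, p5, p6⟩ := B'.b3 C hp
  have hro : r ≠ o := by rintro rfl; exact hn Tr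
  rcases B.b4 C hf hr ry ry' with h | h
  · have := S2 C hp B'.hy (B.zadj C hf) p4 h.1.symm o4 zv'.symm p2 rv.symm o2 p1.symm hro
      (by rw [p3, fz, fz']) (by rw [fr, fo])
    grind
  · have := S2 C hp B'.hy' (B.symm.zadj C hf) p5 h.1.symm o5 zv'.symm p2 rv.symm o2 p1.symm hro
      (by rw [p3, fz, fz']) (by rw [fr, fo])
    grind

lemma BS.false {f : V → Fin k} {v z z' y y' : V} (C : Crit G k) (hf : P1 G v f)
    (B : BS G f v z z' y y') : False := by
  obtain ⟨o, o1, o2, o3, o4, o5, o6⟩ := B.b3 C hf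
  have e := B.e
  have zv := B.hz.ne
  have zv' := B.hz'.ne
  have key : ∀ r, Uniq G f v r → r ≠ y → r ≠ y' →
      Rep G f v z (f r) ∨ Rep G f v z' (f r) ∨ Rep G f v o (f r) := by
    intro r hr ry ry'
    by_contra hcon
    push Not at hcon
    obtain ⟨n1, n2, n3⟩ := hcon
    have c := B.col hr
    have rv := hr.1.ne
    have rz := B.b5 C hf hr ry ry'
    have hor : G.Adj r z' ∨ G.Adj r o := by
      rcases B.b4 C hf hr ry ry' with h | h
      · exact B.b7_aux C hf o1 o2 o3 o4 hr ry h.1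
      · exact B.symm.b7_aux C hf o1 o2 o3 o5 hr ry' h.1
    have hzo : z ≠ o := fun h => o6 (h ▸ B.hz)
    have hro : r ≠ o := fun h => o6 (h ▸ hr.1)
    have gen : ∀ q, q ≠ z → q ≠ v → f q = f z → G.Adj r q → ¬ Rep G f v q (f r) →
        Closed G {v} f (f z) (f r) (fun x => x = z ∨ x = r ∨ x = q) := by
      intro q qz qv fq rq nq s t hs hst sv tv g1 g2
      have h1 := hf s t sv tv hst
      rcases hs with rfl | rfl | rfl
      · have ft : f t = f r := by grind
        exact Or.inr (Or.inl (not_rep n1 hst rz.symm tv rv.symm ft rfl))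
      · have ft : f t = f z := by grind
        by_contra hn
        push Not at hn
        have := S2 C hf hr rz rq rz hst zv.symm qv zv.symm tv qz.symm hn.1.symm fq.symm ft.symm
        grind
      · have ft : f t = f r := by grind
        exact Or.inr (Or.inl (not_rep nq hst rq.symm tv rv.symm ft rfl))
    rcases hor with h | h
    · have := B.b8b C hf o1 o2 o3 o4 o5 hr ry ry' (gen z' B.hne.symm zv'.symm e.symm h n2) (by simp)
      grind
    · have := B.b8a C hf hr ry ry' (gen o hzo.symm o2 o3 h n3) (by simp)
      have := B.hne
      grind
  have so : ∀ c, c ≠ f z → ∃ x, G.Adj o x ∧ f x = c := by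
    intro c hc
    by_cases h1 : c = f y
    · exact ⟨y, o4.symm, h1.symm⟩
    by_cases h2 : c = f y'
    · exact ⟨y', o5.symm, h2.symm⟩
    obtain ⟨r, hr, fr⟩ := sees C hf c
    have hu := B.uq C hf hr (fr ▸ hc)
    by_contra hcon
    push Not at hcon
    refine B.b8b C hf o1 o2 o3 o4 o5 hu (by grind) (by grind) (T := fun x => x ≠ o) ?_ ?_ rfl
    · intro s t hs hst sv tv g1 g2 ht
      subst ht
      have h3 := hf s t sv tv hst
      have h4 := hcon s hst.symm
      grind
    · rintro rfl
      exact o6 hr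
  have k8 := C.k8
  -- counting
  let J : Finset (Fin k) := ((uset G f v) \ {y, y'}).image f
  have hJ : k - 3 ≤ J.card := by
    have : J.card = ((uset G f v) \ {y, y'}).card := by
      apply Finset.card_image_of_injOn
      intro a ha b hb hab
      simp [uset] at ha hb
      exact hb.1.2 a ha.1.1 hab
    have h1 := uset_card C hf
    have h2 := Finset.le_card_sdiff ({y, y'} : Finset V) (uset G f v)
    have h3 : ({y, y'} : Finset V).card ≤ 2 := Finset.card_le_two
    omega
  have hsub : J ⊆ (Finset.univ.filter (fun c => Rep G f v z c)) ∪
      (Finset.univ.filter (fun c => Rep G f v z' c)) ∪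
      ((Finset.univ.filter (fun c => Rep G f v o c)) \ {f z}) := by
    intro c hc
    simp only [J, Finset.mem_image, Finset.mem_sdiff, uset, Finset.mem_filter, Finset.mem_univ,
      true_and, Finset.mem_insert, Finset.mem_singleton, not_or] at hc
    obtain ⟨r, ⟨hr, h1, h2⟩, rfl⟩ := hc
    have h3 := (B.col hr).1
    simp only [Finset.mem_union, Finset.mem_filter, Finset.mem_univ, true_and, Finset.mem_sdiff,
      Finset.mem_singleton]
    have := key r hr h1 h2
    tauto
  have z1 : (Finset.univ.filter (fun c => Rep G f v z c)).card ≤ 1 := by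
    rw [Finset.card_le_one]
    intro a ha b hb
    simp at ha hb
    exact rep_le_one C B.hz (fun c hc => B.b6 C hf hc) ha hb
  have z2 : (Finset.univ.filter (fun c => Rep G f v z' c)).card ≤ 1 := by
    rw [Finset.card_le_one]
    intro a ha b hb
    simp at ha hb
    exact rep_le_one C B.hz' (fun c hc => B.b2 C hf (e ▸ hc)) ha hb
  have z3 := count_rep (nb G o) (Finset.univ \ {f z})
    ((Finset.univ.filter (fun c => Rep G f v o c)) \ {f z}) f (by
      intro c hc
      obtain ⟨x, h1, h2⟩ := so c (by simpa using hc)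
      exact ⟨x, mem_nb.2 h1, h2⟩) (by intro c; simp) (by
      intro c hc
      simp only [Finset.mem_sdiff, Finset.mem_filter, Finset.mem_univ, true_and] at hc
      obtain ⟨⟨x, y, h1, h2, h3, h4, h5, h6, h7⟩, _⟩ := hc
      exact ⟨x, mem_nb.2 h4, y, mem_nb.2 h5, h1, h6, h7⟩)
  have z4 := C.deg o (nb G o) (fun x hx => mem_nb.1 hx)
  have z5 : (Finset.univ \ {f z} : Finset (Fin k)).card = k - 1 := by
    rw [Finset.card_sdiff_of_subset (by simp)]; simp
  have z6 := Finset.card_le_card hsub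
  have z7 := Finset.card_union_le ((Finset.univ.filter (fun c => Rep G f v z c)) ∪
      (Finset.univ.filter (fun c => Rep G f v z' c)))
      ((Finset.univ.filter (fun c => Rep G f v o c)) \ {f z})
  have z8 := Finset.card_union_le (Finset.univ.filter (fun c => Rep G f v z c))
      (Finset.univ.filter (fun c => Rep G f v z' c))
  omega

theorem clawfree (C : Crit G k) {v a b c : V} (ha : G.Adj v a) (hb : G.Adj v b) (hc : G.Adj v c)
    (ab : ¬ G.Adj a b) (ac : ¬ G.Adj a c) (bc : ¬ G.Adj b c) (nab : a ≠ b) (nac : a ≠ c)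
    (nbc : b ≠ c) : False := by
  obtain ⟨f, hf⟩ := C.del v
  have ba : ¬ G.Adj b a := fun h => ab h.symm
  have ca : ¬ G.Adj c a := fun h => ac h.symm
  have cb : ¬ G.Adj c b := fun h => bc h.symm
  -- auxiliary: leaf `z` not unique
  have key : ∀ z y y', G.Adj v z → G.Adj v y → G.Adj v y' → ¬ G.Adj z y → ¬ G.Adj z y' →
      ¬ G.Adj y y' → z ≠ y → z ≠ y' → y ≠ y' → ¬ Uniq G f v z → False := by
    intro z y y' hz hy hy' zy zy' yy' n1 n2 n3 hu
    have : ∃ z', G.Adj v z' ∧ z ≠ z' ∧ f z = f z' := by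
      by_contra hcon
      push Not at hcon
      refine hu ⟨hz, fun x hx fx => ?_⟩
      by_contra hn
      exact hcon x hx (fun h => hn h.symm) fx.symm
    obtain ⟨z', hz', hne, e⟩ := this
    have hun := (uset_pair C hf hz hz' hne e).1
    by_cases h1 : y = z'
    · subst h1
      have := B2 C hf hz hz' hne e (hun y' hy' n2.symm n3.symm)
      rcases this with h | h
      · exact zy' h.symm
      · exact yy' h.symm
    by_cases h2 : y' = z'
    · subst h2
      have := B2 C hf hz hz' hne e (hun y hy n1.symm n3)
      rcases this with h | h
      · exact zy h.symm
      · exact yy' h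
    exact BS.false C hf (B := ⟨hz, hz', hne, e, hun y hy n1.symm h1, hun y' hy' n2.symm h2, zy, zy',
      yy', n3⟩)
  by_cases u1 : Uniq G f v a
  · by_cases u2 : Uniq G f v b
    · by_cases u3 : Uniq G f v c
      · exact caseA C hf u1 u2 u3 ab ac bc nab nac nbc
      · exact key c a b hc ha hb ca cb ab nac.symm nbc.symm nab u3
    · exact key b a c hb ha hc ba bc ac nab.symm nbc nac u2
  · exact key a b c ha hb hc ab ac bc nab nac nbc u1
end
end BK

open SimpleGraph
set_option linter.all false
set_option linter.unusedSectionVars false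
set_option linter.unusedVariables false
set_option linter.unusedSimpArgs false
namespace BK
section
open scoped Classical
variable {V : Type*} [Fintype V] {G : SimpleGraph V} {k : ℕ}

def Cliq (G : SimpleGraph V) (s : Finset V) : Prop := ∀ x ∈ s, ∀ y ∈ s, x ≠ y → G.Adj x y

def CF (G : SimpleGraph V) : Prop := ∀ v a b c, G.Adj v a → G.Adj v b → G.Adj v c →
    ¬ G.Adj a b → ¬ G.Adj a c → ¬ G.Adj b c → a ≠ b → a ≠ c → b ≠ c → False

lemma crit_cf (C : Crit G k) : CF G := fun _ _ _ _ ha hb hc ab ac bc nab nac nbc =>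
  clawfree C ha hb hc ab ac bc nab nac nbc

def NoInd3 (G : SimpleGraph V) (N : Finset V) : Prop := ∀ a ∈ N, ∀ b ∈ N, ∀ c ∈ N,
    ¬ G.Adj a b → ¬ G.Adj a c → ¬ G.Adj b c → a ≠ b → a ≠ c → b ≠ c → False

lemma ram33 {N : Finset V} (h3 : NoInd3 G N) (hN : 6 ≤ N.card) :
    ∃ a ∈ N, ∃ b ∈ N, ∃ c ∈ N, G.Adj a b ∧ G.Adj a c ∧ G.Adj b c := by
  have hne : N.Nonempty := Finset.card_pos.1 (by omega)
  obtain ⟨x, hx⟩ := hne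
  have h1 := Finset.card_erase_of_mem hx
  have h2 := Finset.card_filter_add_card_filter_not (s := N.erase x) (fun y => G.Adj x y)
  by_cases h : 2 < ((N.erase x).filter (fun y => G.Adj x y)).card
  · obtain ⟨a, b, c, ha, hb, hc, nab, nac, nbc⟩ := Finset.two_lt_card_iff.1 h
    simp at ha hb hc
    have := h3 a ha.1.2 b hb.1.2 c hc.1.2
    by_cases ab : G.Adj a b
    · exact ⟨x, hx, a, ha.1.2, b, hb.1.2, ha.2, hb.2, ab⟩
    by_cases ac : G.Adj a c
    · exact ⟨x, hx, a, ha.1.2, c, hc.1.2, ha.2, hc.2, ac⟩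
    by_cases bc : G.Adj b c
    · exact ⟨x, hx, b, hb.1.2, c, hc.1.2, hb.2, hc.2, bc⟩
    exact (this ab ac bc nab nac nbc).elim
  · have h : 2 < ((N.erase x).filter (fun y => ¬ G.Adj x y)).card := by omega
    obtain ⟨a, b, c, ha, hb, hc, nab, nac, nbc⟩ := Finset.two_lt_card_iff.1 h
    simp at ha hb hc
    have e : ∀ p q, p ∈ N → q ∈ N → ¬ G.Adj x p → ¬ G.Adj x q → p ≠ x → q ≠ x → p ≠ q → G.Adj p q := by
      intro p q hp hq h1 h2 px qx hpq
      by_contra hn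
      exact h3 x hx p hp q hq h1 h2 hn px.symm qx.symm hpq
    exact ⟨a, ha.1.2, b, hb.1.2, c, hc.1.2, e a b ha.1.2 hb.1.2 ha.2 hb.2 ha.1.1 hb.1.1 nab,
      e a c ha.1.2 hc.1.2 ha.2 hc.2 ha.1.1 hc.1.1 nac, e b c hb.1.2 hc.1.2 hb.2 hc.2 hb.1.1 hc.1.1 nbc⟩

lemma ram34 {N : Finset V} (h3 : NoInd3 G N) (hN : N.card = 9) :
    ∃ s ⊆ N, s.card = 4 ∧ Cliq G s := by
  by_contra hcon
  push Not at hcon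
  have hM : ∀ x ∈ N, ((N.erase x).filter (fun y => ¬ G.Adj x y)).card ≤ 3 := by
    intro x hx
    by_contra hlt
    push Not at hlt
    obtain ⟨s, hs, hs4⟩ := Finset.exists_subset_card_eq (show 4 ≤ _ from hlt)
    refine hcon s (fun y hy => by have := hs hy; simp at this; exact this.1.2) hs4 ?_
    intro p hp q hq hpq
    have h1 := hs hp
    have h2 := hs hq
    simp at h1 h2
    by_contra hn
    exact h3 x hx p h1.1.2 q h2.1.2 h1.2 h2.2 hn (Ne.symm h1.1.1) (Ne.symm h2.1.1) hpq
  have hM3 : ∀ x ∈ N, ((N.erase x).filter (fun y => ¬ G.Adj x y)).card = 3 := by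
    intro x hx
    by_contra hne
    have hlt := hM x hx
    have h1 := Finset.card_erase_of_mem hx
    have h2 := Finset.card_filter_add_card_filter_not (s := N.erase x) (fun y => G.Adj x y)
    have h6 : 6 ≤ ((N.erase x).filter (fun y => G.Adj x y)).card := by omega
    have hsub : ((N.erase x).filter (fun y => G.Adj x y)) ⊆ N := by
      intro y hy; simp at hy; exact hy.1.2
    obtain ⟨a, ha, b, hb, c, hc, ab, ac, bc⟩ := ram33 (G := G)
      (fun a ha b hb c hc => h3 a (hsub ha) b (hsub hb) c (hsub hc)) h6
    simp at ha hb hc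
    have := ab.ne
    have := ac.ne
    have := bc.ne
    have := ab.symm
    have := ac.symm
    have := bc.symm
    have := ha.2.symm
    have := hb.2.symm
    have := hc.2.symm
    refine hcon {x, a, b, c} ?_ ?_ ?_
    · intro y hy; simp at hy; grind
    · rw [Finset.card_insert_of_notMem, Finset.card_insert_of_notMem, Finset.card_pair] <;> grind
    · intro p hp q hq hpq
      simp only [Finset.mem_insert, Finset.mem_singleton] at hp hq
      grind
  let H : SimpleGraph V :=
    { Adj := fun x y => x ∈ N ∧ y ∈ N ∧ x ≠ y ∧ ¬ G.Adj x y
      symm := ⟨fun x y h => ⟨h.2.1, h.1, h.2.2.1.symm, fun h' => h.2.2.2 h'.symm⟩⟩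
      loopless := ⟨fun x h => h.2.2.1 rfl⟩ }
  have hd : ∀ x, H.degree x = if x ∈ N then 3 else 0 := by
    intro x
    rw [← SimpleGraph.card_neighborFinset_eq_degree]
    split_ifs with hx
    · rw [← hM3 x hx]
      congr 1
      ext y
      simp [H, hx]
      tauto
    · rw [Finset.card_eq_zero]
      ext y
      simp [H, hx]
  have hs := H.sum_degrees_eq_twice_card_edges
  simp only [hd] at hs
  simp [hN] at hs
  omega

lemma exists_five (C : Crit G k) [Nonempty V] : ∃ s : Finset V, s.card = 5 ∧ Cliq G s := by
  have cf := crit_cf C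
  have k8 := C.k8
  by_cases hd : ∃ v, 9 ≤ (nb G v).card
  · obtain ⟨v, hv⟩ := hd
    obtain ⟨N, hN, hN9⟩ := Finset.exists_subset_card_eq hv
    obtain ⟨s, hs, h4, hc⟩ := ram34 (G := G) (N := N) (by
      intro a ha b hb c hc
      exact cf v a b c (mem_nb.1 (hN ha)) (mem_nb.1 (hN hb)) (mem_nb.1 (hN hc))) hN9
    have hvs : ∀ x ∈ s, G.Adj v x := fun x hx => mem_nb.1 (hN (hs hx))
    have hvn : v ∉ s := fun h => (hvs v h).ne rfl
    refine ⟨insert v s, by rw [Finset.card_insert_of_notMem hvn, h4], ?_⟩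
    intro p hp q hq hpq
    rw [Finset.mem_insert] at hp hq
    rcases hp with rfl | hp <;> rcases hq with rfl | hq
    · exact absurd rfl hpq
    · exact hvs q hq
    · exact (hvs p hp).symm
    · exact hc p hp q hq hpq
  · push Not at hd
    have inj : ∀ (v : V) (f : V → Fin k), P1 G v f → ∀ x y, G.Adj v x → G.Adj v y → f x = f y → x = y := by
      intro v f hf x y hx hy hxy
      refine count_inj (nb G v) Finset.univ f ?_ ?_ x (mem_nb.2 hx) y (mem_nb.2 hy) hxy
      · intro c _
        obtain ⟨x, hx, h⟩ := sees C hf c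
        exact ⟨x, mem_nb.2 hx, h⟩
      · have := hd v
        simp; omega
    obtain ⟨v⟩ := ‹Nonempty V›
    obtain ⟨f, hf⟩ := C.del v
    have uq : ∀ x, G.Adj v x → Uniq G f v x := fun x hx => ⟨hx, fun y hy h => inj v f hf y x hy hx h⟩
    have hk : k ≤ (nb G v).card := card_nb_ge C hf _ (fun c => by
      obtain ⟨x, hx, h⟩ := sees C hf c
      exact ⟨x, mem_nb.2 hx, h⟩)
    have nrep : ∀ b c, G.Adj v b → ¬ Rep G f v b c := by
      rintro b c hb ⟨x, y, h1, h2, h3, h4, h5, h6, h7⟩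
      refine h1 (inj b _ (shift hf (uq b hb)) x y h4 h5 ?_)
      rw [Function.update_of_ne h2, Function.update_of_ne h3, h6, h7]
    have hnc : ∃ b c, G.Adj v b ∧ G.Adj v c ∧ b ≠ c ∧ ¬ G.Adj b c := by
      by_contra hcon
      push Not at hcon
      have hvn : v ∉ nb G v := fun h => (mem_nb.1 h).ne rfl
      have := C.clq (insert v (nb G v)) (by
        intro p hp q hq hpq
        rw [Finset.mem_insert, mem_nb] at hp hq
        rcases hp with rfl | hp <;> rcases hq with rfl | hq
        · exact absurd rfl hpq
        · exact hq
        · exact hp.symm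
        · exact hcon p q hp hq hpq)
      rw [Finset.card_insert_of_notMem hvn] at this
      omega
    obtain ⟨b, c, hb, hc, hne, hbc⟩ := hnc
    have fin : ∀ b c, G.Adj v b → G.Adj v c → b ≠ c → ¬ G.Adj b c →
        2 < ((((nb G v).erase b).erase c).filter (fun r => G.Adj r b)).card →
        ∃ s : Finset V, s.card = 5 ∧ Cliq G s := by
      intro b c hb hc hne hbc h
      obtain ⟨r1, r2, r3, m1, m2, m3, n12, n13, n23⟩ := Finset.two_lt_card_iff.1 h
      simp only [Finset.mem_filter, Finset.mem_erase, mem_nb] at m1 m2 m3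
      have nc : ∀ r, G.Adj v r → G.Adj r b → ¬ G.Adj r c := by
        intro r hr h1 h2
        rcases lemR C hf (uq b hb) (uq c hc) (uq r hr) hbc hne h1 h2 with h | h
        · exact nrep _ _ hb h
        · exact nrep _ _ hc h
      have ad : ∀ r s, G.Adj v r → G.Adj v s → G.Adj r b → G.Adj s b → r ≠ s → r ≠ c → s ≠ c →
          G.Adj r s := by
        intro r s hr hs h1 h2 hrs rc sc
        by_contra hn
        exact cf v r s c hr hs hc hn (nc r hr h1) (nc s hs h2) hrs rc sc
      have a12 := ad r1 r2 m1.1.2.2 m2.1.2.2 m1.2 m2.2 n12 m1.1.1 m2.1.1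
      have a13 := ad r1 r3 m1.1.2.2 m3.1.2.2 m1.2 m3.2 n13 m1.1.1 m3.1.1
      have a23 := ad r2 r3 m2.1.2.2 m3.1.2.2 m2.2 m3.2 n23 m2.1.1 m3.1.1
      have vv : ∀ r, G.Adj v r → v ≠ r := fun r hr => hr.ne
      have sm : ∀ x y, G.Adj x y → G.Adj y x := fun x y h => h.symm
      refine ⟨{v, b, r1, r2, r3}, ?_, ?_⟩
      · rw [Finset.card_insert_of_notMem, Finset.card_insert_of_notMem, Finset.card_insert_of_notMem,
          Finset.card_pair] <;> grind
      · intro p hp q hq hpq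
        simp only [Finset.mem_insert, Finset.mem_singleton] at hp hq
        grind
    by_cases h1 : 2 < ((((nb G v).erase b).erase c).filter (fun r => G.Adj r b)).card
    · exact fin b c hb hc hne hbc h1
    · apply fin c b hc hb hne.symm (fun h => hbc h.symm)
      have h2 := Finset.card_filter_add_card_filter_not (s := ((nb G v).erase b).erase c)
        (fun y => G.Adj y b)
      have h3 := Finset.card_erase_of_mem (s := nb G v) (mem_nb.2 hb)
      have h4 := Finset.card_erase_of_mem (s := (nb G v).erase b) (a := c)
        (by simp [mem_nb, hc, hne.symm])
      have h5 : (((nb G v).erase b).erase c).filter (fun y => ¬ G.Adj y b) ⊆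
          (((nb G v).erase c).erase b).filter (fun y => G.Adj y c) := by
        intro r hr
        simp only [Finset.mem_filter, Finset.mem_erase, mem_nb] at hr ⊢
        refine ⟨by tauto, ?_⟩
        by_contra hn
        exact cf v r b c hr.1.2.2 hb hc hr.2 hn hbc hr.1.2.1 hr.1.1 hne
      have h6 := Finset.card_le_card h5
      omega
end
end BK

open SimpleGraph
set_option linter.all false
set_option linter.unusedSectionVars false
set_option linter.unusedVariables false
set_option linter.unusedSimpArgs false
namespace BK
section
open scoped Classical
variable {V : Type*} [Fintype V] {G : SimpleGraph V} {k : ℕ}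

def PO (G : SimpleGraph V) (S : Finset V) (f : V → Fin k) : Prop :=
  ∀ x y, x ∉ S → y ∉ S → G.Adj x y → f x ≠ f y

def Sees (G : SimpleGraph V) (S : Finset V) (f : V → Fin k) (w : V) (c : Fin k) : Prop :=
  ∃ x, x ∉ S ∧ G.Adj w x ∧ f x = c

noncomputable def L (G : SimpleGraph V) (S : Finset V) (f : V → Fin k) (w : V) : Finset (Fin k) :=
  Finset.univ.filter (fun c => ¬ Sees G S f w c)

lemma mem_L {S : Finset V} {f : V → Fin k} {w : V} {c : Fin k} :
    c ∈ L G S f w ↔ ¬ Sees G S f w c := by simp [L]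

noncomputable def out (G : SimpleGraph V) (S : Finset V) (w : V) : Finset V := nb G w \ S

lemma mem_out {S : Finset V} {w x : V} : x ∈ out G S w ↔ G.Adj w x ∧ x ∉ S := by
  simp [out, mem_nb]

lemma out_card (C : Crit G k) {S : Finset V} (hS : Cliq G S) {w : V} (hw : w ∈ S) :
    (out G S w).card + S.card ≤ k + 2 := by
  have h1 : out G S w ∪ S.erase w ⊆ nb G w := by
    intro x hx
    simp only [Finset.mem_union, mem_out, Finset.mem_erase] at hx
    rw [mem_nb]
    rcases hx with h | h
    · exact h.1
    · exact hS w hw x h.2 (Ne.symm h.1)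
  have h2 : Disjoint (out G S w) (S.erase w) := by
    rw [Finset.disjoint_left]
    intro x hx hx'
    exact (mem_out.1 hx).2 (Finset.mem_of_mem_erase hx')
  have h3 := Finset.card_le_card h1
  rw [Finset.card_union_of_disjoint h2, Finset.card_erase_of_mem hw] at h3
  have h4 := C.deg w (nb G w) (fun x hx => mem_nb.1 hx)
  have h5 : 0 < S.card := Finset.card_pos.2 ⟨w, hw⟩
  omega

/-- outside neighbours of a vertex with many neighbours in `S`. -/
lemma out_card' (C : Crit G k) {S : Finset V} {p : V} :
    (out G S p).card + (S.filter (fun w => G.Adj p w)).card ≤ k + 1 := by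
  have h1 : out G S p ∪ S.filter (fun w => G.Adj p w) ⊆ nb G p := by
    intro x hx
    simp only [Finset.mem_union, mem_out, Finset.mem_filter] at hx
    rw [mem_nb]
    tauto
  have h2 : Disjoint (out G S p) (S.filter (fun w => G.Adj p w)) := by
    rw [Finset.disjoint_left]
    intro x hx hx'
    exact (mem_out.1 hx).2 (Finset.mem_filter.1 hx').1
  have h3 := Finset.card_le_card h1
  rw [Finset.card_union_of_disjoint h2] at h3
  exact h3.trans (C.deg p (nb G p) (fun x hx => mem_nb.1 hx))

lemma sees_card {S : Finset V} {f : V → Fin k} {w : V} {D : Finset (Fin k)}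
    (h : ∀ c ∈ D, Sees G S f w c) : D.card ≤ (out G S w).card := by
  have : D ⊆ (out G S w).image f := by
    intro c hc
    obtain ⟨x, h1, h2, h3⟩ := h c hc
    exact Finset.mem_image.2 ⟨x, mem_out.2 ⟨h2, h1⟩, h3⟩
  exact (Finset.card_le_card this).trans Finset.card_image_le

lemma L_card_add {S : Finset V} {f : V → Fin k} {w : V} :
    k ≤ (L G S f w).card + (out G S w).card := by
  have h1 := sees_card (G := G) (S := S) (f := f) (w := w) (D := (L G S f w)ᶜ) (by
    intro c hc
    rw [Finset.mem_compl, mem_L] at hc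
    exact not_not.1 hc)
  rw [Finset.card_compl, Fintype.card_fin] at h1
  omega

lemma L_card (C : Crit G k) {S : Finset V} (hS : Cliq G S) {f : V → Fin k} {w : V} (hw : w ∈ S) :
    S.card ≤ (L G S f w).card + 2 := by
  have h1 := L_card_add (G := G) (S := S) (f := f) (w := w)
  have h2 := out_card C hS hw
  omega

lemma noInj (C : Crit G k) {S : Finset V} {f : V → Fin k} (hf : PO G S f) (g : V → Fin k)
    (hg : ∀ w ∈ S, g w ∈ L G S f w) (hi : ∀ x ∈ S, ∀ y ∈ S, g x = g y → x = y) : False := by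
  obtain ⟨x, y, hxy, h⟩ := C.noCol (fun x => if x ∈ S then g x else f x)
  have h1 := hxy.ne
  have h2 := hxy.symm
  by_cases hx : x ∈ S <;> by_cases hy : y ∈ S <;> simp [hx, hy] at h
  · exact h1 (hi x hx y hy h)
  · exact mem_L.1 (hg x hx) ⟨y, hy, hxy, h.symm⟩
  · exact mem_L.1 (hg y hy) ⟨x, hx, h2, h⟩
  · exact hf x y hx hy hxy h

def Bad (G : SimpleGraph V) (S : Finset V) (f : V → Fin k) : Prop :=
  ∃ u ∈ S, ∃ Λ : Finset (Fin k), Λ.card + 2 = S.card ∧ ∀ w ∈ S, w ≠ u → L G S f w = Λ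

lemma dich (C : Crit G k) {S : Finset V} (hS : Cliq G S) {f : V → Fin k} (hf : PO G S f) :
    (∃ Φ : Finset (Fin k), Φ.card + 1 = S.card ∧ ∀ w ∈ S, L G S f w ⊆ Φ) ∨ Bad G S f := by
  have hk := C.clq S hS
  have hall : ¬ ∀ s : Finset S, s.card ≤ (s.biUnion (fun w : S => L G S f w)).card := by
    intro h
    obtain ⟨g, gi, gm⟩ := (Finset.all_card_le_biUnion_card_iff_exists_injective _).1 h
    have k8 := C.k8
    refine noInj C hf (fun x => if h : x ∈ S then g ⟨x, h⟩ else ⟨0, by omega⟩) ?_ ?_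
    · intro w hw
      simp only [hw, dif_pos]
      exact gm ⟨w, hw⟩
    · intro x hx y hy hxy
      simp only [hx, hy, dif_pos] at hxy
      exact congrArg Subtype.val (gi hxy)
  push Not at hall
  obtain ⟨W', hW'⟩ := hall
  set W : Finset V := W'.map (Function.Embedding.subtype _) with hWd
  have hWS : W ⊆ S := by
    intro x hx
    simp only [hWd, Finset.mem_map] at hx
    obtain ⟨y, _, rfl⟩ := hx
    exact y.2
  have hWc : W.card = W'.card := by simp [hWd]
  set U := W'.biUnion (fun w : S => L G S f w) with hU
  have hLU : ∀ w ∈ W, L G S f w ⊆ U := by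
    intro w hw c hc
    simp only [hWd, Finset.mem_map] at hw
    obtain ⟨y, hy, rfl⟩ := hw
    exact Finset.mem_biUnion.2 ⟨y, hy, hc⟩
  have hne : W.Nonempty := Finset.card_pos.1 (by omega)
  obtain ⟨w0, hw0⟩ := hne
  have hw0S := hWS hw0
  have h1 := L_card C hS (f := f) hw0S
  have h2 := Finset.card_le_card (hLU w0 hw0)
  have h3 := Finset.card_le_card hWS
  by_cases hEq : W.card = S.card
  · left
    have hWeq : W = S := Finset.eq_of_subset_of_card_le hWS hEq.ge
    obtain ⟨Φ, hΦ1, -, hΦ2⟩ := Finset.exists_subsuperset_card_eq (s := U) (t := Finset.univ)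
      (Finset.subset_univ _) (n := S.card - 1) (by omega) (by simp; omega)
    refine ⟨Φ, by omega, fun w hw => (hLU w (hWeq ▸ hw)).trans hΦ1⟩
  · right
    have hW1 : W.card + 1 = S.card := by omega
    have hUc : U.card + 2 = S.card := by omega
    have : ∃ u ∈ S, u ∉ W := by
      by_contra hcon
      push Not at hcon
      have := Finset.card_le_card (show S ⊆ W from hcon)
      omega
    obtain ⟨u, hu, huW⟩ := this
    have hWe : W = S.erase u := by
      apply Finset.eq_of_subset_of_card_le
      · intro x hx
        rw [Finset.mem_erase]
        exact ⟨fun h => huW (h ▸ hx), hWS hx⟩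
      · rw [Finset.card_erase_of_mem hu]; omega
    refine ⟨u, hu, U, hUc, fun w hw hwu => ?_⟩
    apply Finset.eq_of_subset_of_card_le
    · apply hLU; rw [hWe, Finset.mem_erase]; exact ⟨hwu, hw⟩
    · have := L_card C hS (f := f) hw
      omega

structure Tight (G : SimpleGraph V) (S : Finset V) (f : V → Fin k) (Φ : Finset (Fin k)) : Prop where
  cl : Cliq G S
  po : PO G S f
  card : Φ.card + 1 = S.card
  sub : ∀ w ∈ S, L G S f w ⊆ Φ
  nbad : ¬ Bad G S f

variable {S : Finset V} {f : V → Fin k} {Φ : Finset (Fin k)}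

lemma Tight.sees (T : Tight G S f Φ) {w : V} (hw : w ∈ S) {c : Fin k} (hc : c ∉ Φ) :
    Sees G S f w c := by
  by_contra h
  exact hc (T.sub w hw (mem_L.2 h))

/-- if all `w ≠ u` see `γ ∈ Φ`, contradiction. -/
lemma Tight.four (C : Crit G k) (T : Tight G S f Φ) {u : V} (hu : u ∈ S) {γ : Fin k} (hγ : γ ∈ Φ)
    (h : ∀ w ∈ S, w ≠ u → Sees G S f w γ) : False := by
  have hc := T.card
  have hp : 0 < Φ.card := Finset.card_pos.2 ⟨γ, hγ⟩
  refine T.nbad ⟨u, hu, Φ.erase γ, ?_, fun w hw hwu => ?_⟩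
  · rw [Finset.card_erase_of_mem hγ]; omega
  · apply Finset.eq_of_subset_of_card_le
    · intro c hcL
      rw [Finset.mem_erase]
      refine ⟨?_, T.sub w hw hcL⟩
      rintro rfl
      exact mem_L.1 hcL (h w hw hwu)
    · have := L_card C T.cl (f := f) hw
      rw [Finset.card_erase_of_mem hγ]; omega

lemma Tight.all (C : Crit G k) (T : Tight G S f Φ) {γ : Fin k} (hγ : γ ∈ Φ) :
    ∃ w ∈ S, ¬ Sees G S f w γ := by
  by_contra hcon
  push Not at hcon
  have hc := T.card
  have : 0 < S.card := by omega
  obtain ⟨u, hu⟩ := Finset.card_pos.1 this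
  exact T.four C hu hγ (fun w hw _ => hcon w hw)

lemma Tight.miss (C : Crit G k) (T : Tight G S f Φ) {w : V} (hw : w ∈ S) {γ δ : Fin k} (hγ : γ ∈ Φ)
    (hδ : δ ∈ Φ) (h1 : Sees G S f w γ) (h2 : Sees G S f w δ) : γ = δ := by
  by_contra hne
  have hsub : L G S f w ⊆ (Φ.erase γ).erase δ := by
    intro c hc
    have := T.sub w hw hc
    rw [mem_L] at hc
    simp only [Finset.mem_erase]
    refine ⟨?_, ?_, this⟩ <;> rintro rfl <;> exact hc (by assumption)
  have h3 := Finset.card_le_card hsub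
  have h4 : δ ∈ Φ.erase γ := Finset.mem_erase.2 ⟨Ne.symm hne, hδ⟩
  have h5 := Finset.card_pos.2 ⟨_, h4⟩
  rw [Finset.card_erase_of_mem h4] at h3
  rw [Finset.card_erase_of_mem hγ] at h3 h5
  have := L_card C T.cl (f := f) hw
  have := T.card
  omega

lemma Tight.ccard (T : Tight G S f Φ) : (Φᶜ).card + S.card = k + 1 := by
  have := T.card
  have h2 := Finset.card_le_univ Φ
  rw [Finset.card_compl]
  simp at *
  omega

lemma Tight.pair (C : Crit G k) (T : Tight G S f Φ) {w : V} (hw : w ∈ S) {x1 x2 y1 y2 : V}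
    (hx1 : G.Adj w x1) (hx2 : G.Adj w x2) (hy1 : G.Adj w y1) (hy2 : G.Adj w y2)
    (sx1 : x1 ∉ S) (sx2 : x2 ∉ S) (sy1 : y1 ∉ S) (sy2 : y2 ∉ S)
    (hx : x1 ≠ x2) (hy : y1 ≠ y2) (fx : f x1 = f x2) (fy : f y1 = f y2) :
    (x1 = y1 ∧ x2 = y2) ∨ (x1 = y2 ∧ x2 = y1) := by
  refine count_pair (out G S w) Φᶜ f ?_ ?_ (mem_out.2 ⟨hx1, sx1⟩) (mem_out.2 ⟨hx2, sx2⟩)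
    (mem_out.2 ⟨hy1, sy1⟩) (mem_out.2 ⟨hy2, sy2⟩) hx hy fx fy
  · intro c hc
    obtain ⟨x, h1, h2, h3⟩ := T.sees hw (Finset.mem_compl.1 hc)
    exact ⟨x, mem_out.2 ⟨h2, h1⟩, h3⟩
  · have h1 := out_card C T.cl hw
    have h2 := T.ccard
    omega

lemma Tight.rain (C : Crit G k) (T : Tight G S f Φ) {w : V} (hw : w ∈ S) {γ : Fin k} (hγ : γ ∈ Φ)
    (hs : Sees G S f w γ) {x y : V} (hx : G.Adj w x) (hy : G.Adj w y) (sx : x ∉ S) (sy : y ∉ S)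
    (fxy : f x = f y) : x = y := by
  refine count_inj (out G S w) (insert γ Φᶜ) f ?_ ?_ x (mem_out.2 ⟨hx, sx⟩) y (mem_out.2 ⟨hy, sy⟩) fxy
  · intro c hc
    have : Sees G S f w c := by
      rw [Finset.mem_insert] at hc
      rcases hc with rfl | hc
      · exact hs
      · exact T.sees hw (Finset.mem_compl.1 hc)
    obtain ⟨x, h1, h2, h3⟩ := this
    exact ⟨x, mem_out.2 ⟨h2, h1⟩, h3⟩
  · have h1 := out_card C T.cl hw
    have h2 := T.ccard
    rw [Finset.card_insert_of_notMem (by simpa using hγ)]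
    omega

lemma Tight.E_aux (C : Crit G k) (T : Tight G S f Φ) {f' : V → Fin k} (hf' : PO G S f') {α : Fin k}
    (hα : α ∉ Φ) (h1 : ∀ γ ∈ Φ, ∃ w ∈ S, γ ∈ L G S f' w) {w1 : V} (hw1 : w1 ∈ S)
    (h2 : α ∈ L G S f' w1) : Bad G S f' := by
  rcases dich C T.cl hf' with ⟨Φ', hc, hs⟩ | h
  · exfalso
    have : insert α Φ ⊆ Φ' := by
      intro γ hγ
      rw [Finset.mem_insert] at hγ
      rcases hγ with rfl | hγ
      · exact hs w1 hw1 h2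
      · obtain ⟨w, hw, h⟩ := h1 γ hγ
        exact hs w hw h
    have := Finset.card_le_card this
    rw [Finset.card_insert_of_notMem hα] at this
    have := T.card
    omega
  · exact h

lemma Tight.E (C : Crit G k) (T : Tight G S f Φ) {f' : V → Fin k} (hf' : PO G S f') {α ρ : Fin k}
    (hα : α ∉ Φ) (hg : ∀ w ∈ S, ∀ c ∈ L G S f w, c ≠ ρ → c ∈ L G S f' w)
    {w1 w2 : V} (hw1 : w1 ∈ S) (hw2 : w2 ∈ S) (h1 : α ∈ L G S f' w1) (h2 : ρ ∈ L G S f w2)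
    (h2' : ρ ∈ L G S f' w2) (h3 : α ∉ L G S f' w2) : False := by
  have hB := T.E_aux C hf' hα (by
    intro γ hγ
    by_cases h : γ = ρ
    · exact ⟨w2, hw2, h ▸ h2'⟩
    · obtain ⟨w, hw, hs⟩ := T.all C hγ
      exact ⟨w, hw, hg w hw γ (mem_L.2 hs) h⟩) hw1 h1
  obtain ⟨u, hu, Λ, hΛ, hL⟩ := hB
  have hρ : ρ ∈ Φ := T.sub w2 hw2 h2
  have hαρ : α ≠ ρ := fun h => hα (h ▸ hρ)
  have hne : w1 ≠ w2 := fun h => h3 (h ▸ h1)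
  have hcard := T.card
  by_cases hu2 : w2 = u
  · subst hu2
    have hαΛ : α ∈ Λ := by rw [← hL w1 hw1 hne]; exact h1
    have hpos := Finset.card_pos.2 ⟨_, hαΛ⟩
    have hsub : ∀ w ∈ S, w ≠ w2 → L G S f w ⊆ insert ρ (Λ.erase α) := by
      intro w hw hwu c hc
      rw [Finset.mem_insert, Finset.mem_erase]
      by_cases hcρ : c = ρ
      · exact Or.inl hcρ
      · refine Or.inr ⟨?_, ?_⟩
        · rintro rfl; exact hα (T.sub w hw hc)
        · rw [← hL w hw hwu]; exact hg w hw c hc hcρ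
    have hle : (insert ρ (Λ.erase α)).card ≤ Λ.card := by
      have := Finset.card_insert_le ρ (Λ.erase α)
      rw [Finset.card_erase_of_mem hαΛ] at this
      omega
    have hge := L_card C T.cl (f := f) hw1
    have hle2 := Finset.card_le_card (hsub w1 hw1 hne)
    refine T.nbad ⟨w2, hu, insert ρ (Λ.erase α), by omega, fun w hw hwu => ?_⟩
    apply Finset.eq_of_subset_of_card_le (hsub w hw hwu)
    have := L_card C T.cl (f := f) hw
    omega
  · have e2 := hL w2 hw2 hu2
    have hρΛ : ρ ∈ Λ := e2 ▸ h2'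
    have hαΛ : α ∉ Λ := e2 ▸ h3
    have hu1 : w1 = u := by
      by_contra h
      rw [hL w1 hw1 h] at h1
      exact hαΛ h1
    refine T.nbad ⟨u, hu, Λ, hΛ, fun w hw hwu => ?_⟩
    apply Finset.eq_of_subset_of_card_le
    · intro c hc
      by_cases hcρ : c = ρ
      · exact hcρ ▸ hρΛ
      · rw [← hL w hw hwu]; exact hg w hw c hc hcρ
    · have := L_card C T.cl (f := f) hw
      omega

lemma Tight.E' (C : Crit G k) (T : Tight G S f Φ) {f' : V → Fin k} (hf' : PO G S f') {α : Fin k}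
    (hα : α ∉ Φ) (hg : ∀ w ∈ S, ∀ c ∈ L G S f w, c ∈ L G S f' w)
    {w1 : V} (hw1 : w1 ∈ S) (h1 : α ∈ L G S f' w1) : False := by
  have hB := T.E_aux C hf' hα (by
    intro γ hγ
    obtain ⟨w, hw, hs⟩ := T.all C hγ
    exact ⟨w, hw, hg w hw γ (mem_L.2 hs)⟩) hw1 h1
  obtain ⟨u, hu, Λ, hΛ, hL⟩ := hB
  refine T.nbad ⟨u, hu, Λ, hΛ, fun w hw hwu => ?_⟩
  apply Finset.eq_of_subset_of_card_le
  · intro c hc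
    rw [← hL w hw hwu]; exact hg w hw c hc
  · have := L_card C T.cl (f := f) hw
    omega

/-- `p` is the unique outside neighbour of `w` with its colour. -/
def UqO (G : SimpleGraph V) (S : Finset V) (f : V → Fin k) (w p : V) : Prop :=
  G.Adj w p ∧ p ∉ S ∧ ∀ x, x ∉ S → G.Adj w x → f x = f p → x = p

lemma po_update (hf : PO G S f) {p : V} {c : Fin k} (h : ¬ Sees G S f p c) :
    PO G S (Function.update f p c) := by
  intro x y hx hy hxy
  have h1 := hf x y hx hy hxy
  have h2 := hxy.symm
  have h3 := hxy.ne
  simp only [Sees, not_exists] at h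
  have h4 := h x
  have h5 := h y
  simp only [Function.update_apply]
  grind

lemma Tight.T2a (C : Crit G k) (T : Tight G S f Φ) {p x0 : V} (hx0 : x0 ∈ S) (hp : UqO G S f x0 p)
    (hα : f p ∉ Φ) {ρ : Fin k} (hρ : ρ ∈ Φ) {w : V} (hw : w ∈ S) (hpw : ¬ G.Adj p w)
    (hsw : ¬ Sees G S f w ρ) : Sees G S f p ρ := by
  by_contra hn
  have hne : f p ≠ ρ := fun h => hα (h ▸ hρ)
  refine T.E C (po_update T.po hn) (α := f p) (ρ := ρ) hα ?_ hx0 hw ?_ (mem_L.2 hsw) ?_ ?_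
  · intro w hw c hc hcρ
    rw [mem_L] at hc ⊢
    rintro ⟨x, h1, h2, h3⟩
    rw [Function.update_apply] at h3
    split_ifs at h3 with h
    · exact hcρ h3.symm
    · exact hc ⟨x, h1, h2, h3⟩
  · rw [mem_L]
    rintro ⟨x, h1, h2, h3⟩
    rw [Function.update_apply] at h3
    split_ifs at h3 with h
    · exact hne h3.symm
    · exact h (hp.2.2 x h1 h2 h3)
  · rw [mem_L]
    rintro ⟨x, h1, h2, h3⟩
    rw [Function.update_apply] at h3
    split_ifs at h3 with h
    · exact hpw (h ▸ h2).symm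
    · exact hsw ⟨x, h1, h2, h3⟩
  · rw [mem_L, not_not]
    obtain ⟨x, h1, h2, h3⟩ := T.sees hw hα
    have : x ≠ p := by rintro rfl; exact hpw h2.symm
    exact ⟨x, h1, h2, by rw [Function.update_of_ne this, h3]⟩

lemma Tight.T2b (C : Crit G k) (T : Tight G S f Φ) {p x0 : V} (hx0 : x0 ∈ S) (hp : UqO G S f x0 p)
    (hα : f p ∉ Φ) {ζ : Fin k} (hζ : ζ ∉ Φ) (hne : ζ ≠ f p) : Sees G S f p ζ := by
  by_contra hn
  refine T.E' C (po_update T.po hn) (α := f p) hα ?_ hx0 ?_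
  · intro w hw c hc
    have hcΦ := T.sub w hw hc
    rw [mem_L] at hc ⊢
    rintro ⟨x, h1, h2, h3⟩
    rw [Function.update_apply] at h3
    split_ifs at h3 with h
    · exact hζ (h3 ▸ hcΦ)
    · exact hc ⟨x, h1, h2, h3⟩
  · rw [mem_L]
    rintro ⟨x, h1, h2, h3⟩
    rw [Function.update_apply] at h3
    split_ifs at h3 with h
    · exact hne h3
    · exact h (hp.2.2 x h1 h2 h3)

lemma Tight.T2c (C : Crit G k) (T : Tight G S f Φ) {p x0 : V} (hx0 : x0 ∈ S) (hp : UqO G S f x0 p)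
    (hα : f p ∉ Φ) (h : ∀ ρ ∈ Φ, ∃ w ∈ S, ¬ G.Adj p w ∧ ¬ Sees G S f w ρ) :
    (∀ c, c ≠ f p → Sees G S f p c) ∧ (S.filter (fun w => G.Adj p w)).card ≤ 2 := by
  have h1 : ∀ c, c ≠ f p → Sees G S f p c := by
    intro c hc
    by_cases hΦ : c ∈ Φ
    · obtain ⟨w, h1, h2, h3⟩ := h c hΦ
      exact T.T2a C hx0 hp hα hΦ h1 h2 h3
    · exact T.T2b C hx0 hp hα hΦ hc
  refine ⟨h1, ?_⟩
  have h2 := sees_card (G := G) (S := S) (f := f) (w := p) (D := Finset.univ.erase (f p))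
    (fun c hc => h1 c (Finset.ne_of_mem_erase hc))
  rw [Finset.card_erase_of_mem (Finset.mem_univ _)] at h2
  have h3 := out_card' C (S := S) (p := p)
  simp at h2
  have := C.k8
  omega

lemma Tight.T2 (C : Crit G k) (T : Tight G S f Φ) {p x0 y0 : V} (hx0 : x0 ∈ S) (hp : UqO G S f x0 p)
    (hα : f p ∉ Φ) (hy0 : y0 ∈ S) (hy0p : ¬ G.Adj p y0) :
    (S.filter (fun w => G.Adj p w)).card ≤ 2 ∨ ((S.filter (fun w => G.Adj p w)).card = 3 ∧
      ∃ ρ ∈ Φ, (∀ w ∈ S, ¬ G.Adj p w → Sees G S f w ρ) ∧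
        ∀ x y, x ∉ S → y ∉ S → G.Adj p x → G.Adj p y → f x = f y → x = y) := by
  by_cases h : ∀ ρ ∈ Φ, ∃ w ∈ S, ¬ G.Adj p w ∧ ¬ Sees G S f w ρ
  · exact Or.inl (T.T2c C hx0 hp hα h).2
  push Not at h
  obtain ⟨ρ, hρ, hρs⟩ := h
  have h1 : ∀ c, c ≠ f p → c ≠ ρ → Sees G S f p c := by
    intro c hc hcρ
    by_cases hΦ : c ∈ Φ
    · refine T.T2a C hx0 hp hα hΦ hy0 hy0p ?_
      intro hs
      exact hcρ (T.miss C hy0 hΦ hρ hs (hρs y0 hy0 hy0p))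
    · exact T.T2b C hx0 hp hα hΦ hc
  have hne : ρ ≠ f p := fun h => hα (h ▸ hρ)
  have hD : ((Finset.univ.erase (f p)).erase ρ : Finset (Fin k)).card = k - 2 := by
    rw [Finset.card_erase_of_mem (by simp [hne]), Finset.card_erase_of_mem (Finset.mem_univ _)]
    simp; omega
  have hDs : ∀ c ∈ (Finset.univ.erase (f p)).erase ρ, Sees G S f p c := by
    intro c hc
    simp at hc
    exact h1 c hc.2 hc.1
  have h2 := sees_card hDs
  have h3 := out_card' C (S := S) (p := p)
  have k8 := C.k8
  by_cases h4 : (S.filter (fun w => G.Adj p w)).card ≤ 2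
  · exact Or.inl h4
  · refine Or.inr ⟨by omega, ρ, hρ, hρs, ?_⟩
    intro x y sx sy hx hy fxy
    refine count_inj (out G S p) ((Finset.univ.erase (f p)).erase ρ) f ?_ (by omega) x
      (mem_out.2 ⟨hx, sx⟩) y (mem_out.2 ⟨hy, sy⟩) fxy
    intro c hc
    obtain ⟨x, h1, h2, h3⟩ := hDs c hc
    exact ⟨x, mem_out.2 ⟨h2, h1⟩, h3⟩

lemma Tight.T4 (C : Crit G k) (T : Tight G S f Φ) {b1 b2 w1 w2 : V} (hw1 : w1 ∈ S) (hw2 : w2 ∈ S)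
    (u1 : UqO G S f w1 b1) (u2 : UqO G S f w2 b2) (hα : f b1 ∉ Φ) (he : f b2 = f b1) {β : Fin k}
    (hβ : β ∈ Φ) (s1 : ¬ Sees G S f w1 β) (s2 : ¬ Sees G S f w2 β) {X : V → Prop}
    (hX : Closed G (↑S) f (f b1) β X) (h1 : X b1) : X b2 := by
  by_contra h2
  have hne : f b1 ≠ β := fun h => hα (h ▸ hβ)
  have hpo : PO G S (swp f (f b1) β X) := by
    have := swp_po (S := (↑S : Set V)) (G := G) (by simpa [PO] using T.po) hX
    simpa [PO] using this
  simp only [Sees, not_exists] at s1 s2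
  have u1' := u1.2.2
  have u2' := u2.2.2
  refine T.E C hpo (α := f b1) (ρ := β) hα ?_ hw1 hw2 ?_ (mem_L.2 (by simpa [Sees] using s2)) ?_ ?_
  · intro w hw c hc hcβ
    have hcΦ := T.sub w hw hc
    rw [mem_L] at hc ⊢
    rintro ⟨x, h1, h2, h3⟩
    apply hc
    refine ⟨x, h1, h2, ?_⟩
    simp only [swp] at h3
    grind
  · rw [mem_L]
    rintro ⟨x, h1, h2, h3⟩
    have a1 := s1 x
    have a2 := u1' x h1 h2
    simp only [swp] at h3
    grind
  · rw [mem_L]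
    rintro ⟨x, h1, h2, h3⟩
    have a1 := s2 x
    have a2 := u2' x h1 h2
    simp only [swp] at h3
    grind
  · rw [mem_L, not_not]
    refine ⟨b2, u2.2.1, u2.1, ?_⟩
    simp [swp, h2, he]
end
end BK

open SimpleGraph
set_option linter.all false
set_option linter.unusedSectionVars false
set_option linter.unusedVariables false
set_option linter.unusedSimpArgs false
namespace BK
section
open scoped Classical
variable {V : Type*} [Fintype V] {G : SimpleGraph V} {k : ℕ}

def PInv (adj : V → V → Prop) (b : V) (T : Finset V) (u : V) : Prop :=
  b ∈ T ∧ u ∈ T ∧ (∀ x ∈ T, x ≠ u → ∀ y, adj x y → y ∈ T) ∧ (u ≠ b → ∃ q ∈ T, adj u q) ∧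
    ∀ x ∈ T, x ≠ b → x ≠ u → ∃ p q, p ≠ q ∧ adj x p ∧ adj x q

lemma path_grow (adj : V → V → Prop) (hs : ∀ x y, adj x y → adj y x)
    (hd : ∀ x p q r, adj x p → adj x q → adj x r → p = q ∨ p = r ∨ q = r) (b : V)
    (hb : ∀ p q, adj b p → adj b q → p = q) :
    ∀ n, ∀ T : Finset V, ∀ u, PInv adj b T u → Fintype.card V ≤ T.card + n →
      ∃ T' u', PInv adj b T' u' ∧ ∀ y, adj u' y → y ∈ T' := by
  intro n
  induction n with
  | zero =>
    intro T u hI hc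
    refine ⟨T, u, hI, fun y _ => ?_⟩
    have : T = Finset.univ := Finset.eq_univ_of_card T (le_antisymm (Finset.card_le_univ T) (by omega))
    rw [this]; exact Finset.mem_univ y
  | succ n ih =>
    intro T u hI hc
    by_cases h : ∀ y, adj u y → y ∈ T
    · exact ⟨T, u, hI, h⟩
    push Not at h
    obtain ⟨w, huw, hw⟩ := h
    apply ih (insert w T) w
    · obtain ⟨i1, i2, i3, i4, i5⟩ := hI
      refine ⟨by simp [i1], by simp, ?_, fun _ => ⟨u, by simp [i2], hs _ _ huw⟩, ?_⟩
      · intro x hx hxw y hxy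
        rw [Finset.mem_insert] at hx ⊢
        have hxT := hx.resolve_left hxw
        by_cases hxu : x = u
        · subst hxu
          by_cases hxb : x = b
          · subst hxb; exact Or.inl (hb _ _ hxy huw)
          · obtain ⟨q, hq, hxq⟩ := i4 hxb
            rcases hd x y w q hxy huw hxq with h | h | h
            · exact Or.inl h
            · exact Or.inr (h ▸ hq)
            · exact absurd hq (h ▸ hw)
        · exact Or.inr (i3 x hxT hxu y hxy)
      · intro x hx hxb hxw
        rw [Finset.mem_insert] at hx
        have hxT := hx.resolve_left hxw
        by_cases hxu : x = u
        · subst hxu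
          obtain ⟨q, hq, hxq⟩ := i4 hxb
          exact ⟨w, q, fun h => hw (h ▸ hq), huw, hxq⟩
        · exact i5 x hxT hxb hxu
    · rw [Finset.card_insert_of_notMem hw]; omega

lemma path_end (adj : V → V → Prop) (hs : ∀ x y, adj x y → adj y x)
    (hd : ∀ x p q r, adj x p → adj x q → adj x r → p = q ∨ p = r ∨ q = r) (b : V)
    (hb : ∀ p q, adj b p → adj b q → p = q) :
    ∃ (T : Finset V) (u : V), b ∈ T ∧ (∀ x ∈ T, ∀ y, adj x y → y ∈ T) ∧
      ∀ x ∈ T, x ≠ b → x ≠ u → ∃ p q, p ≠ q ∧ adj x p ∧ adj x q := by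
  obtain ⟨T, u, ⟨h1, h2, h3, h4, h5⟩, h6⟩ := path_grow adj hs hd b hb (Fintype.card V) {b} b
    ⟨by simp, by simp, by simp, by simp, by simp⟩ (by omega)
  refine ⟨T, u, h1, ?_, h5⟩
  intro x hx y hxy
  by_cases hxu : x = u
  · exact h6 y (hxu ▸ hxy)
  · exact h3 x hx hxu y hxy

variable {S : Finset V} {f : V → Fin k} {Φ : Finset (Fin k)}

lemma Tight.T3 (C : Crit G k) (T : Tight G S f Φ) {b1 b2 b3 w1 w2 w3 : V} (hw1 : w1 ∈ S)
    (hw2 : w2 ∈ S) (hw3 : w3 ∈ S)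
    (u1 : UqO G S f w1 b1) (u2 : UqO G S f w2 b2) (u3 : UqO G S f w3 b3) (hα : f b1 ∉ Φ)
    (he2 : f b2 = f b1) (he3 : f b3 = f b1) (n12 : b1 ≠ b2) (n13 : b1 ≠ b3) (n23 : b2 ≠ b3)
    {β : Fin k} (hβ : β ∈ Φ) (s1 : ¬ Sees G S f w1 β) (s2 : ¬ Sees G S f w2 β)
    (s3 : ¬ Sees G S f w3 β) : False := by
  have cf := crit_cf C
  have hne : f b1 ≠ β := fun h => hα (h ▸ hβ)
  let adj : V → V → Prop := fun x y => G.Adj x y ∧ x ∉ S ∧ y ∉ S ∧ (f x = f b1 ∨ f x = β) ∧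
    (f y = f b1 ∨ f y = β)
  have hs : ∀ x y, adj x y → adj y x := fun x y h => ⟨h.1.symm, h.2.2.1, h.2.1, h.2.2.2.2, h.2.2.2.1⟩
  have same : ∀ x p q, adj x p → adj x q → f p = f q := by
    intro x p q hp hq
    have h1 := T.po x p hp.2.1 hp.2.2.1 hp.1
    have h2 := T.po x q hq.2.1 hq.2.2.1 hq.1
    have h3 := hp.2.2.2
    have h4 := hq.2.2.2
    grind
  have nadj : ∀ x p q, adj x p → adj x q → ¬ G.Adj p q := fun x p q hp hq h =>
    T.po p q hp.2.2.1 hq.2.2.1 h (same x p q hp hq)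
  have hd : ∀ x p q r, adj x p → adj x q → adj x r → p = q ∨ p = r ∨ q = r := by
    intro x p q r hp hq hr
    by_contra hcon
    push Not at hcon
    exact cf x p q r hp.1 hq.1 hr.1 (nadj x p q hp hq) (nadj x p r hp hr) (nadj x q r hq hr)
      hcon.1 hcon.2.1 hcon.2.2
  have hend : ∀ b w, w ∈ S → UqO G S f w b → f b = f b1 → ¬ Sees G S f w β →
      ∀ p q, adj b p → adj b q → p = q := by
    intro b w hw hu hb hsw p q hp hq
    by_contra hpq
    have hfp : ∀ p, adj b p → f p = β := by
      intro p hp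
      have h1 := T.po b p hp.2.1 hp.2.2.1 hp.1
      have h2 := hp.2.2.2.2
      grind
    have nw : ∀ p, adj b p → ¬ G.Adj w p := fun p hp h => hsw ⟨p, hp.2.2.1, h, hfp p hp⟩
    have wne : ∀ p, adj b p → w ≠ p := by
      rintro p hp rfl
      exact hp.2.2.1 hw
    exact cf b w p q hu.1.symm hp.1 hq.1 (nw p hp) (nw q hq) (nadj b p q hp hq) (wne p hp) (wne q hq) hpq
  obtain ⟨X, u, hb1, hcl, hintr⟩ := path_end adj hs hd b1 (hend b1 w1 hw1 u1 rfl s1)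
  have hclosed : Closed G (↑S) f (f b1) β (fun x => x ∈ X) := by
    intro x y hx hxy hxS hyS h1 h2
    exact hcl x hx y ⟨hxy, by simpa using hxS, by simpa using hyS, h1, h2⟩
  have m2 := T.T4 C hw1 hw2 u1 u2 hα he2 hβ s1 s2 hclosed hb1
  have m3 := T.T4 C hw1 hw3 u1 u3 hα he3 hβ s1 s3 hclosed hb1
  have e2 : b2 = u := by
    by_contra h
    obtain ⟨p, q, hpq, hp, hq⟩ := hintr b2 m2 n12.symm h
    exact hpq (hend b2 w2 hw2 u2 he2 s2 p q hp hq)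
  have e3 : b3 = u := by
    by_contra h
    obtain ⟨p, q, hpq, hp, hq⟩ := hintr b3 m3 n13.symm h
    exact hpq (hend b3 w3 hw3 u3 he3 s3 p q hp hq)
  exact n23 (e2.trans e3.symm)

lemma Tight.T3' (C : Crit G k) (T : Tight G S f Φ) (h5 : 5 ≤ S.card) {b1 b2 b3 w1 w2 w3 : V}
    (hw1 : w1 ∈ S) (hw2 : w2 ∈ S) (hw3 : w3 ∈ S)
    (u1 : UqO G S f w1 b1) (u2 : UqO G S f w2 b2) (u3 : UqO G S f w3 b3) (hα : f b1 ∉ Φ)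
    (he2 : f b2 = f b1) (he3 : f b3 = f b1) (n12 : b1 ≠ b2) (n13 : b1 ≠ b3) (n23 : b2 ≠ b3) :
    False := by
  have hsub : Φ ⊆ Φ.filter (fun β => Sees G S f w1 β) ∪ Φ.filter (fun β => Sees G S f w2 β) ∪
      Φ.filter (fun β => Sees G S f w3 β) := by
    intro β hβ
    by_contra hn
    simp only [Finset.mem_union, Finset.mem_filter, hβ, true_and, not_or] at hn
    exact T.T3 C hw1 hw2 hw3 u1 u2 u3 hα he2 he3 n12 n13 n23 hβ hn.1.1 hn.1.2 hn.2
  have h1 : ∀ w ∈ S, (Φ.filter (fun β => Sees G S f w β)).card ≤ 1 := by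
    intro w hw
    rw [Finset.card_le_one]
    intro a ha b hb
    simp only [Finset.mem_filter] at ha hb
    exact T.miss C hw ha.1 hb.1 ha.2 hb.2
  have a1 := h1 w1 hw1
  have a2 := h1 w2 hw2
  have a3 := h1 w3 hw3
  have b1 := Finset.card_le_card hsub
  have b2 := Finset.card_union_le (Φ.filter (fun β => Sees G S f w1 β) ∪
    Φ.filter (fun β => Sees G S f w2 β)) (Φ.filter (fun β => Sees G S f w3 β))
  have b3 := Finset.card_union_le (Φ.filter (fun β => Sees G S f w1 β))
    (Φ.filter (fun β => Sees G S f w2 β))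
  have := T.card
  omega

def MaxC (G : SimpleGraph V) (A : Finset V) : Prop := Cliq G A ∧ ∀ B : Finset V, Cliq G B → B.card ≤ A.card

lemma cliq_insert {A : Finset V} (hA : Cliq G A) {p : V} (h : ∀ w ∈ A, G.Adj p w) :
    Cliq G (insert p A) := by
  intro x hx y hy hxy
  rw [Finset.mem_insert] at hx hy
  rcases hx with rfl | hx <;> rcases hy with rfl | hy
  · exact absurd rfl hxy
  · exact h y hy
  · exact (h x hx).symm
  · exact hA x hx y hy hxy

lemma MaxC.miss {A : Finset V} (hA : MaxC G A) {p : V} (hp : p ∉ A) : ∃ w ∈ A, ¬ G.Adj p w := by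
  by_contra hcon
  push Not at hcon
  have := hA.2 _ (cliq_insert hA.1 hcon)
  rw [Finset.card_insert_of_notMem hp] at this
  omega

/-- no outside colour repetition at `w` in colour `α`. -/
def NoDup (G : SimpleGraph V) (S : Finset V) (f : V → Fin k) (α : Fin k) (w : V) : Prop :=
  ∀ x y, x ∉ S → y ∉ S → G.Adj w x → G.Adj w y → f x = α → f y = α → x = y

lemma NoDup.uqo {α : Fin k} {w p : V} (h : NoDup G S f α w) (hp : p ∉ S) (hw : G.Adj w p)
    (fp : f p = α) : UqO G S f w p :=
  ⟨hw, hp, fun x hx hwx fx => h x p hx hp hwx hw (fx.trans fp) fp⟩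

/-- two-class split for a colour without repetitions -/
lemma Tight.split (C : Crit G k) (T : Tight G S f Φ) (hM : MaxC G S) (h5 : 5 ≤ S.card) {α : Fin k}
    (hα : α ∉ Φ) (hd : ∀ w ∈ S, NoDup G S f α w) :
    ∃ p q, p ∉ S ∧ q ∉ S ∧ f p = α ∧ f q = α ∧
      (∀ w ∈ S, (G.Adj p w ∧ ¬ G.Adj q w) ∨ (G.Adj q w ∧ ¬ G.Adj p w)) ∧
      (∃ w ∈ S, UqO G S f w p) ∧ (∃ w ∈ S, UqO G S f w q) := by
  have hpos : 0 < S.card := by omega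
  obtain ⟨w0, hw0⟩ := Finset.card_pos.1 hpos
  obtain ⟨p, hp, hw0p, fp⟩ := T.sees hw0 hα
  obtain ⟨w1, hw1, hpw1⟩ := hM.miss hp
  obtain ⟨q, hq, hw1q, fq⟩ := T.sees hw1 hα
  have hpq : p ≠ q := by rintro rfl; exact hpw1 hw1q.symm
  have up := (hd w0 hw0).uqo hp hw0p fp
  have uq := (hd w1 hw1).uqo hq hw1q fq
  refine ⟨p, q, hp, hq, fp, fq, ?_, ⟨w0, hw0, up⟩, ⟨w1, hw1, uq⟩⟩
  intro w hw
  obtain ⟨r, hr, hwr, fr⟩ := T.sees hw hα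
  have ur := (hd w hw).uqo hr hwr fr
  by_cases h1 : r = p
  · subst h1
    exact Or.inl ⟨hwr.symm, fun h => hpq (hd w hw r q hp hq hwr h.symm fp fq)⟩
  by_cases h2 : r = q
  · subst h2
    exact Or.inr ⟨hwr.symm, fun h => hpq (hd w hw p r hp hq h.symm hwr fp fq)⟩
  exact (T.T3' C h5 hw0 hw1 hw up uq ur (fp ▸ hα) (by rw [fq, fp]) (by rw [fr, fp]) hpq
    (Ne.symm h1) (Ne.symm h2)).elim

/-- claw covering -/
lemma cover (C : Crit G k) (hS : Cliq G S) {d p q : V} (hd : d ∈ S) (hp : p ∉ S) (hq : q ∉ S) (hdp : G.Adj d p)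
    (hdq : G.Adj d q) (hpq : ¬ G.Adj p q) (hne : p ≠ q) {w : V} (hw : w ∈ S) :
    G.Adj p w ∨ G.Adj q w := by
  by_cases h : w = d
  · subst h; exact Or.inl hdp.symm
  by_contra hcon
  push Not at hcon
  exact crit_cf C d p q w hdp hdq (hS d hd w hw (Ne.symm h)) hpq hcon.1 hcon.2 hne
    (fun h => hp (h ▸ hw)) (fun h => hq (h ▸ hw))

lemma Tight.N5 (C : Crit G k) (T : Tight G S f Φ) (hM : MaxC G S) (h5 : S.card = 5) {x x' : V}
    (hx : x ∈ S) (hx' : x' ∈ S) (hne : x ≠ x')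
    (h : ∀ α, α ∉ Φ → ∃ b, b ∉ S ∧ f b = α ∧ G.Adj b x ∧ G.Adj b x' ∧
      (S.filter (fun w => G.Adj b w)).card ≤ 3) : False := by
  have h' : ∀ α, ∃ b, α ∉ Φ → b ∉ S ∧ f b = α ∧ G.Adj b x ∧ G.Adj b x' ∧
      (S.filter (fun w => G.Adj b w)).card ≤ 3 := by
    intro α
    by_cases hα : α ∈ Φ
    · exact ⟨x, fun h => absurd hα h⟩
    · obtain ⟨b, hb⟩ := h α hα
      exact ⟨b, fun _ => hb⟩
  choose b hb using h'
  have inj : ∀ α ∈ Φᶜ, ∀ β ∈ Φᶜ, b α = b β → α = β := by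
    intro α hα β hβ e
    rw [← (hb α (by simpa using hα)).2.1, ← (hb β (by simpa using hβ)).2.1, e]
  have adj : ∀ α ∈ Φᶜ, ∀ β ∈ Φᶜ, α ≠ β → G.Adj (b α) (b β) := by
    intro α hα β hβ hαβ
    by_contra hn
    obtain ⟨a1, a2, a3, a4, a5⟩ := hb α (by simpa using hα)
    obtain ⟨b1, b2, b3, b4, b5⟩ := hb β (by simpa using hβ)
    have cov := fun w (hw : w ∈ S) => cover C T.cl hx a1 b1 a3.symm b3.symm hn
      (fun e => hαβ (inj α hα β hβ e)) hw
    have hsub : S ⊆ S.filter (fun w => G.Adj (b α) w) ∪ S.filter (fun w => G.Adj (b β) w) := by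
      intro w hw
      simp [hw, cov w hw]
    have hin : ({x, x'} : Finset V) ⊆ S.filter (fun w => G.Adj (b α) w) ∩ S.filter (fun w => G.Adj (b β) w) := by
      intro w hw
      simp only [Finset.mem_insert, Finset.mem_singleton] at hw
      rcases hw with rfl | rfl <;> simp [*]
    have c1 := Finset.card_le_card hsub
    have c2 := Finset.card_le_card hin
    have c3 := Finset.card_union_add_card_inter (S.filter (fun w => G.Adj (b α) w)) (S.filter (fun w => G.Adj (b β) w))
    rw [Finset.card_pair hne] at c2
    omega
  have xadj := T.cl x hx x' hx' hne
  have hcl1 : Cliq G ((Φᶜ).image b) := by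
    intro p hp q hq hpq
    simp only [Finset.mem_image] at hp hq
    obtain ⟨α, hα, rfl⟩ := hp
    obtain ⟨β, hβ, rfl⟩ := hq
    exact adj α hα β hβ (fun h => hpq (h ▸ rfl))
  have hcl2 : Cliq G (insert x' ((Φᶜ).image b)) := cliq_insert hcl1 (by
    intro w hw
    simp only [Finset.mem_image] at hw
    obtain ⟨α, hα, rfl⟩ := hw
    exact (hb α (by simpa using hα)).2.2.2.1.symm)
  have hcl3 : Cliq G (insert x (insert x' ((Φᶜ).image b))) := cliq_insert hcl2 (by
    intro w hw
    simp only [Finset.mem_insert, Finset.mem_image] at hw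
    rcases hw with rfl | ⟨α, hα, rfl⟩
    · exact xadj
    · exact (hb α (by simpa using hα)).2.2.1.symm)
  have hc := hM.2 _ hcl3
  have hni : ∀ y ∈ S, y ∉ (Φᶜ).image b := by
    intro y hy h
    simp only [Finset.mem_image] at h
    obtain ⟨α, hα, rfl⟩ := h
    exact (hb α (by simpa using hα)).1 hy
  rw [Finset.card_insert_of_notMem (by
    rw [Finset.mem_insert, not_or]; exact ⟨hne, hni x hx⟩),
    Finset.card_insert_of_notMem (hni x' hx'), Finset.card_image_of_injOn inj] at hc
  have := T.ccard
  have := C.k8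
  omega
end
end BK

open SimpleGraph
set_option linter.all false
set_option linter.unusedSectionVars false
set_option linter.unusedVariables false
set_option linter.unusedSimpArgs false
namespace BK
section
open scoped Classical
variable {V : Type*} [Fintype V] {G : SimpleGraph V} {k : ℕ}

structure BadS (G : SimpleGraph V) (S : Finset V) (u : V) (f : V → Fin k) (Λ : Finset (Fin k)) : Prop where
  hu : u ∉ S
  hM : MaxC G (insert u S)
  T : Tight G S f Λ
  hL : ∀ w ∈ S, L G (insert u S) f w = Λ
  hLS : ∀ w ∈ S, L G S f w = Λ
  hc : f u ∉ Λ

lemma bad_setup (C : Crit G k) {A : Finset V} (hM : MaxC G A) (h5 : 5 ≤ A.card) {v : V} (hv : v ∈ A)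
    {f : V → Fin k} (hf : P1 G v f) (hB : Bad G A f) :
    ∃ S u Λ, insert u S = A ∧ v ∈ S ∧ BadS G S u f Λ := by
  obtain ⟨u, hu, Λ, hΛ, hL⟩ := hB
  have hA := hM.1
  have hcl : ∀ w ∈ A, w ≠ v → f w ∈ L G A f w := by
    intro w hw hwv
    rw [mem_L]
    rintro ⟨x, h1, h2, h3⟩
    exact hf w x hwv (fun h => h1 (h ▸ hv)) h2 h3.symm
  have inj : ∀ x ∈ A, ∀ y ∈ A, x ≠ v → y ≠ v → f x = f y → x = y := by
    intro x hx y hy hxv hyv e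
    by_contra h
    exact hf x y hxv hyv (hA x hx y hy h) e
  have hvu : v ≠ u := by
    rintro rfl
    have h1 : (A.erase v).image f ⊆ Λ := by
      intro c hc
      simp only [Finset.mem_image, Finset.mem_erase] at hc
      obtain ⟨w, ⟨hwv, hw⟩, rfl⟩ := hc
      rw [← hL w hw hwv]
      exact hcl w hw hwv
    have h2 := Finset.card_le_card h1
    rw [Finset.card_image_of_injOn, Finset.card_erase_of_mem hv] at h2
    · omega
    · intro x hx y hy e
      simp only [Finset.coe_erase, Set.mem_diff, Finset.mem_coe, Set.mem_singleton_iff] at hx hy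
      exact inj x hx.1 y hy.1 hx.2 hy.2 e
  have himg : ((A.erase u).erase v).image f = Λ := by
    apply Finset.eq_of_subset_of_card_le
    · intro c hc
      simp only [Finset.mem_image, Finset.mem_erase] at hc
      obtain ⟨w, ⟨hwv, hwu, hw⟩, rfl⟩ := hc
      rw [← hL w hw hwu]
      exact hcl w hw hwv
    · rw [Finset.card_image_of_injOn, Finset.card_erase_of_mem, Finset.card_erase_of_mem hu]
      · omega
      · simp [hv, hvu]
      · intro x hx y hy e
        rw [Finset.mem_coe, Finset.mem_erase, Finset.mem_erase] at hx hy
        exact inj x hx.2.2 y hy.2.2 hx.1 hy.1 e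
  have hcΛ : f u ∉ Λ := by
    rw [← himg]
    intro hc
    simp only [Finset.mem_image, Finset.mem_erase] at hc
    obtain ⟨w, ⟨hwv, hwu, hw⟩, e⟩ := hc
    exact hwu (inj w hw u hu hwv hvu.symm e)
  have hins : insert u (A.erase u) = A := Finset.insert_erase hu
  have hvS : v ∈ A.erase u := by simp [hv, hvu]
  have hLS : ∀ w ∈ A.erase u, L G (A.erase u) f w = Λ := by
    intro w hw
    rw [Finset.mem_erase] at hw
    have hwu := hA w hw.2 u hu hw.1
    ext c
    constructor
    · intro h
      rw [← hL w hw.2 hw.1, mem_L]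
      rw [mem_L] at h
      rintro ⟨x, h1, h2, h3⟩
      exact h ⟨x, fun h => h1 (Finset.mem_of_mem_erase h), h2, h3⟩
    · intro h
      have hcc : c ≠ f u := fun e => hcΛ (e ▸ h)
      rw [← hL w hw.2 hw.1, mem_L] at h
      rw [mem_L]
      rintro ⟨x, h1, h2, h3⟩
      refine h ⟨x, fun hx => h1 ?_, h2, h3⟩
      rw [Finset.mem_erase]
      refine ⟨?_, hx⟩
      rintro rfl
      exact hcc h3.symm
  have hSc : (A.erase u).card + 1 = A.card := by
    rw [Finset.card_erase_of_mem hu]; omega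
  refine ⟨A.erase u, u, Λ, hins, hvS, by simp, by rwa [hins], ⟨?_, ?_, by omega, fun w hw => (hLS w hw).subset, ?_⟩, ?_, hLS, hcΛ⟩
  · intro x hx y hy hxy
    exact hA x (Finset.mem_of_mem_erase hx) y (Finset.mem_of_mem_erase hy) hxy
  · intro x y hx hy hxy
    exact hf x y (fun h => hx (h ▸ hvS)) (fun h => hy (h ▸ hvS)) hxy
  · rintro ⟨u', hu', Λ', hΛ', h⟩
    obtain ⟨w, hw, hne⟩ := Finset.exists_mem_ne (s := A.erase u) (by omega) u'
    have h1 := h w hw hne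
    rw [hLS w hw] at h1
    rw [← h1] at hΛ'
    omega
  · intro w hw
    rw [hins]
    rw [Finset.mem_erase] at hw
    exact hL w hw.2 hw.1

variable {u : V} {Λ : Finset (Fin k)}

lemma BadS.rain (C : Crit G k) (B : BadS G S u f Λ) {w x y : V} (hw : w ∈ S) (hx : x ∉ insert u S)
    (hy : y ∉ insert u S) (wx : G.Adj w x) (wy : G.Adj w y) (e : f x = f y) : x = y := by
  refine count_inj (out G (insert u S) w) Λᶜ f ?_ ?_ x (mem_out.2 ⟨wx, hx⟩) y (mem_out.2 ⟨wy, hy⟩) e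
  · intro c hc
    have : Sees G (insert u S) f w c := by
      by_contra h
      rw [← mem_L, B.hL w hw] at h
      exact Finset.mem_compl.1 hc h
    obtain ⟨x, h1, h2, h3⟩ := this
    exact ⟨x, mem_out.2 ⟨h2, h1⟩, h3⟩
  · have h1 := out_card C B.hM.1 (Finset.mem_insert_of_mem (a := w) (b := u) hw)
    have h2 := B.T.ccard
    rw [Finset.card_insert_of_notMem B.hu] at h1
    omega

lemma BadS.sees (B : BadS G S u f Λ) {w : V} (hw : w ∈ S) {c : Fin k} (hc : c ∉ Λ) :
    Sees G (insert u S) f w c := by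
  by_contra h
  rw [← mem_L, B.hL w hw] at h
  exact hc h

lemma BadS.col (B : BadS G S u f Λ) {w p : V} (hw : w ∈ S) (hp : p ∉ S) (wp : G.Adj w p) : f p ∉ Λ := by
  rw [← B.hLS w hw, mem_L, not_not]
  exact ⟨p, hp, wp, rfl⟩

lemma BadS.uq (C : Crit G k) (B : BadS G S u f Λ) {w p : V} (hw : w ∈ S) (hp : p ∉ insert u S)
    (wp : G.Adj w p) (hne : f p ≠ f u) : UqO G S f w p := by
  refine ⟨wp, fun h => hp (Finset.mem_insert_of_mem h), fun x hx wx e => ?_⟩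
  refine B.rain C hw ?_ hp wx wp e
  rw [Finset.mem_insert, not_or]
  refine ⟨?_, hx⟩
  rintro rfl
  exact hne e.symm

lemma BadS.nsee (B : BadS G S u f Λ) {w : V} (hw : w ∈ S) {c : Fin k} (hc : c ∈ Λ) : ¬ Sees G S f w c := by
  rw [← mem_L, B.hLS w hw]
  exact hc

lemma BadS.t2 (C : Crit G k) (B : BadS G S u f Λ) {w p w' : V} (hw : w ∈ S) (hp : p ∉ insert u S)
    (wp : G.Adj w p) (hne : f p ≠ f u) (hw' : w' ∈ S) (hpw' : ¬ G.Adj p w') :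
    (∀ c, c ≠ f p → Sees G S f p c) ∧ (S.filter (fun w => G.Adj p w)).card ≤ 2 :=
  B.T.T2c C hw (B.uq C hw hp wp hne) (B.col hw (fun h => hp (Finset.mem_insert_of_mem h)) wp)
    (fun ρ hρ => ⟨w', hw', hpw', B.nsee hw' hρ⟩)

lemma BadS.two (C : Crit G k) (B : BadS G S u f Λ) (h4 : 4 ≤ S.card) {w p : V} (hw : w ∈ S)
    (hp : p ∉ insert u S) (wp : G.Adj w p) (hne : f p ≠ f u) :
    ∃ w' q, w' ∈ S ∧ q ∉ insert u S ∧ G.Adj w' q ∧ f q = f p ∧ ∀ w ∈ S, G.Adj p w ∨ G.Adj q w := by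
  by_cases hall : ∀ w ∈ S, G.Adj p w
  · exact ⟨w, p, hw, hp, wp, rfl, fun w hw => Or.inl (hall w hw)⟩
  push Not at hall
  obtain ⟨w', hw', hpw'⟩ := hall
  have pS : p ∉ S := fun h => hp (Finset.mem_insert_of_mem h)
  have hα := B.col hw pS wp
  obtain ⟨q, hq, wq, fq⟩ := B.sees hw' hα
  refine ⟨w', q, hw', hq, wq, fq, fun x hx => ?_⟩
  obtain ⟨r, hr, xr, fr⟩ := B.sees hx hα
  by_contra hcon
  push Not at hcon
  have hpos : 0 < Λ.card := by have := B.T.card; omega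
  obtain ⟨β, hβ⟩ := Finset.card_pos.1 hpos
  refine B.T.T3 C hw hw' hx (B.uq C hw hp wp hne) (B.uq C hw' hq wq (by rwa [fq]))
    (B.uq C hx hr xr (by rwa [fr])) hα fq fr ?_ ?_ ?_ hβ (B.nsee hw hβ) (B.nsee hw' hβ) (B.nsee hx hβ)
  · rintro rfl; exact hpw' wq.symm
  · rintro rfl; exact hcon.1 xr.symm
  · rintro rfl; exact hcon.2 xr.symm

lemma BadS.two_card (C : Crit G k) (B : BadS G S u f Λ) (h4 : 4 ≤ S.card) {w p : V} (hw : w ∈ S)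
    (hp : p ∉ insert u S) (wp : G.Adj w p) (hne : f p ≠ f u) :
    (∃ q, q ∉ insert u S ∧ f q = f p ∧ ∀ w ∈ S, G.Adj q w) ∨ 
      (S.card = 4 ∧ (S.filter (fun w => G.Adj p w)).card = 2 ∧ (∀ c, c ≠ f p → Sees G S f p c)) := by
  obtain ⟨w', q, hw', hq, wq, fq, hcov⟩ := B.two C h4 hw hp wp hne
  by_cases h1 : ∀ w ∈ S, G.Adj p w
  · exact Or.inl ⟨p, hp, rfl, h1⟩
  by_cases h2 : ∀ w ∈ S, G.Adj q w
  · exact Or.inl ⟨q, hq, fq, h2⟩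
  push Not at h1 h2
  obtain ⟨x, hx, px⟩ := h1
  obtain ⟨y, hy, qy⟩ := h2
  have a1 := B.t2 C hw hp wp hne hx px
  have a2 := B.t2 C hw' hq wq (by rwa [fq]) hy qy
  have hsub : S ⊆ S.filter (fun w => G.Adj p w) ∪ S.filter (fun w => G.Adj q w) := by
    intro w hw
    simp [hw, hcov w hw]
  have c1 := Finset.card_le_card hsub
  have c2 := Finset.card_union_le (S.filter (fun w => G.Adj p w)) (S.filter (fun w => G.Adj q w))
  right
  exact ⟨by omega, by omega, a1.1⟩

lemma BadS.big (C : Crit G k) (B : BadS G S u f Λ) (h5 : 5 ≤ S.card) :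
    ∃ (A' : Finset V) (f' : V → Fin k) (Φ : Finset (Fin k)), Tight G A' f' Φ ∧ MaxC G A' ∧ 5 ≤ A'.card := by
  have hcomp : ∀ α, α ∉ Λ → α ≠ f u → ∃ q, q ∉ insert u S ∧ f q = α ∧ ∀ w ∈ S, G.Adj q w := by
    intro α hα hαu
    have hpos : 0 < S.card := by omega
    obtain ⟨w, hw⟩ := Finset.card_pos.1 hpos
    obtain ⟨p, hp, wp, rfl⟩ := B.sees hw hα
    rcases B.two_card C (by omega) hw hp wp hαu with h | h
    · exact h
    · omega
  have hpos : 0 < S.card := by omega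
  obtain ⟨w0, hw0⟩ := Finset.card_pos.1 hpos
  have huadj : ∀ w ∈ S, G.Adj w u := fun w hw => B.hM.1 w (by simp [hw]) u (by simp) (fun h => B.hu (h ▸ hw))
  have hcompu : ∀ q, q ∉ insert u S → (∀ w ∈ S, G.Adj q w) → ¬ G.Adj q u := by
    intro q hq h hqu
    obtain ⟨w, hw, hn⟩ := B.hM.miss hq
    rw [Finset.mem_insert] at hw
    rcases hw with rfl | hw
    · exact hn hqu
    · exact hn (h w hw)
  have huniq : ∀ α β, α ∉ Λ → β ∉ Λ → α ≠ f u → β ≠ f u → α = β := by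
    intro α β hα hβ hαu hβu
    by_contra hne
    obtain ⟨p, hp, fp, pc⟩ := hcomp α hα hαu
    obtain ⟨q, hq, fq, qc⟩ := hcomp β hβ hβu
    have hpq : p ≠ q := by rintro rfl; exact hne (fp.symm.trans fq)
    have pS : p ∉ S := fun h => hp (Finset.mem_insert_of_mem h)
    have qS : q ∉ S := fun h => hq (Finset.mem_insert_of_mem h)
    by_cases hadj : G.Adj p q
    · have h1 := B.hM.2 (insert p (insert q S)) (cliq_insert (cliq_insert B.T.cl qc) (by
        intro w hw
        rw [Finset.mem_insert] at hw
        rcases hw with rfl | hw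
        · exact hadj
        · exact pc w hw))
      rw [Finset.card_insert_of_notMem (by rw [Finset.mem_insert, not_or]; exact ⟨hpq, pS⟩),
        Finset.card_insert_of_notMem qS, Finset.card_insert_of_notMem B.hu] at h1
      omega
    · refine crit_cf C w0 p q u (pc w0 hw0).symm (qc w0 hw0).symm (huadj w0 hw0) hadj
        (hcompu p hp pc) (hcompu q hq qc) hpq ?_ ?_
      · rintro rfl; simp at hp
      · rintro rfl; simp at hq
  have hcc := B.T.ccard
  have hAk := C.clq _ B.hM.1
  rw [Finset.card_insert_of_notMem B.hu] at hAk
  obtain ⟨α, hα, hαu⟩ := Finset.exists_mem_ne (s := Λᶜ) (by omega) (f u)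
  rw [Finset.mem_compl] at hα
  have hΛc : Λᶜ ⊆ {f u, α} := by
    intro c hc
    rw [Finset.mem_compl] at hc
    by_cases h : c = f u
    · simp [h]
    · simp [huniq c α hc hα h hαu]
  have hle := Finset.card_le_card hΛc
  rw [Finset.card_pair (Ne.symm hαu)] at hle
  have hSk : S.card + 1 = k := by omega
  obtain ⟨p, hp, fp, pc⟩ := hcomp α hα hαu
  have pS : p ∉ S := fun h => hp (Finset.mem_insert_of_mem h)
  have pu : p ≠ u := by rintro rfl; simp at hp
  have npu := hcompu p hp pc
  have hcl : Cliq G (insert p S) := cliq_insert B.T.cl pc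
  have hcard : (insert p S).card = S.card + 1 := Finset.card_insert_of_notMem pS
  have hLw : ∀ w ∈ S, ∀ c, Sees G (insert p S) f w c ↔ c = f u := by
    intro w hw c
    constructor
    · rintro ⟨x, hx, wx, rfl⟩
      by_contra hxu
      have xS : x ∉ S := fun h => hx (Finset.mem_insert_of_mem h)
      have xu : x ∉ insert u S := by
        rw [Finset.mem_insert, not_or]
        exact ⟨fun h => hxu (h ▸ rfl), xS⟩
      have h1 := B.col hw xS wx
      have h2 := huniq _ _ h1 hα hxu hαu
      have h3 := B.rain C hw xu hp wx (pc w hw).symm (h2.trans fp.symm)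
      exact hx (by simp [h3])
    · rintro rfl
      refine ⟨u, ?_, huadj w hw, rfl⟩
      rw [Finset.mem_insert, not_or]
      exact ⟨pu.symm, B.hu⟩
  have hLp : Sees G (insert p S) f p (f u) := by
    obtain ⟨t, ht, wt, ft⟩ := B.sees hw0 B.hc
    have tS : t ∉ S := fun h => ht (Finset.mem_insert_of_mem h)
    have tu : t ≠ u := by rintro rfl; simp at ht
    have ntu : ¬ G.Adj t u := fun h => B.T.po t u tS B.hu h ft
    have tp : t ≠ p := by
      rintro rfl
      exact hαu (fp.symm.trans ft)
    refine ⟨t, ?_, ?_, ft⟩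
    · rw [Finset.mem_insert, not_or]
      exact ⟨tp, tS⟩
    · by_contra hn
      exact crit_cf C w0 p t u (pc w0 hw0).symm wt (huadj w0 hw0) hn npu ntu tp.symm pu tu
  have hcs : ({f u}ᶜ : Finset (Fin k)).card + 1 = k := by
    rw [Finset.card_compl, Finset.card_singleton, Fintype.card_fin]
    omega
  refine ⟨insert p S, f, {f u}ᶜ, ⟨hcl, ?_, by omega, ?_, ?_⟩, ⟨hcl, ?_⟩, by omega⟩
  · intro x y hx hy hxy
    exact B.T.po x y (fun h => hx (Finset.mem_insert_of_mem h)) (fun h => hy (Finset.mem_insert_of_mem h)) hxy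
  · intro w hw c hc
    rw [mem_L] at hc
    rw [Finset.mem_compl, Finset.mem_singleton]
    rintro rfl
    rw [Finset.mem_insert] at hw
    rcases hw with rfl | hw
    · exact hc hLp
    · exact hc ((hLw w hw _).2 rfl)
  · rintro ⟨u', hu', Λ', hΛ', h⟩
    obtain ⟨w, hw, hne⟩ := Finset.exists_mem_ne (s := S) (by omega) u'
    have h1 := h w (by simp [hw]) hne
    have h2 : L G (insert p S) f w = {f u}ᶜ := by
      ext c
      rw [mem_L, hLw w hw]
      simp
    rw [h2] at h1
    rw [← h1] at hΛ'
    omega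
  · intro D hD
    have := B.hM.2 D hD
    rw [Finset.card_insert_of_notMem B.hu] at this
    omega

lemma BadS.small (C : Crit G k) (B : BadS G S u f Λ) (h4 : S.card = 4) :
    ∃ (A' : Finset V) (f' : V → Fin k) (Φ : Finset (Fin k)), Tight G A' f' Φ ∧ MaxC G A' ∧ 5 ≤ A'.card := by
  have hpos : 0 < S.card := by omega
  obtain ⟨v, hv⟩ := Finset.card_pos.1 hpos
  have huadj : ∀ w ∈ S, G.Adj w u := fun w hw => B.hM.1 w (by simp [hw]) u (by simp) (fun h => B.hu (h ▸ hw))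
  have hcardA : (insert u S).card = 5 := by rw [Finset.card_insert_of_notMem B.hu]; omega
  -- nonadjacent outside neighbours of v
  have hnon : ∃ b b', b ∉ insert u S ∧ b' ∉ insert u S ∧ G.Adj v b ∧ G.Adj v b' ∧ b ≠ b' ∧ ¬ G.Adj b b' := by
    by_contra hcon
    push Not at hcon
    have hcl : Cliq G (out G (insert u S) v) := by
      intro x hx y hy hxy
      rw [mem_out] at hx hy
      exact hcon x y hx.2 hy.2 hx.1 hy.1 hxy
    have hcl2 := cliq_insert hcl (p := v) (fun w hw => (mem_out.1 hw).1)
    have h1 := B.hM.2 _ hcl2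
    rw [Finset.card_insert_of_notMem (by rw [mem_out]; exact fun h => G.irrefl h.1)] at h1
    have h2 := sees_card (G := G) (S := insert u S) (f := f) (w := v) (D := Λᶜ)
      (fun c hc => B.sees hv (Finset.mem_compl.1 hc))
    have := B.T.ccard
    have := C.k8
    omega
  have hb : ∃ b, b ∉ insert u S ∧ G.Adj v b ∧ G.Adj b u := by
    obtain ⟨b, b', hb, hb', vb, vb', hne, hn⟩ := hnon
    rcases cover C B.hM.1 (Finset.mem_insert_of_mem hv) hb hb' vb vb' hn hne (Finset.mem_insert_self u S) with h | h
    · exact ⟨b, hb, vb, h⟩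
    · exact ⟨b', hb', vb', h⟩
  obtain ⟨b, hb, vb, bu⟩ := hb
  have bS : b ∉ S := fun h => hb (Finset.mem_insert_of_mem h)
  have bne : b ≠ u := by rintro rfl; simp at hb
  have fb : f b ≠ f u := B.T.po b u bS B.hu bu
  have hα := B.col hv bS vb
  have hnc : ∃ w ∈ S, ¬ G.Adj b w := by
    obtain ⟨w, hw, hn⟩ := B.hM.miss hb
    rw [Finset.mem_insert] at hw
    rcases hw with rfl | hw
    · exact absurd bu hn
    · exact ⟨w, hw, hn⟩
  obtain ⟨x, hx, bx⟩ := hnc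
  have hPb := B.t2 C hv hb vb fb hx bx
  obtain ⟨w', q, hw', hq, wq, fq, hcov⟩ := B.two C (by omega) hv hb vb fb
  have hq2 : (S.filter (fun w => G.Adj q w)).card ≤ 2 ∨ ∀ w ∈ S, G.Adj q w := by
    by_cases h : ∀ w ∈ S, G.Adj q w
    · exact Or.inr h
    · push Not at h
      obtain ⟨y, hy, qy⟩ := h
      exact Or.inl (B.t2 C hw' hq wq (by rwa [fq]) hy qy).2
  have hq2 : (S.filter (fun w => G.Adj q w)).card ≤ 2 := by
    rcases hq2 with h | h
    · exact h
    · exfalso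
      have := B.rain C hv hb hq vb (h v hv).symm fq.symm
      subst this
      exact bx (h x hx)
  have hsub : S ⊆ S.filter (fun w => G.Adj b w) ∪ S.filter (fun w => G.Adj q w) := by
    intro w hw
    simp [hw, hcov w hw]
  have c1 := Finset.card_le_card hsub
  have c2 := Finset.card_union_le (S.filter (fun w => G.Adj b w)) (S.filter (fun w => G.Adj q w))
  have hP2 : (S.filter (fun w => G.Adj b w)).card = 2 := by omega
  have hrain : ∀ y, y ∉ S → G.Adj b y → f y = f u → y = u := by
    intro y hy hby e
    refine count_inj (out G S b) ({f b}ᶜ) f ?_ ?_ y (mem_out.2 ⟨hby, hy⟩) u (mem_out.2 ⟨bu, B.hu⟩) e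
    · intro c hc
      rw [Finset.mem_compl, Finset.mem_singleton] at hc
      obtain ⟨x, h1, h2, h3⟩ := hPb.1 c hc
      exact ⟨x, mem_out.2 ⟨h2, h1⟩, h3⟩
    · have h1 := out_card' C (S := S) (p := b)
      rw [Finset.card_compl, Finset.card_singleton, Fintype.card_fin]
      omega
  have hpoA : PO G (insert u S) f := fun x y hx hy hxy =>
    B.T.po x y (fun h => hx (Finset.mem_insert_of_mem h)) (fun h => hy (Finset.mem_insert_of_mem h)) hxy
  have hpo : PO G (insert u S) (Function.update f b (f u)) := by
    apply po_update hpoA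
    rintro ⟨y, hy, hby, e⟩
    rw [Finset.mem_insert, not_or] at hy
    exact hy.1 (hrain y hy.2 hby e)
  have hnb : ¬ Bad G (insert u S) (Function.update f b (f u)) := by
    rintro ⟨u', hu', Λ', hΛ', h⟩
    obtain ⟨w, hw, hne⟩ := Finset.exists_mem_ne (s := S.filter (fun w => G.Adj b w)) (by omega) u'
    rw [Finset.mem_filter] at hw
    have h1 := h w (by simp [hw.1]) hne
    have h2 : insert (f b) Λ ⊆ L G (insert u S) (Function.update f b (f u)) w := by
      intro c hc
      rw [mem_L]
      rintro ⟨y, hy, wy, e⟩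
      rw [Function.update_apply] at e
      split_ifs at e with hyb
      · subst e
        rw [Finset.mem_insert] at hc
        rcases hc with hc | hc
        · exact fb hc.symm
        · exact B.hc hc
      · have hyS : y ∉ S := fun h => hy (Finset.mem_insert_of_mem h)
        rw [Finset.mem_insert] at hc
        rcases hc with hc | hc
        · exact hyb (B.rain C hw.1 hy hb wy hw.2.symm (e.trans hc))
        · exact B.col hw.1 hyS wy (e ▸ hc)
    have h3 := Finset.card_le_card h2
    rw [h1, Finset.card_insert_of_notMem hα] at h3
    have := B.T.card
    omega
  rcases dich C B.hM.1 hpo with ⟨Φ, h1, h2⟩ | h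
  · exact ⟨_, _, Φ, ⟨B.hM.1, hpo, h1, h2, hnb⟩, B.hM, by omega⟩
  · exact absurd h hnb

lemma exists_maxC (G : SimpleGraph V) : ∃ A : Finset V, MaxC G A := by
  obtain ⟨A, hA, hmax⟩ := Finset.exists_max_image (Finset.univ.filter (fun s : Finset V => Cliq G s))
    Finset.card ⟨∅, Finset.mem_filter.2 ⟨Finset.mem_univ _, by intro x hx; simp at hx⟩⟩
  refine ⟨A, (Finset.mem_filter.1 hA).2, fun B hB => hmax B (by simp [hB])⟩

theorem step1 (C : Crit G k) [Nonempty V] :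
    ∃ (A : Finset V) (f : V → Fin k) (Φ : Finset (Fin k)), Tight G A f Φ ∧ MaxC G A ∧ 5 ≤ A.card := by
  obtain ⟨A, hM⟩ := exists_maxC G
  obtain ⟨s, hs, hsc⟩ := exists_five C
  have h5 : 5 ≤ A.card := hs ▸ hM.2 s hsc
  have hpos : 0 < A.card := by omega
  obtain ⟨v, hv⟩ := Finset.card_pos.1 hpos
  obtain ⟨f, hf⟩ := C.del v
  by_cases hB : Bad G A f
  · obtain ⟨S, u, Λ, hA, hvS, B⟩ := bad_setup C hM h5 hv hf hB
    have : A.card = S.card + 1 := by rw [← hA, Finset.card_insert_of_notMem B.hu]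
    by_cases h : S.card = 4
    · exact B.small C h
    · exact B.big C (by omega)
  · have hpo : PO G A f := fun x y hx hy hxy =>
      hf x y (fun h => hx (h ▸ hv)) (fun h => hy (h ▸ hv)) hxy
    rcases dich C hM.1 hpo with ⟨Φ, h1, h2⟩ | h
    · exact ⟨A, f, Φ, ⟨hM.1, hpo, h1, h2, hB⟩, hM, h5⟩
    · exact absurd h hB
end
end BK

open SimpleGraph
set_option linter.all false
set_option linter.unusedSectionVars false
set_option linter.unusedVariables false
set_option linter.unusedSimpArgs false
namespace BK
section
open scoped Classical
variable {V : Type*} [Fintype V] {G : SimpleGraph V} {k : ℕ}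

variable {S : Finset V} {f : V → Fin k} {Φ : Finset (Fin k)}

lemma core3a (C : Crit G k) (T : Tight G S f Φ) (hk : S.card = k) {α : Fin k} (hα : α ∉ Φ)
    {pi pj pl : V} (si : pi ∉ S) (sj : pj ∉ S) (sl : pl ∉ S) (fi : f pi = α) (fj : f pj = α)
    (fl : f pl = α) (nij : pi ≠ pj) (nil : pi ≠ pl) (njl : pj ≠ pl)
    (hN : ∀ w ∈ S, ∀ x, x ∉ S → G.Adj w x → x = pi ∨ x = pj ∨ x = pl)
    (cij : ∀ w ∈ S, G.Adj pi w ∨ G.Adj pj w) (cil : ∀ w ∈ S, G.Adj pi w ∨ G.Adj pl w)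
    (cjl : ∀ w ∈ S, G.Adj pj w ∨ G.Adj pl w)
    {wi wj wl : V} (hwi : wi ∈ S) (hwj : wj ∈ S) (hwl : wl ∈ S) (ni : ¬ G.Adj pi wi)
    (nj : ¬ G.Adj pj wj) (nl : ¬ G.Adj pl wl)
    (ci : 4 ≤ (S.filter (fun w => G.Adj pi w)).card) (cj : 4 ≤ (S.filter (fun w => G.Adj pj w)).card) :
    False := by
  have hΦ := T.card
  have two : ∀ p, 4 ≤ (S.filter (fun w => G.Adj p w)).card →
      2 ≤ (Φ.filter (fun c => ¬ Sees G S f p c)).card := by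
    intro p hp
    have h1 := out_card' C (S := S) (p := p)
    have h2 := sees_card (G := G) (S := S) (f := f) (w := p) (D := Φ.filter (fun c => Sees G S f p c))
      (fun c hc => (Finset.mem_filter.1 hc).2)
    have h3 := Finset.card_filter_add_card_filter_not (s := Φ) (fun c => Sees G S f p c)
    omega
  have ti := two pi ci
  have tj := two pj cj
  obtain ⟨ρ, hρ⟩ := Finset.card_pos.1 (show 0 < (Φ.filter (fun c => ¬ Sees G S f pi c)).card by omega)
  obtain ⟨σ, hσ, hne⟩ := Finset.exists_mem_ne (s := Φ.filter (fun c => ¬ Sees G S f pj c)) (by omega) ρ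
  rw [Finset.mem_filter] at hρ hσ
  have hρα : ρ ≠ α := fun h => hα (h ▸ hρ.1)
  have hσα : σ ≠ α := fun h => hα (h ▸ hσ.1)
  have po1 := po_update T.po hρ.2
  have po2 : PO G S (Function.update (Function.update f pi ρ) pj σ) := by
    apply po_update po1
    rintro ⟨x, h1, h2, h3⟩
    rw [Function.update_apply] at h3
    split_ifs at h3 with hx
    · exact hne h3.symm
    · exact hσ.2 ⟨x, h1, h2, h3⟩
  set f' := Function.update (Function.update f pi ρ) pj σ with hf'
  have vi : f' pi = ρ := by simp [hf', Function.update_apply, nij]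
  have vj : f' pj = σ := by simp [hf', Function.update_apply]
  have vl : f' pl = α := by simp [hf', Function.update_apply, nil.symm, njl.symm, fl]
  have Lc : ∀ w ∈ S, ∀ c, c ∈ L G S f' w ↔ ((G.Adj pi w → c ≠ ρ) ∧ (G.Adj pj w → c ≠ σ) ∧ (G.Adj pl w → c ≠ α)) := by
    intro w hw c
    rw [mem_L]
    constructor
    · intro h
      refine ⟨fun ha e => h ⟨pi, si, ha.symm, ?_⟩, fun ha e => h ⟨pj, sj, ha.symm, ?_⟩, fun ha e => h ⟨pl, sl, ha.symm, ?_⟩⟩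
      · rw [vi, e]
      · rw [vj, e]
      · rw [vl, e]
    · rintro ⟨h1, h2, h3⟩ ⟨x, hx, wx, e⟩
      rcases hN w hw x hx wx with rfl | rfl | rfl
      · exact h1 wx.symm (e.symm.trans vi)
      · exact h2 wx.symm (e.symm.trans vj)
      · exact h3 wx.symm (e.symm.trans vl)
  have a1 := cij wi hwi
  have a2 := cil wi hwi
  have a3 := cij wj hwj
  have a4 := cjl wj hwj
  have a5 := cil wl hwl
  have a6 := cjl wl hwl
  rcases dich C T.cl po2 with ⟨Φ', hc, hs⟩ | ⟨u, hu, Λ, hΛ, h⟩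
  · have : Φ' = Finset.univ := by
      rw [Finset.eq_univ_iff_forall]
      intro c
      by_cases h1 : c = ρ
      · exact hs wi hwi ((Lc wi hwi c).2 (by grind))
      by_cases h2 : c = σ
      · exact hs wj hwj ((Lc wj hwj c).2 (by grind))
      · exact hs wl hwl ((Lc wl hwl c).2 (by grind))
    rw [this, Finset.card_univ, Fintype.card_fin] at hc
    omega
  · have e1 := Lc wi hwi
    have e2 := Lc wj hwj
    have e3 := Lc wl hwl
    have g1 := h wi hwi
    have g2 := h wj hwj
    have g3 := h wl hwl
    have q1 := e1 α
    have q2 := e2 α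
    have q3 := e3 α
    have q4 := e1 ρ
    have q5 := e2 ρ
    have q6 := e3 ρ
    by_cases z1 : wi = u
    · have z2 : wj ≠ u := by grind
      have z3 : wl ≠ u := by grind
      rw [g2 z2] at q2
      rw [g3 z3] at q3
      grind
    · rw [g1 z1] at q1 q4
      by_cases z2 : wj = u
      · have z3 : wl ≠ u := by grind
        rw [g3 z3] at q3
        grind
      · rw [g2 z2] at q2 q5
        grind

lemma card_cover {p q : V} (h : ∀ w ∈ S, G.Adj p w ∨ G.Adj q w) :
    S.card ≤ (S.filter (fun w => G.Adj p w)).card + (S.filter (fun w => G.Adj q w)).card := by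
  have hsub : S ⊆ S.filter (fun w => G.Adj p w) ∪ S.filter (fun w => G.Adj q w) := by
    intro w hw
    simp [hw, h w hw]
  exact (Finset.card_le_card hsub).trans (Finset.card_union_le _ _)

lemma step3a (C : Crit G k) (T : Tight G S f Φ) (hM : MaxC G S) (h5 : 5 ≤ S.card) {α : Fin k}
    (hα : α ∉ Φ) (hd : ∀ w ∈ S, ¬ NoDup G S f α w) : False := by
  have hd' : ∀ w ∈ S, ∃ x y, x ∉ S ∧ y ∉ S ∧ G.Adj w x ∧ G.Adj w y ∧ f x = α ∧ f y = α ∧ x ≠ y := by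
    intro w hw
    have := hd w hw
    unfold NoDup at this
    push Not at this
    exact this
  have hns : ∀ w ∈ S, ∀ ρ ∈ Φ, ¬ Sees G S f w ρ := by
    intro w hw ρ hρ hs
    obtain ⟨x, y, sx, sy, wx, wy, fx, fy, hne⟩ := hd' w hw
    exact hne (T.rain C hw hρ hs wx wy sx sy (fx.trans fy.symm))
  by_cases hα' : ∃ α', α' ∉ Φ ∧ α' ≠ α
  · obtain ⟨α', hα', hne⟩ := hα'
    obtain ⟨p, q, hp, hq, fp, fq, hx, ⟨x0, hx0, up⟩, ⟨y0, hy0, uq⟩⟩ := T.split C hM h5 hα' (by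
      intro w hw a b sa sb wa wb fa fb
      by_contra hab
      obtain ⟨x, y, sx, sy, wx, wy, fx, fy, hxy⟩ := hd' w hw
      have := T.pair C hw wx wy wa wb sx sy sa sb hxy hab (fx.trans fy.symm) (fa.trans fb.symm)
      grind)
    have h1 := (T.T2c C hx0 up (fp ▸ hα') (fun ρ hρ => by
      obtain ⟨w, hw, hn⟩ := hM.miss hp
      exact ⟨w, hw, hn, hns w hw ρ hρ⟩)).2
    have h2 := (T.T2c C hy0 uq (fq ▸ hα') (fun ρ hρ => by
      obtain ⟨w, hw, hn⟩ := hM.miss hq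
      exact ⟨w, hw, hn, hns w hw ρ hρ⟩)).2
    have h3 := card_cover (G := G) (S := S) (p := p) (q := q) (by intro w hw; have := hx w hw; tauto)
    omega
  · push Not at hα'
    have hsub : Φᶜ ⊆ {α} := by
      intro c hc
      rw [Finset.mem_compl] at hc
      simp [hα' c hc]
    have hcc := T.ccard
    have hle := Finset.card_le_card hsub
    rw [Finset.card_singleton] at hle
    have hk := C.clq S T.cl
    have hk8 := C.k8
    have hSk : S.card = k := by omega
    have hout : ∀ w ∈ S, ∀ x y z, x ∉ S → y ∉ S → z ∉ S → G.Adj w x → G.Adj w y → G.Adj w z →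
        x = y ∨ x = z ∨ y = z := by
      intro w hw x y z sx sy sz wx wy wz
      by_contra hcon
      push Not at hcon
      have h1 := out_card C T.cl hw
      have h2 : ({x, y, z} : Finset V) ⊆ out G S w := by
        intro t ht
        simp only [Finset.mem_insert, Finset.mem_singleton] at ht
        rw [mem_out]
        rcases ht with rfl | rfl | rfl <;> simp [*]
      have h3 := Finset.card_le_card h2
      rw [Finset.card_eq_three.2 ⟨x, y, z, hcon.1, hcon.2.1, hcon.2.2, rfl⟩] at h3
      omega
    have nadj : ∀ x y, x ∉ S → y ∉ S → f x = α → f y = α → ¬ G.Adj x y := 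
      fun x y sx sy fx fy h => T.po x y sx sy h (fx.trans fy.symm)
    have hpos : 0 < S.card := by omega
    obtain ⟨d, hdS⟩ := Finset.card_pos.1 hpos
    obtain ⟨p1, p2, s1, s2, d1, d2, f1, f2, n12⟩ := hd' d hdS
    have c12 := fun w hw => cover C T.cl hdS s1 s2 d1 d2 (nadj _ _ s1 s2 f1 f2) n12 (w := w) hw
    obtain ⟨y, hy, ny⟩ := hM.miss s1
    have y2 : G.Adj p2 y := (c12 y hy).resolve_left ny
    have h3 : ∃ p3, p3 ∉ S ∧ G.Adj y p3 ∧ f p3 = α ∧ p2 ≠ p3 := by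
      obtain ⟨a, b, sa, sb, ya, yb, fa, fb, hab⟩ := hd' y hy
      by_cases h : a = p2
      · exact ⟨b, sb, yb, fb, fun e => hab (h.trans e)⟩
      · exact ⟨a, sa, ya, fa, fun e => h e.symm⟩
    obtain ⟨p3, s3, y3, f3, n23⟩ := h3
    have n13 : p1 ≠ p3 := by rintro rfl; exact ny y3.symm
    have c23 := fun w hw => cover C T.cl hy s2 s3 y2.symm y3 (nadj _ _ s2 s3 f2 f3) n23 (w := w) hw
    obtain ⟨x, hx, nx⟩ := hM.miss s2
    have x1 : G.Adj p1 x := (c12 x hx).resolve_right nx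
    have x3 : G.Adj p3 x := (c23 x hx).resolve_left nx
    have c13 := fun w hw => cover C T.cl hx s1 s3 x1.symm x3.symm (nadj _ _ s1 s3 f1 f3) n13 (w := w) hw
    obtain ⟨z, hz, nz⟩ := hM.miss s3
    have hN : ∀ w ∈ S, ∀ t, t ∉ S → G.Adj w t → t = p1 ∨ t = p2 ∨ t = p3 := by
      intro w hw t st wt
      have e1 := c12 w hw
      have e2 := c23 w hw
      have e3 := c13 w hw
      by_cases a1 : G.Adj p1 w
      · by_cases a2 : G.Adj p2 w
        · have := hout w hw t p1 p2 st s1 s2 wt a1.symm a2.symm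
          tauto
        · have a3 := e2.resolve_left a2
          have := hout w hw t p1 p3 st s1 s3 wt a1.symm a3.symm
          tauto
      · have a2 := e1.resolve_left a1
        have a3 := e3.resolve_left a1
        have := hout w hw t p2 p3 st s2 s3 wt a2.symm a3.symm
        tauto
    have k12 := card_cover (G := G) (S := S) c12
    have k13 := card_cover (G := G) (S := S) c13
    have k23 := card_cover (G := G) (S := S) c23
    by_cases g1 : 4 ≤ (S.filter (fun w => G.Adj p1 w)).card
    · by_cases g2 : 4 ≤ (S.filter (fun w => G.Adj p2 w)).card
      · exact core3a C T hSk hα s1 s2 s3 f1 f2 f3 n12 n13 n23 hN c12 c13 c23 hy hx hz ny nx nz g1 g2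
      · exact core3a C T hSk hα s1 s3 s2 f1 f3 f2 n13 n12 n23.symm
          (fun w hw t st wt => by have := hN w hw t st wt; tauto)
          c13 c12 (fun w hw => (c23 w hw).symm) hy hz hx ny nz nx g1 (by omega)
    · exact core3a C T hSk hα s2 s3 s1 f2 f3 f1 n23 n12.symm n13.symm
          (fun w hw t st wt => by have := hN w hw t st wt; tauto)
          c23 (fun w hw => (c12 w hw).symm) (fun w hw => (c13 w hw).symm) hx hz hy nx nz ny (by omega) (by omega)

/-- the split of a 5-clique by a repetition-free colour -/
lemma five_split (C : Crit G k) (T : Tight G S f Φ) (hM : MaxC G S) (h5 : S.card = 5) {α : Fin k}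
    (hα : α ∉ Φ) (hd : ∀ w ∈ S, NoDup G S f α w) :
    ∃ b c s s' ρ, b ∉ S ∧ c ∉ S ∧ f b = α ∧ f c = α ∧ s ∈ S ∧ s' ∈ S ∧ s ≠ s' ∧ ρ ∈ Φ ∧
      Sees G S f s ρ ∧ Sees G S f s' ρ ∧ (∀ w ∈ S, G.Adj c w ↔ (w = s ∨ w = s')) ∧
      (∀ w ∈ S, G.Adj b w ↔ ¬ (w = s ∨ w = s')) ∧ (S.filter (fun w => G.Adj b w)).card ≤ 3 ∧
      (S.filter (fun w => G.Adj c w)).card ≤ 3 := by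
  have key : ∀ p q x0, p ∉ S → q ∉ S → f p = α → f q = α → 
      (∀ w ∈ S, (G.Adj p w ∧ ¬ G.Adj q w) ∨ (G.Adj q w ∧ ¬ G.Adj p w)) → x0 ∈ S → UqO G S f x0 p →
      (S.filter (fun w => G.Adj q w)).card ≤ 2 → 
      ∃ b c s s' ρ, b ∉ S ∧ c ∉ S ∧ f b = α ∧ f c = α ∧ s ∈ S ∧ s' ∈ S ∧ s ≠ s' ∧ ρ ∈ Φ ∧
      Sees G S f s ρ ∧ Sees G S f s' ρ ∧ (∀ w ∈ S, G.Adj c w ↔ (w = s ∨ w = s')) ∧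
      (∀ w ∈ S, G.Adj b w ↔ ¬ (w = s ∨ w = s')) ∧ (S.filter (fun w => G.Adj b w)).card ≤ 3 ∧
      (S.filter (fun w => G.Adj c w)).card ≤ 3 := by
    intro p q x0 hp hq fp fq hx hx0 up hq2
    obtain ⟨y0, hy0, py0⟩ := hM.miss hp
    have hcov := card_cover (G := G) (S := S) (p := p) (q := q) (by intro w hw; have := hx w hw; tauto)
    rcases T.T2 C hx0 up (fp ▸ hα) hy0 py0 with h | ⟨h3, ρ, hρ, hs, -⟩
    · omega
    have hq2' : (S.filter (fun w => G.Adj q w)).card = 2 := by omega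
    obtain ⟨s, s', hne, hss⟩ := Finset.card_eq_two.1 hq2'
    have hiff : ∀ w, (w ∈ S ∧ G.Adj q w) ↔ (w = s ∨ w = s') := by
      intro w
      have := Finset.ext_iff.1 hss w
      simpa using this
    have hsS := (hiff s).2 (Or.inl rfl)
    have hsS' := (hiff s').2 (Or.inr rfl)
    refine ⟨p, q, s, s', ρ, hp, hq, fp, fq, hsS.1, hsS'.1, hne, hρ, hs s hsS.1 ?_, hs s' hsS'.1 ?_, ?_, ?_, by omega, by omega⟩
    · have := hx s hsS.1; tauto
    · have := hx s' hsS'.1; tauto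
    · intro w hw; have := hiff w; tauto
    · intro w hw; have := hiff w; have := hx w hw; tauto
  obtain ⟨p, q, hp, hq, fp, fq, hx, ⟨x0, hx0, up⟩, ⟨y0, hy0, uq⟩⟩ := T.split C hM (by omega) hα hd
  by_cases h2 : (S.filter (fun w => G.Adj q w)).card ≤ 2
  · exact key p q x0 hp hq fp fq hx hx0 up h2
  · have : (S.filter (fun w => G.Adj p w)).card ≤ 2 := by
      have hsum : (S.filter (fun w => G.Adj p w)).card + (S.filter (fun w => G.Adj q w)).card = S.card := by
        rw [← Finset.card_filter_add_card_filter_not (s := S) (fun w => G.Adj p w)]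
        congr 2
        ext w
        simp only [Finset.mem_filter]
        have := hx w
        tauto
      omega
    exact key q p y0 hq hp fq fp (fun w hw => (hx w hw).symm) hy0 uq this

lemma step3b' (C : Crit G k) (T : Tight G S f Φ) (hM : MaxC G S) (h5 : 5 ≤ S.card) {α : Fin k}
    (hα : α ∉ Φ) {d p q w0 : V} (hdS : d ∈ S) (hp : p ∉ S) (hq : q ∉ S) (dp : G.Adj d p)
    (dq : G.Adj d q) (fp : f p = α) (fq : f q = α) (hpq : p ≠ q) (hw0 : w0 ∈ S)
    (hnd : NoDup G S f α w0) (wp : G.Adj p w0) : False := by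
  have nadj : ∀ x y, x ∉ S → y ∉ S → f x = α → f y = α → ¬ G.Adj x y := 
      fun x y sx sy fx fy h => T.po x y sx sy h (fx.trans fy.symm)
  have hcov := fun w hw => cover C T.cl hdS hp hq dp dq (nadj _ _ hp hq fp fq) hpq (w := w) hw
  have wq : ¬ G.Adj q w0 := fun h => hpq (hnd p q hp hq wp.symm h.symm fp fq)
  obtain ⟨y, hy, py⟩ := hM.miss hp
  have qy : G.Adj q y := (hcov y hy).resolve_left py
  have yq : ∀ q', q' ∉ S → G.Adj y q' → f q' = α → q' = q := by
    intro q' hq' yq' fq'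
    by_contra hne
    rcases cover C T.cl hy hq hq' qy.symm yq' (nadj _ _ hq hq' fq fq') (Ne.symm hne) hw0 with h | h
    · exact wq h
    · have := hnd q' p hq' hp h.symm wp.symm fq' fp
      subst this
      exact py yq'.symm
  have up : UqO G S f w0 p := hnd.uqo hp wp.symm fp
  have uq : UqO G S f y q := ⟨qy.symm, hq, fun x hx yx fx => yq x hx yx (fx.trans fq)⟩
  have hsum := Finset.card_union_add_card_inter (S.filter (fun w => G.Adj p w)) (S.filter (fun w => G.Adj q w))
  have hun : S.filter (fun w => G.Adj p w) ∪ S.filter (fun w => G.Adj q w) = S := by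
    ext w
    simp only [Finset.mem_union, Finset.mem_filter]
    have := hcov w
    tauto
  rw [hun] at hsum
  have hdi : d ∈ S.filter (fun w => G.Adj p w) ∩ S.filter (fun w => G.Adj q w) := by
    simp [hdS, dp.symm, dq.symm]
  have hdc : 0 < (S.filter (fun w => G.Adj p w) ∩ S.filter (fun w => G.Adj q w)).card := Finset.card_pos.2 ⟨d, hdi⟩
  have tp := T.T2 C hw0 up (fp ▸ hα) hy py
  have tq := T.T2 C hy uq (fq ▸ hα) hw0 wq
  rcases tp with tp | ⟨p3, ρ1, hρ1, sρ1, -⟩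
  · omega
  rcases tq with tq | ⟨q3, ρ2, hρ2, sρ2, -⟩
  · omega
  have hS5 : S.card = 5 := by omega
  have hi1 : (S.filter (fun w => G.Adj p w) ∩ S.filter (fun w => G.Adj q w)).card = 1 := by omega
  have honly : ∀ w ∈ S, G.Adj p w → G.Adj q w → w = d := by
    intro w hw h1 h2
    obtain ⟨e, he⟩ := Finset.card_eq_one.1 hi1
    have h3 : w ∈ S.filter (fun w => G.Adj p w) ∩ S.filter (fun w => G.Adj q w) := by simp [hw, h1, h2]
    rw [he, Finset.mem_singleton] at h3 hdi
    rw [h3, hdi]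
  have hne : ρ1 ≠ ρ2 := by
    rintro rfl
    refine T.four C hdS hρ1 (fun w hw hwd => ?_)
    by_cases h1 : G.Adj p w
    · by_cases h2 : G.Adj q w
      · exact absurd (honly w hw h1 h2) hwd
      · exact sρ2 w hw h2
    · exact sρ1 w hw h1
  have dns : ∀ ρ ∈ Φ, ¬ Sees G S f d ρ := fun ρ hρ hs =>
    hpq (T.rain C hdS hρ hs dp dq hp hq (fp.trans fq.symm))
  have hnd' : ∀ α', α' ∉ Φ → α' ≠ α → ∀ w ∈ S, NoDup G S f α' w := by
    intro α' hα' hne' w hw a b sa sb wa wb fa fb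
    by_cases hwd : w = d
    · subst hwd
      by_contra hab
      have := T.pair C hw dp dq wa wb hp hq sa sb hpq hab (fp.trans fq.symm) (fa.trans fb.symm)
      grind
    · by_cases h1 : G.Adj p w
      · by_cases h2 : G.Adj q w
        · exact absurd (honly w hw h1 h2) hwd
        · exact T.rain C hw hρ2 (sρ2 w hw h2) wa wb sa sb (fa.trans fb.symm)
      · exact T.rain C hw hρ1 (sρ1 w hw h1) wa wb sa sb (fa.trans fb.symm)
  have hcq : (S.filter (fun w => ¬ G.Adj q w)).card = 2 := by
    have := Finset.card_filter_add_card_filter_not (s := S) (fun w => G.Adj q w)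
    omega
  obtain ⟨x, x', hxx, hX⟩ := Finset.card_eq_two.1 hcq
  have hiff : ∀ w, (w ∈ S ∧ ¬ G.Adj q w) ↔ (w = x ∨ w = x') := by
    intro w
    have := Finset.ext_iff.1 hX w
    simpa using this
  have hx := (hiff x).2 (Or.inl rfl)
  have hx' := (hiff x').2 (Or.inr rfl)
  refine T.N5 C hM hS5 hx.1 hx'.1 hxx (fun β hβ => ?_)
  by_cases hβα : β = α
  · subst hβα
    exact ⟨p, hp, fp, (hcov x hx.1).resolve_right hx.2, (hcov x' hx'.1).resolve_right hx'.2, by omega⟩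
  obtain ⟨b, c, s, s', ρ, hb, hc, fb, fc, hs, hs', hss, hρ, sees, sees', hC, hBB, cb, cc⟩ :=
    five_split C T hM hS5 hβ (hnd' β hβ hβα)
  have sd : s ≠ d := by rintro rfl; exact dns ρ hρ sees
  have sd' : s' ≠ d := by rintro rfl; exact dns ρ hρ sees'
  have typ : ∀ w ∈ S, w ≠ d → Sees G S f w ρ → (ρ = ρ2 ∧ ¬ G.Adj q w) ∨ (ρ = ρ1 ∧ ¬ G.Adj p w) := by
    intro w hw hwd hsw
    by_cases h1 : G.Adj p w
    · by_cases h2 : G.Adj q w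
      · exact absurd (honly w hw h1 h2) hwd
      · exact Or.inl ⟨T.miss C hw hρ hρ2 hsw (sρ2 w hw h2), h2⟩
    · exact Or.inr ⟨T.miss C hw hρ hρ1 hsw (sρ1 w hw h1), h1⟩
  have t1 := typ s hs sd sees
  have t2 := typ s' hs' sd' sees'
  have e1 := hiff s
  have e2 := hiff s'
  by_cases hr : ρ = ρ2
  · have g1 : ¬ G.Adj q s := by grind
    have g2 : ¬ G.Adj q s' := by grind
    refine ⟨c, hc, fc, (hC x hx.1).2 ?_, (hC x' hx'.1).2 ?_, cc⟩ <;> grind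
  · have g1 : ¬ G.Adj p s := by grind
    have g2 : ¬ G.Adj p s' := by grind
    have i1 := (hcov x hx.1).resolve_right hx.2
    have i2 := (hcov x' hx'.1).resolve_right hx'.2
    refine ⟨b, hb, fb, (hBB x hx.1).2 ?_, (hBB x' hx'.1).2 ?_, cb⟩ <;> grind

lemma step3 (C : Crit G k) (T : Tight G S f Φ) (hM : MaxC G S) (h5 : 5 ≤ S.card) {α : Fin k}
    (hα : α ∉ Φ) {w : V} (hw : w ∈ S) : NoDup G S f α w := by
  by_contra hdup
  by_cases hall : ∀ w ∈ S, ¬ NoDup G S f α w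
  · exact step3a C T hM h5 hα hall
  push Not at hall
  obtain ⟨w0, hw0, hnd⟩ := hall
  unfold NoDup at hdup
  push Not at hdup
  obtain ⟨p, q, hp, hq, dp, dq, fp, fq, hne⟩ := hdup
  have nadj : ¬ G.Adj p q := fun h => T.po p q hp hq h (fp.trans fq.symm)
  rcases cover C T.cl hw hp hq dp dq nadj hne hw0 with h | h
  · exact step3b' C T hM h5 hα hw hp hq dp dq fp fq hne hw0 hnd h
  · exact step3b' C T hM h5 hα hw hq hp dq dp fq fp hne.symm hw0 hnd h

lemma step4_five (C : Crit G k) (T : Tight G S f Φ) (hM : MaxC G S) (h5 : S.card = 5) : False := by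
  have hnd : ∀ α, α ∉ Φ → ∀ w ∈ S, NoDup G S f α w := fun α hα w hw => step3 C T hM (by omega) hα hw
  have hk8 := C.k8
  have hcc := T.ccard
  obtain ⟨α0, hα0⟩ := Finset.card_pos.1 (show 0 < (Φᶜ).card by omega)
  rw [Finset.mem_compl] at hα0
  obtain ⟨b, c, t, t', ρ, hb, hc, fb, fc, ht, ht', htt, hρ, st, st', hC, hBB, cb, cc⟩ :=
    five_split C T hM h5 hα0 (hnd α0 hα0)
  -- separating colour
  have sep : ∀ t t', t ∈ S → t' ∈ S → t ≠ t' → Sees G S f t ρ → Sees G S f t' ρ →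
      ∀ b1 c1 x1 ρ1, ρ1 ∈ Φ → x1 ∈ S → x1 ≠ t → x1 ≠ t' → Sees G S f t ρ1 → Sees G S f x1 ρ1 → b1 ∉ S → c1 ∉ S → False := by
    intro t t' ht ht' htt st st' b1 c1 x1 ρ1 hρ1 hx1 n1 n2 st1 sx1 _ _
    have := T.miss C ht hρ1 hρ st1 st
    subst this
    have hsub : ({t, t', x1} : Finset V) ⊆ S := by
      intro w hw
      simp only [Finset.mem_insert, Finset.mem_singleton] at hw
      rcases hw with rfl | rfl | rfl <;> assumption
    have hc3 : ({t, t', x1} : Finset V).card = 3 := Finset.card_eq_three.2 ⟨t, t', x1, htt, n1.symm, n2.symm, rfl⟩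
    have hc2 : (S \ {t, t', x1}).card = 2 := by
      rw [Finset.card_sdiff_of_subset hsub]; omega
    obtain ⟨y, z, hyz, hY⟩ := Finset.card_eq_two.1 hc2
    have hiff : ∀ w, (w ∈ S ∧ ¬ (w = t ∨ w = t' ∨ w = x1)) ↔ (w = y ∨ w = z) := by
      intro w
      have := Finset.ext_iff.1 hY w
      simpa using this
    have hy := (hiff y).2 (Or.inl rfl)
    have hz := (hiff z).2 (Or.inr rfl)
    have hrest : ∀ w ∈ S, w ≠ y → w ≠ z → Sees G S f w ρ1 := by
      intro w hw h1 h2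
      have : w = t ∨ w = t' ∨ w = x1 := by
        by_contra hn
        rcases (hiff w).1 ⟨hw, hn⟩ with e | e
        · exact h1 e
        · exact h2 e
      rcases this with rfl | rfl | rfl <;> assumption
    have ny : ¬ Sees G S f y ρ1 := by
      intro h
      refine T.four C hz.1 hρ (fun w hw hwz => ?_)
      by_cases e : w = y
      · rwa [e]
      · exact hrest w hw e hwz
    have nz : ¬ Sees G S f z ρ1 := by
      intro h
      refine T.four C hy.1 hρ (fun w hw hwz => ?_)
      by_cases e : w = z
      · rwa [e]
      · exact hrest w hw hwz e
    refine T.N5 C hM h5 hy.1 hz.1 hyz (fun β hβ => ?_)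
    obtain ⟨b, c, s, s', ρ', hb, hc, fb, fc, hs, hs', hss, hρ', sees, sees', hC, hBB, cb, cc⟩ :=
      five_split C T hM h5 hβ (hnd β hβ)
    by_cases hyin : y = s ∨ y = s'
    · by_cases hzin : z = s ∨ z = s'
      · exact ⟨c, hc, fc, (hC y hy.1).2 hyin, (hC z hz.1).2 hzin, cc⟩
      · exfalso
        rcases hyin with rfl | rfl
        · have r1 := hrest s' hs' hss.symm (fun e => hzin (Or.inr e.symm))
          have := T.miss C hs' hρ hρ' r1 sees'
          subst this
          exact ny sees
        · have r1 := hrest s hs hss (fun e => hzin (Or.inl e.symm))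
          have := T.miss C hs hρ hρ' r1 sees
          subst this
          exact ny sees'
    · by_cases hzin : z = s ∨ z = s'
      · exfalso
        rcases hzin with rfl | rfl
        · have r1 := hrest s' hs' (fun e => hyin (Or.inr e.symm)) hss.symm
          have := T.miss C hs' hρ hρ' r1 sees'
          subst this
          exact nz sees
        · have r1 := hrest s hs (fun e => hyin (Or.inl e.symm)) hss
          have := T.miss C hs hρ hρ' r1 sees
          subst this
          exact nz sees'
      · exact ⟨b, hb, fb, (hBB y hy.1).2 hyin, (hBB z hz.1).2 hzin, cb⟩
  refine T.N5 C hM h5 ht ht' htt (fun β hβ => ?_)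
  obtain ⟨b1, c1, s, s', ρ1, hb1, hc1, fb1, fc1, hs, hs', hss, hρ1, sees, sees', hC1, hBB1, cb1, cc1⟩ :=
    five_split C T hM h5 hβ (hnd β hβ)
  by_cases h1 : t = s ∨ t = s'
  · by_cases h2 : t' = s ∨ t' = s'
    · exact ⟨c1, hc1, fc1, (hC1 t ht).2 h1, (hC1 t' ht').2 h2, cc1⟩
    · exfalso
      rcases h1 with rfl | rfl
      · exact sep t t' ht ht' htt st st' b1 c1 s' ρ1 hρ1 hs' hss.symm (fun e => h2 (Or.inr e.symm)) sees sees' hb1 hc1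
      · exact sep t t' ht ht' htt st st' b1 c1 s ρ1 hρ1 hs hss (fun e => h2 (Or.inl e.symm)) sees' sees hb1 hc1
  · by_cases h2 : t' = s ∨ t' = s'
    · exfalso
      rcases h2 with rfl | rfl
      · exact sep t' t ht' ht htt.symm st' st b1 c1 s' ρ1 hρ1 hs' hss.symm (fun e => h1 (Or.inr e.symm)) sees sees' hb1 hc1
      · exact sep t' t ht' ht htt.symm st' st b1 c1 s ρ1 hρ1 hs hss (fun e => h1 (Or.inl e.symm)) sees' sees hb1 hc1
    · exact ⟨b1, hb1, fb1, (hBB1 t ht).2 h1, (hBB1 t' ht').2 h2, cb1⟩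

lemma six_split (C : Crit G k) (T : Tight G S f Φ) (hM : MaxC G S) (h6 : 6 ≤ S.card) {α : Fin k}
    (hα : α ∉ Φ) : S.card = 6 ∧ 
    ∃ p q ρ σ, p ∉ S ∧ q ∉ S ∧ f p = α ∧ f q = α ∧ ρ ∈ Φ ∧ σ ∈ Φ ∧ ρ ≠ σ ∧
      (∀ w ∈ S, G.Adj p w ↔ Sees G S f w ρ) ∧ (∀ w ∈ S, G.Adj q w ↔ Sees G S f w σ) ∧
      (∀ w ∈ S, Sees G S f w ρ ∨ Sees G S f w σ) ∧
      (S.filter (fun w => Sees G S f w ρ)).card = 3 ∧ (S.filter (fun w => Sees G S f w σ)).card = 3 ∧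
      (∀ x y, x ∉ S → y ∉ S → G.Adj p x → G.Adj p y → f x = f y → x = y) ∧
      (∀ x y, x ∉ S → y ∉ S → G.Adj q x → G.Adj q y → f x = f y → x = y) := by
  obtain ⟨p, q, hp, hq, fp, fq, hx, ⟨x0, hx0, up⟩, ⟨y0, hy0, uq⟩⟩ :=
    T.split C hM (by omega) hα (fun w hw => step3 C T hM (by omega) hα hw)
  obtain ⟨y, hy, py⟩ := hM.miss hp
  obtain ⟨x, hxS, qx⟩ := hM.miss hq
  have hcov := card_cover (G := G) (S := S) (p := p) (q := q) (by intro w hw; have := hx w hw; tauto)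
  have tp := T.T2 C hx0 up (fp ▸ hα) hy py
  have tq := T.T2 C hy0 uq (fq ▸ hα) hxS qx
  rcases tp with tp | ⟨p3, σ, hσ, sσ, rp⟩
  · omega
  rcases tq with tq | ⟨q3, ρ, hρ, sρ, rq⟩
  · omega
  have hall : ∀ w ∈ S, Sees G S f w ρ ∨ Sees G S f w σ := by
    intro w hw
    rcases hx w hw with h | h
    · exact Or.inl (sρ w hw h.2)
    · exact Or.inr (sσ w hw h.2)
  have hne : ρ ≠ σ := by
    rintro rfl
    obtain ⟨w, hw, hn⟩ := T.all C hρ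
    have := hall w hw
    tauto
  have ip : ∀ w ∈ S, G.Adj p w ↔ Sees G S f w ρ := by
    intro w hw
    constructor
    · intro h
      have := hx w hw
      exact sρ w hw (by tauto)
    · intro h
      by_contra hn
      exact hne (T.miss C hw hρ hσ h (sσ w hw hn))
  have iq : ∀ w ∈ S, G.Adj q w ↔ Sees G S f w σ := by
    intro w hw
    constructor
    · intro h
      have := hx w hw
      exact sσ w hw (by tauto)
    · intro h
      by_contra hn
      exact hne (T.miss C hw hρ hσ (sρ w hw hn) h)
  refine ⟨by omega, p, q, ρ, σ, hp, hq, fp, fq, hρ, hσ, hne, ip, iq, hall, ?_, ?_, rp, rq⟩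
  · rw [← p3]
    congr 1
    apply Finset.filter_congr
    intro w hw
    rw [ip w hw]
  · rw [← q3]
    congr 1
    apply Finset.filter_congr
    intro w hw
    rw [iq w hw]

lemma step4_six (C : Crit G k) (T : Tight G S f Φ) (hM : MaxC G S) (h6 : 6 ≤ S.card) : False := by
  have hk8 := C.k8
  have hcc := T.ccard
  have hkS := C.clq S T.cl
  have cf := crit_cf C
  obtain ⟨α0, hα0⟩ := Finset.card_pos.1 (show 0 < (Φᶜ).card by omega)
  rw [Finset.mem_compl] at hα0
  obtain ⟨hS6, p0, q0, ρ, σ, hp0, hq0, fp0, fq0, hρ, hσ, hne, ip0, iq0, hall, cρ, cσ, rp0, rq0⟩ :=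
    six_split C T hM h6 hα0
  have hex : ∀ α, ∃ p, α ∉ Φ → (p ∉ S ∧ f p = α ∧ (∀ w ∈ S, G.Adj p w ↔ Sees G S f w ρ) ∧
      (∀ x y, x ∉ S → y ∉ S → G.Adj p x → G.Adj p y → f x = f y → x = y)) := by
    intro α
    by_cases hα : α ∈ Φ
    · exact ⟨p0, fun h => absurd hα h⟩
    obtain ⟨-, p, q, ρ', σ', hp, hq, fp, fq, hρ', hσ', hne', ip, iq, hall', cρ', cσ', rp, rq⟩ :=
      six_split C T hM h6 hα
    by_cases h1 : ρ' = ρ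
    · subst h1
      exact ⟨p, fun _ => ⟨hp, fp, ip, rp⟩⟩
    by_cases h2 : σ' = ρ
    · subst h2
      exact ⟨q, fun _ => ⟨hq, fq, iq, rq⟩⟩
    exfalso
    obtain ⟨w, hw⟩ := Finset.card_pos.1 (show 0 < (S.filter (fun w => Sees G S f w ρ)).card by omega)
    rw [Finset.mem_filter] at hw
    rcases hall' w hw.1 with h | h
    · exact h1 (T.miss C hw.1 hρ' hρ h hw.2)
    · exact h2 (T.miss C hw.1 hσ' hρ h hw.2)
  choose b hb using hex
  set P := S.filter (fun w => Sees G S f w ρ) with hP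
  have memP : ∀ w, w ∈ P ↔ w ∈ S ∧ Sees G S f w ρ := fun w => by rw [hP, Finset.mem_filter]
  obtain ⟨x0, hx0⟩ := Finset.card_pos.1 (show 0 < P.card by omega)
  obtain ⟨y0, hy0⟩ := Finset.card_pos.1 (show 0 < (S.filter (fun w => Sees G S f w σ)).card by omega)
  rw [Finset.mem_filter] at hy0
  rw [memP] at hx0
  have ny0 : ¬ Sees G S f y0 ρ := fun h => hne (T.miss C hy0.1 hρ hσ h hy0.2)
  have hxy : ∀ x, x ∈ P → G.Adj x y0 := by
    intro x hx
    rw [memP] at hx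
    exact T.cl x hx.1 y0 hy0.1 (by rintro rfl; exact ny0 hx.2)
  have bP : ∀ α, α ∉ Φ → ∀ x ∈ P, G.Adj (b α) x := by
    intro α hα x hx
    rw [memP] at hx
    exact ((hb α hα).2.2.1 x hx.1).2 hx.2
  have by0 : ∀ α, α ∉ Φ → ¬ G.Adj (b α) y0 := fun α hα h => ny0 (((hb α hα).2.2.1 y0 hy0.1).1 h)
  have bne0 : ∀ α, α ∉ Φ → ∀ w ∈ S, b α ≠ w := fun α hα w hw e => (hb α hα).1 (e ▸ hw)
  have hx0P : x0 ∈ P := (memP x0).2 hx0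
  have bb : ∀ α β, α ∉ Φ → β ∉ Φ → b α ≠ b β → G.Adj (b α) (b β) := by
    intro α β hα hβ h
    by_contra hn
    exact cf x0 (b α) (b β) y0 (bP α hα x0 hx0P).symm (bP β hβ x0 hx0P).symm (hxy x0 hx0P) hn
      (by0 α hα) (by0 β hβ) h (bne0 α hα y0 hy0.1) (bne0 β hβ y0 hy0.1)
  have tb : ∀ x ∈ P, ∀ t, t ∉ S → G.Adj x t → f t = ρ → ∀ α, α ∉ Φ → G.Adj (b α) t := by
    intro x hx t st xt ft α hα
    by_contra hn
    refine cf x (b α) t y0 (bP α hα x hx).symm xt (hxy x hx) hn (by0 α hα) ?_ ?_ (bne0 α hα y0 hy0.1) ?_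
    · intro h
      exact ny0 ⟨t, st, h.symm, ft⟩
    · rintro rfl
      rw [(hb α hα).2.1] at ft
      exact hα (ft ▸ hρ)
    · rintro rfl
      exact st hy0.1
  obtain ⟨t, st, x0t, ft⟩ := hx0.2
  have tP : ∀ x ∈ P, G.Adj t x := by
    intro x hx
    obtain ⟨t', st', xt', ft'⟩ := ((memP x).1 hx).2
    have := (hb α0 hα0).2.2.2 t' t st' st (tb x hx t' st' xt' ft' α0 hα0) (tb x0 hx0P t st x0t ft α0 hα0)
      (ft'.trans ft.symm)
    subst this
    exact xt'.symm
  have inj : ∀ α ∈ Φᶜ, ∀ β ∈ Φᶜ, b α = b β → α = β := by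
    intro α hα β hβ e
    rw [← (hb α (by simpa using hα)).2.1, ← (hb β (by simpa using hβ)).2.1, e]
  have hcl1 : Cliq G (P ∪ (Φᶜ).image b) := by
    intro x hx y hy hne
    simp only [Finset.mem_union, Finset.mem_image, Finset.mem_compl] at hx hy
    rcases hx with hx | ⟨α, hα, rfl⟩ <;> rcases hy with hy | ⟨β, hβ, rfl⟩
    · exact T.cl x ((memP x).1 hx).1 y ((memP y).1 hy).1 hne
    · exact (bP β hβ x hx).symm
    · exact bP α hα y hy
    · exact bb α β hα hβ hne
  have hcl2 : Cliq G (insert t (P ∪ (Φᶜ).image b)) := cliq_insert hcl1 (by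
    intro w hw
    simp only [Finset.mem_union, Finset.mem_image, Finset.mem_compl] at hw
    rcases hw with hw | ⟨α, hα, rfl⟩
    · exact tP w hw
    · exact (tb x0 hx0P t st x0t ft α hα).symm)
  have hdis : Disjoint P ((Φᶜ).image b) := by
    rw [Finset.disjoint_left]
    intro x hx h
    simp only [Finset.mem_image, Finset.mem_compl] at h
    obtain ⟨α, hα, rfl⟩ := h
    exact (hb α hα).1 ((memP _).1 hx).1
  have hcard := hM.2 _ hcl2
  rw [Finset.card_insert_of_notMem, Finset.card_union_of_disjoint hdis, Finset.card_image_of_injOn inj] at hcard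
  · omega
  · intro h
    simp only [Finset.mem_union, Finset.mem_image, Finset.mem_compl] at h
    rcases h with h | ⟨α, hα, rfl⟩
    · exact st ((memP t).1 h).1
    · rw [(hb α hα).2.1] at ft
      exact hα (ft ▸ hρ)

theorem crit_false (C : Crit G k) [Nonempty V] : False := by
  obtain ⟨A, f, Φ, T, hM, h5⟩ := step1 C
  by_cases h : A.card = 5
  · exact step4_five C T hM h
  · exact step4_six C T hM (by omega)
end
end BK

open SimpleGraph
set_option linter.all false
set_option linter.unusedSectionVars false
set_option linter.unusedVariables false
set_option linter.unusedSimpArgs false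
namespace BK
section
open scoped Classical
variable {V : Type*} [Fintype V] {G : SimpleGraph V} {k : ℕ}

def ColOn (G : SimpleGraph V) (k : ℕ) (S : Finset V) : Prop :=
  ∃ f : V → Fin k, ∀ x ∈ S, ∀ y ∈ S, G.Adj x y → f x ≠ f y

theorem main (hk : 8 ≤ k) (deg : ∀ v (s : Finset V), (∀ x ∈ s, G.Adj v x) → s.card ≤ k + 1)
    (clq : ∀ s : Finset V, (∀ x ∈ s, ∀ y ∈ s, x ≠ y → G.Adj x y) → s.card ≤ k)
    (chair : ∀ w a v b c, G.Adj w a → G.Adj a v → G.Adj v b → G.Adj v c → b ≠ c →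
    ¬ G.Adj w v → ¬ G.Adj w b → ¬ G.Adj w c → ¬ G.Adj a b → ¬ G.Adj a c → ¬ G.Adj b c → False) :
    G.Colorable k := by
  by_contra hcol
  have huniv : ¬ ColOn G k Finset.univ := by
    rintro ⟨f, hf⟩
    exact hcol ⟨SimpleGraph.Coloring.mk f (fun {x y} h => hf x (Finset.mem_univ _) y (Finset.mem_univ _) h)⟩
  obtain ⟨S, hS, hmin⟩ := Finset.exists_min_image
    (Finset.univ.filter (fun S : Finset V => ¬ ColOn G k S)) Finset.card
    ⟨Finset.univ, Finset.mem_filter.2 ⟨Finset.mem_univ _, huniv⟩⟩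
  rw [Finset.mem_filter] at hS
  have hS := hS.2
  let c0 : Fin k := ⟨0, by omega⟩
  let H : SimpleGraph S := G.comap (fun x : S => (x : V))
  have hH : ∀ x y : S, H.Adj x y ↔ G.Adj x y := fun x y => Iff.rfl
  have hne : Nonempty S := by
    by_contra hn
    apply hS
    refine ⟨fun _ => c0, fun x hx => ?_⟩
    exact absurd ⟨⟨x, hx⟩⟩ hn
  have C : Crit H k := by
    refine ⟨?_, ?_, ?_, ?_, ?_, hk⟩
    · intro f
      by_contra hcon
      push Not at hcon
      apply hS
      refine ⟨fun x => if h : x ∈ S then f ⟨x, h⟩ else c0, fun x hx y hy hxy => ?_⟩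
      simp only [hx, hy, dif_pos]
      exact hcon ⟨x, hx⟩ ⟨y, hy⟩ hxy
    · intro v
      have : ColOn G k (S.erase v) := by
        by_contra hn
        have := hmin (S.erase v) (Finset.mem_filter.2 ⟨Finset.mem_univ _, hn⟩)
        have := Finset.card_erase_lt_of_mem v.2
        omega
      obtain ⟨f, hf⟩ := this
      refine ⟨fun x => f x, fun x y hx hy hxy => hf x ?_ y ?_ hxy⟩
      · exact Finset.mem_erase.2 ⟨fun h => hx (Subtype.ext h), x.2⟩
      · exact Finset.mem_erase.2 ⟨fun h => hy (Subtype.ext h), y.2⟩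
    · intro v s hs
      have := deg v (s.map (Function.Embedding.subtype _)) (by
        intro x hx
        rw [Finset.mem_map] at hx
        obtain ⟨y, hy, rfl⟩ := hx
        exact hs y hy)
      rwa [Finset.card_map] at this
    · intro s hs
      have := clq (s.map (Function.Embedding.subtype _)) (by
        intro x hx y hy hxy
        rw [Finset.mem_map] at hx hy
        obtain ⟨x, hx, rfl⟩ := hx
        obtain ⟨y, hy, rfl⟩ := hy
        exact hs x hx y hy (fun h => hxy (h ▸ rfl)))
      rwa [Finset.card_map] at this
    · intro w a v b c h1 h2 h3 h4 h5
      exact chair w a v b c h1 h2 h3 h4 (fun h => h5 (Subtype.ext h))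
  exact crit_false C
end
end BK

theorem borodin_kostochka_chair_free
    {V : Type*} [Fintype V]
    (G : SimpleGraph V) [DecidableRel G.Adj]
    (hΔ : 9 ≤ G.maxDegree)
    (hfree : ¬ Nonempty (chairGraph ↪g G)) :
    G.chromaticNumber ≤ (↑(max (G.maxDegree - 1) G.cliqueNum) : ℕ∞) := by
  apply Colorable.chromaticNumber_le
  have h1 := le_max_left (G.maxDegree - 1) G.cliqueNum
  have h2 := le_max_right (G.maxDegree - 1) G.cliqueNum
  apply BK.main
  · omega
  · intro v s hs
    have h3 : s.card ≤ G.degree v := by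
      rw [← card_neighborFinset_eq_degree]
      exact Finset.card_le_card (fun x hx => (mem_neighborFinset _ _ _).2 (hs x hx))
    have h4 := G.degree_le_maxDegree v
    omega
  · intro s hs
    refine le_trans ?_ h2
    have : G.IsClique (s : Set V) := fun x hx y hy hxy => hs x hx y hy hxy
    exact this.card_le_cliqueNum
  · intro w a v b c wa av vb vc bc nwv nwb nwc nab nac nbc
    apply hfree
    have e1 := wa.symm
    have e2 := av.symm
    have e3 := vb.symm
    have e4 := vc.symm
    have m1 : ¬ G.Adj v w := fun h => nwv h.symm
    have m2 : ¬ G.Adj b w := fun h => nwb h.symm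
    have m3 : ¬ G.Adj c w := fun h => nwc h.symm
    have m4 : ¬ G.Adj b a := fun h => nab h.symm
    have m5 : ¬ G.Adj c a := fun h => nac h.symm
    have m6 : ¬ G.Adj c b := fun h => nbc h.symm
    have d1 := wa.ne
    have d2 := av.ne
    have d3 := vb.ne
    have d4 := vc.ne
    have d5 : w ≠ v := by rintro rfl; exact nwb vb
    have d6 : w ≠ b := by rintro rfl; exact nwv e3
    have d7 : w ≠ c := by rintro rfl; exact nwv e4
    have d8 : a ≠ b := by rintro rfl; exact nwb wa
    have d9 : a ≠ c := by rintro rfl; exact nwc wa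
    refine ⟨⟨⟨![w, a, v, b, c], ?_⟩, ?_⟩⟩
    · intro i j h
      fin_cases i <;> fin_cases j <;> simp_all
    · intro i j
      change G.Adj (![w, a, v, b, c] i) (![w, a, v, b, c] j) ↔ _
      fin_cases i <;> fin_cases j <;> simp [chairGraph, *]
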